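/- arXiv:2411.07017 — 4 statements merged into one kernel-verified Lean document; each statement's English description precedes it below -/
import Mathlib

section
/- Let r be a prime number. For n ≥ 1 let p_r(n) = #{σ ∈ S_n : σ = τ^r for some τ ∈ S_n} / n! be the probability that a uniformly random permutation in S_n has an r-th root. Then p_r(n) is monotonically nonincreasing in n, i.e., p_r(n+1) ≤ p_r(n) for all n ≥ 1. -/
namespace RthRoot

open Finset PowerSeries

/-- The cycle lengths of the `r`-th power of a cycle of length `l`, for `r` prime. -/
def cyclePowType (r l : ℕ) : Multiset ℕ :=
  if r ∣ l then (Multiset.replicate r (l / r)).filter (2 ≤ ·) else {l}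

section Perm

variable {α : Type*} [Fintype α] [DecidableEq α]

open Equiv Equiv.Perm

theorem cycleType_pow_of_isCycle_of_dvd {r : ℕ} (hr : 0 < r) {τ : Perm α} (hτ : τ.IsCycle)
    (h : r ∣ #τ.support) (h2 : 2 ≤ #τ.support / r) :
    (τ ^ r).cycleType = Multiset.replicate r (#τ.support / r) := by
  obtain ⟨m, hm⟩ := h
  have hdiv : #τ.support / r = m := by rw [hm, Nat.mul_div_cancel_left _ hr]
  rw [hdiv] at h2 ⊢
  have hord : orderOf τ = r * m := by rw [hτ.orderOf, hm]
  have hfix : ∀ k x, ((τ ^ r) ^ k) x = x → x ∈ τ.support → m ∣ k := by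
    intro k x hx hxs
    rw [← pow_mul] at hx
    have h1 : τ ^ (r * k) = 1 := hτ.pow_eq_one_iff.2 ⟨x, mem_support.1 hxs, hx⟩
    have := orderOf_dvd_of_pow_eq_one h1
    rw [hord] at this
    exact Nat.dvd_of_mul_dvd_mul_left hr this
  have hpow : (τ ^ r) ^ m = 1 := by rw [← pow_mul, ← hord, pow_orderOf_eq_one]
  have hsupp : (τ ^ r).support = τ.support := by
    refine le_antisymm (support_pow_le _ _) fun x hx => ?_
    rw [mem_support]
    intro h
    have := Nat.le_of_dvd one_pos (hfix 1 x (by simpa using h) hx)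
    omega
  have hall : ∀ l ∈ (τ ^ r).cycleType, l = m := by
    intro l hl
    obtain ⟨c, σ', hmul, hdisj, hc, rfl⟩ := mem_cycleType_iff.1 hl
    refine Nat.dvd_antisymm ?_ ?_
    · have := dvd_of_mem_cycleType hl
      exact this.trans (orderOf_dvd_of_pow_eq_one hpow)
    · obtain ⟨x, hx⟩ := hc.nonempty_support
      have hxσ : σ' x = x := (hdisj x).resolve_left (mem_support.1 hx)
      refine hfix _ x ?_ ?_
      · rw [hmul, hdisj.commute.mul_pow, ← hc.orderOf, pow_orderOf_eq_one, one_mul]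
        exact pow_apply_eq_self_of_apply_eq_self hxσ _
      · rw [← hsupp, hmul, hdisj.support_mul]
        exact mem_union_left _ hx
  have hrep := Multiset.eq_replicate_card.2 hall
  have hsum := sum_cycleType (τ ^ r)
  rw [hrep, Multiset.sum_replicate, hsupp, hm, smul_eq_mul] at hsum
  rw [hrep, Nat.eq_of_mul_eq_mul_right (by omega) hsum]

theorem cycleType_pow_of_isCycle {r : ℕ} (hr : r.Prime) {τ : Perm α} (hτ : τ.IsCycle) :
    (τ ^ r).cycleType = cyclePowType r #τ.support := by
  unfold cyclePowType
  split_ifs with h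
  · by_cases h2 : 2 ≤ #τ.support / r
    · rw [cycleType_pow_of_isCycle_of_dvd hr.pos hτ h h2, Multiset.filter_eq_self.2]
      intro a ha
      rwa [Multiset.eq_of_mem_replicate ha]
    · rw [Multiset.filter_eq_nil.2, cycleType_eq_zero]
      · apply orderOf_dvd_iff_pow_eq_one.1
        rw [hτ.orderOf]
        obtain ⟨m, hm⟩ := h
        rw [hm, Nat.mul_div_cancel_left _ hr.pos] at h2
        rw [hm]
        have := hτ.two_le_card_support
        interval_cases m <;> simp_all
      · intro a ha
        rwa [Multiset.eq_of_mem_replicate ha]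
  · have hcop : r.Coprime (orderOf τ) := by rw [hτ.orderOf]; exact hr.coprime_iff_not_dvd.2 h
    have hsupp : (τ ^ r).support = τ.support := support_pow_coprime hcop
    have hc : (τ ^ r).IsCycle := (hτ.pow_iff).2 hcop
    rw [hc.cycleType, hsupp]

theorem cycleType_pow_prime {r : ℕ} (hr : r.Prime) (τ : Perm α) :
    (τ ^ r).cycleType = τ.cycleType.bind (cyclePowType r) := by
  induction τ using cycle_induction_on with
  | base_one => simp
  | base_cycles σ hσ => rw [cycleType_pow_of_isCycle hr hσ, hσ.cycleType, Multiset.singleton_bind]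
  | induction_disjoint σ τ hd _ h1 h2 =>
    rw [hd.commute.mul_pow, (hd.pow_disjoint_pow r r).cycleType_mul, hd.cycleType_mul, h1, h2,
      Multiset.add_bind]

theorem dvd_count_bind_cyclePowType {r l : ℕ} (hl : r ∣ l) (m : Multiset ℕ) :
    r ∣ (m.bind (cyclePowType r)).count l := by
  rw [Multiset.count_bind]
  refine Multiset.dvd_sum fun x hx => ?_
  obtain ⟨a, -, rfl⟩ := Multiset.mem_map.1 hx
  unfold cyclePowType
  split_ifs with h
  · rw [Multiset.count_filter]
    split_ifs
    · rw [Multiset.count_replicate]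
      split_ifs <;> simp
    · simp
  · rw [Multiset.count_singleton, if_neg (by rintro rfl; exact h hl)]
    exact dvd_zero r

theorem exists_bind_cyclePowType_eq {r : ℕ} (hr : 0 < r) (m : Multiset ℕ) (h2 : ∀ a ∈ m, 2 ≤ a)
    (h : ∀ l, r ∣ l → r ∣ m.count l) :
    ∃ m' : Multiset ℕ, m'.bind (cyclePowType r) = m ∧ m'.sum = m.sum ∧ ∀ a ∈ m', 2 ≤ a := by
  induction m using Multiset.strongInductionOn with
  | ih m ih =>
  by_cases hm : ∃ l ∈ m, r ∣ l
  · obtain ⟨l, hlm, hl⟩ := hm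
    have hle : Multiset.replicate r l ≤ m :=
      Multiset.le_count_iff_replicate_le.1
        (Nat.le_of_dvd (Multiset.count_pos.2 hlm) (h l hl))
    obtain ⟨m₀, rfl⟩ := Multiset.le_iff_exists_add.1 hle
    have hlt : m₀ < Multiset.replicate r l + m₀ := by
      refine Multiset.lt_iff_cons_le.2 ⟨l, ?_⟩
      rw [← Multiset.singleton_add, Multiset.add_le_add_iff_right, Multiset.singleton_le]
      exact Multiset.mem_replicate.2 ⟨hr.ne', rfl⟩
    obtain ⟨m', hb, hs, hp⟩ := ih m₀ hlt (fun a ha => h2 a (Multiset.mem_add.2 (Or.inr ha))) (by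
      intro k hk
      have := h k hk
      rw [Multiset.count_add, Multiset.count_replicate] at this
      split_ifs at this
      · exact (Nat.dvd_add_right dvd_rfl).1 this
      · simpa using this)
    have hl2 := h2 l hlm
    refine ⟨(r * l) ::ₘ m', ?_, ?_, ?_⟩
    · rw [Multiset.cons_bind, hb, cyclePowType, if_pos (dvd_mul_right r l),
        Nat.mul_div_cancel_left _ hr, Multiset.filter_eq_self.2]
      intro a ha
      rwa [Multiset.eq_of_mem_replicate ha]
    · simp [hs]
    · intro a ha
      rcases Multiset.mem_cons.1 ha with rfl | ha
      · nlinarith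
      · exact hp a ha
  · push Not at hm
    refine ⟨m, ?_, rfl, h2⟩
    rw [Multiset.bind_congr (g := fun a => {a}) fun a ha => by
      rw [cyclePowType, if_neg (hm a ha)]]
    rw [Multiset.bind_singleton, Multiset.map_id']

theorem exists_pow_eq_iff {r : ℕ} (hr : r.Prime) (σ : Perm α) :
    (∃ τ : Perm α, τ ^ r = σ) ↔ ∀ l, r ∣ l → r ∣ σ.cycleType.count l := by
  constructor
  · rintro ⟨τ, rfl⟩ l hl
    rw [cycleType_pow_prime hr]
    exact dvd_count_bind_cyclePowType hl _
  · intro h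
    obtain ⟨m, hb, hs, hp⟩ := exists_bind_cyclePowType_eq hr.pos σ.cycleType
      (fun a => two_le_of_mem_cycleType) h
    obtain ⟨τ, rfl⟩ := (exists_with_cycleType_iff α).2 ⟨hs ▸ sum_cycleType_le σ, hp⟩
    rw [← cycleType_pow_prime hr] at hb
    obtain ⟨c, hc⟩ := isConj_iff.1 (isConj_of_cycleType_eq hb)
    exact ⟨c * τ * c⁻¹, by rw [conj_pow, hc]⟩

/-- The probability weight of having `c` cycles of length `i`. -/
def cycleWeight (i c : ℕ) : ℚ := 1 / (i ^ c * c.factorial)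

theorem parts_eq_add_replicate {n : ℕ} (p : n.Partition) :
    p.parts = p.parts.filter (2 ≤ ·) +
      Multiset.replicate (n - (p.parts.filter (2 ≤ ·)).sum) 1 := by
  have h1 := Multiset.filter_add_not (2 ≤ ·) p.parts
  have h2 := (Multiset.eq_replicate_card (s := p.parts.filter (¬ 2 ≤ ·)) (a := 1)).2 fun b hb => by
    obtain ⟨hb1, hb2⟩ := Multiset.mem_filter.1 hb
    have := p.parts_pos hb1
    omega
  rw [h2] at h1
  have h3 := congrArg Multiset.sum h1
  rw [Multiset.sum_add, p.parts_sum, Multiset.sum_replicate, smul_eq_mul, mul_one] at h3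
  rw [show n - _ = _ from Nat.sub_eq_of_eq_add' h3.symm]
  exact h1.symm

theorem partition_eq_iff (σ : Perm α) (p : (Fintype.card α).Partition) :
    σ.partition = p ↔ σ.cycleType = p.parts.filter (2 ≤ ·) := by
  constructor
  · rintro rfl
    exact filter_parts_partition_eq_cycleType.symm
  · intro h
    rw [Nat.Partition.ext_iff, parts_partition, ← sum_cycleType, h]
    exact (parts_eq_add_replicate p).symm

theorem prod_factorial_count_add_replicate_one (m : Multiset ℕ) (hm : 1 ∉ m) (k : ℕ) :
    ∏ i ∈ (m + Multiset.replicate k 1).toFinset,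
      ((m + Multiset.replicate k 1).count i).factorial =
    k.factorial * ∏ i ∈ m.toFinset, (m.count i).factorial := by
  rw [Finset.prod_subset (s₂ := insert 1 m.toFinset), Finset.prod_insert (by simpa using hm)]
  · congr 1
    · simp [Multiset.count_eq_zero_of_notMem hm]
    · refine Finset.prod_congr rfl fun i hi => ?_
      have : (1 : ℕ) ≠ i := by rintro rfl; exact hm (Multiset.mem_toFinset.1 hi)
      rw [Multiset.count_add, Multiset.count_replicate, if_neg this, add_zero]
  · intro i hi
    simp only [Multiset.mem_toFinset, Multiset.mem_add, Multiset.mem_replicate,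
      Finset.mem_insert] at hi ⊢
    tauto
  · intro i _ hi
    rw [Multiset.mem_toFinset] at hi
    rw [Multiset.count_eq_zero_of_notMem hi, Nat.factorial_zero]

theorem card_partition_eq (p : (Fintype.card α).Partition) :
    (#{σ : Perm α | σ.partition = p} : ℚ) / (Fintype.card α).factorial =
      ∏ i ∈ p.parts.toFinset, cycleWeight i (p.parts.count i) := by
  have hp := parts_eq_add_replicate p
  simp only [partition_eq_iff]
  set m := p.parts.filter (2 ≤ ·) with hm
  have hm2 : ∀ a ∈ m, 2 ≤ a := fun a ha => (Multiset.mem_filter.1 ha).2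
  have hsum : m.sum ≤ Fintype.card α := by
    have := congrArg Multiset.sum hp
    rw [p.parts_sum, Multiset.sum_add] at this
    omega
  have hcard := card_of_cycleType_mul_eq α m
  rw [if_pos ⟨hsum, hm2⟩] at hcard
  have hprod : p.parts.prod * ∏ i ∈ p.parts.toFinset, (p.parts.count i).factorial =
      (Fintype.card α - m.sum).factorial * m.prod * ∏ n ∈ m.toFinset, (m.count n).factorial := by
    rw [hp, prod_factorial_count_add_replicate_one m (fun h => by simpa using hm2 1 h),
      Multiset.prod_add, Multiset.prod_replicate, one_pow]
    ring
  rw [← hprod, Finset.prod_multiset_count, ← Finset.prod_mul_distrib] at hcard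
  have hne : ((Fintype.card α).factorial : ℚ) ≠ 0 := by positivity
  simp only [cycleWeight]
  rw [Finset.prod_div_distrib, Finset.prod_const_one]
  rw [← hcard] at hne ⊢
  push_cast at hne ⊢
  rw [div_mul_eq_div_div, div_self (left_ne_zero_of_mul hne)]

theorem card_div_factorial_eq_coeff (Φ : ℕ → ℕ → Prop) [∀ i c, Decidable (Φ i c)] :
    (#{σ : Perm α | ∀ i ∈ σ.partition.parts, Φ i (σ.partition.parts.count i)} : ℚ) /
      (Fintype.card α).factorial =
    (Nat.Partition.genFun fun i c => if Φ i c then cycleWeight i c else 0).coeff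
      (Fintype.card α) := by
  rw [Nat.Partition.coeff_genFun, Finset.card_eq_sum_card_fiberwise (f := fun σ => σ.partition)
    (t := univ) (by simp), Nat.cast_sum, Finset.sum_div]
  refine Finset.sum_congr rfl fun p _ => ?_
  rw [Finsupp.prod, Finset.prod_ite_zero]
  simp only [Multiset.toFinsupp_support, Multiset.mem_toFinset, Multiset.toFinsupp_apply]
  split_ifs with h
  · rw [Finset.filter_filter]
    rw [← card_partition_eq p]
    congr! 4 with σ
    rw [and_iff_right_iff_imp]
    rintro rfl
    exact h
  · rw [Finset.filter_filter, Finset.filter_eq_empty_iff.2]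
    · simp
    · rintro σ - ⟨h1, rfl⟩
      exact h h1

end Perm

section GenFun

open Nat.Partition
open scoped PowerSeries.WithPiTopology

theorem genFun_eq_mul {f g h : ℕ → ℕ → ℚ}
    (H : ∀ i, (∀ c, f i (c + 1) = g i (c + 1) ∧ h i (c + 1) = 0) ∨
      ∀ c, f i (c + 1) = h i (c + 1) ∧ g i (c + 1) = 0) :
    genFun f = genFun g * genFun h := by
  refine (hasProd_genFun f).unique ?_
  convert! (hasProd_genFun g).mul (hasProd_genFun h) using 2 with i
  rcases H (i + 1) with H | H <;> simp [H]

variable {f : ℕ → ℕ → ℚ}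

theorem toFinsupp_prod_eq_prod_range (h0 : ∀ i, f i 0 = 1) {n N : ℕ} (p : n.Partition)
    (hN : n ≤ N) :
    p.parts.toFinsupp.prod f = ∏ j ∈ range (N + 1), f j (p.parts.count j) := by
  refine Finsupp.prod_of_support_subset _ ?_ _ fun i _ => h0 i
  intro j hj
  rw [Multiset.toFinsupp_support, Multiset.mem_toFinset] at hj
  exact mem_range.2 (Nat.lt_succ_of_le ((le_of_mem_parts hj).trans hN))

theorem sum_mul_count {n : ℕ} (p : n.Partition) :
    ∑ i ∈ range (n + 1), i * p.parts.count i = n := by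
  conv_rhs => rw [← p.parts_sum, Finset.sum_multiset_count]
  refine (Finset.sum_subset (s₁ := p.parts.toFinset) (fun j hj => ?_) fun j _ hj => ?_).symm.trans
    (Finset.sum_congr rfl fun j _ => by rw [smul_eq_mul, mul_comm])
  · exact mem_range.2 (Nat.lt_succ_of_le (le_of_mem_parts (Multiset.mem_toFinset.1 hj)))
  · rw [Multiset.count_eq_zero_of_notMem (by simpa using hj), mul_zero]

theorem mul_count_le {n : ℕ} (p : n.Partition) (i : ℕ) : i * p.parts.count i ≤ n := by
  by_cases hi : i ∈ range (n + 1)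
  · conv_rhs => rw [← sum_mul_count p]
    exact single_le_sum (f := fun i => i * p.parts.count i) (fun _ _ => Nat.zero_le _) hi
  · rw [Multiset.count_eq_zero_of_notMem, mul_zero]
    · exact n.zero_le
    · intro h
      exact hi (mem_range.2 (Nat.lt_succ_of_le (le_of_mem_parts h)))

/-- Adjoin `k` parts equal to `i` to a partition. -/
def addParts {i : ℕ} (hi : 0 < i) (k : ℕ) {m : ℕ} (q : m.Partition) : (m + i * k).Partition where
  parts := q.parts + Multiset.replicate k i
  parts_pos {j} hj := by
    rcases Multiset.mem_add.1 hj with h | h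
    · exact q.parts_pos h
    · rwa [Multiset.eq_of_mem_replicate h]
  parts_sum := by
    rw [Multiset.sum_add, q.parts_sum, Multiset.sum_replicate, smul_eq_mul, mul_comm]

theorem count_addParts {i : ℕ} (hi : 0 < i) (k : ℕ) {m : ℕ} (q : m.Partition) (j : ℕ) :
    (addParts hi k q).parts.count j = q.parts.count j + if i = j then k else 0 := by
  rw [addParts, Multiset.count_add, Multiset.count_replicate]

theorem addParts_injective {i : ℕ} (hi : 0 < i) (k m : ℕ) :
    Function.Injective (addParts hi k : m.Partition → (m + i * k).Partition) := by
  intro p q h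
  exact Nat.Partition.ext (add_right_cancel (congrArg Nat.Partition.parts h))

theorem exists_addParts_eq {i : ℕ} (hi : 0 < i) {k m : ℕ} (p : (m + i * k).Partition)
    (hp : k ≤ p.parts.count i) : ∃ q : m.Partition, addParts hi k q = p := by
  obtain ⟨s, hs⟩ := Multiset.le_iff_exists_add.1 (Multiset.le_count_iff_replicate_le.1 hp)
  have hsum := p.parts_sum
  rw [hs, Multiset.sum_add, Multiset.sum_replicate, smul_eq_mul, mul_comm, add_comm] at hsum
  refine ⟨⟨s, fun {j} hj => p.parts_pos ?_, Nat.add_right_cancel hsum⟩, ?_⟩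
  · rw [hs]
    exact Multiset.mem_add.2 (Or.inr hj)
  · exact Nat.Partition.ext ((add_comm _ _).trans hs.symm)

theorem sum_count_mul_prod (h0 : ∀ i, f i 0 = 1) {g : ℕ → ℚ} {i k : ℕ} (hi : 0 < i)
    (hlow : ∀ c < k, c * f i c = 0) (hg : ∀ c, ((c + k : ℕ) : ℚ) * f i (c + k) = g c * f i c)
    (m : ℕ) :
    ∑ p : (m + i * k).Partition, p.parts.count i * p.parts.toFinsupp.prod f =
      ∑ q : m.Partition, g (q.parts.count i) * q.parts.toFinsupp.prod f := by
  have hsplit : ∀ {n : ℕ} (p : n.Partition), n ≤ m + i * k →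
      p.parts.toFinsupp.prod f = f i (p.parts.count i) *
        ∏ j ∈ (range (m + i * k + i + 1)).erase i, f j (p.parts.count j) := by
    intro n p hn
    rw [toFinsupp_prod_eq_prod_range h0 p (hn.trans (Nat.le_add_right _ i)),
      mul_prod_erase _ (fun j => f j (p.parts.count j)) (mem_range.2 (by omega))]
  refine (sum_of_injOn (addParts hi k) (addParts_injective hi k m).injOn (by simp) ?_ ?_).symm
  · intro p _ hp
    rw [hsplit p le_rfl, ← mul_assoc, hlow, zero_mul]
    by_contra! h
    obtain ⟨q, hq⟩ := exists_addParts_eq hi p h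
    exact hp ⟨q, by simp, hq⟩
  · intro q _
    rw [hsplit _ (Nat.le_add_right m _), hsplit _ le_rfl, count_addParts, if_pos rfl, ← mul_assoc,
      ← mul_assoc, hg]
    congr 1
    refine prod_congr rfl fun j hj => ?_
    rw [count_addParts, if_neg (ne_of_mem_erase hj).symm, add_zero]

theorem mul_coeff_genFun (h0 : ∀ i, f i 0 = 1) {g : ℕ → ℕ → ℚ} {k : ℕ}
    (hlow : ∀ i, 0 < i → ∀ c < k, c * f i c = 0)
    (hg : ∀ i, 0 < i → ∀ c, ((c + k : ℕ) : ℚ) * f i (c + k) = g i c * f i c) (n : ℕ) :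
    n * (genFun f).coeff n = ∑ i ∈ range (n + 1), if i * k ≤ n then
      i * ∑ q : (n - i * k).Partition, g i (q.parts.count i) * q.parts.toFinsupp.prod f else 0 := by
  have h1 : n * (genFun f).coeff n = ∑ i ∈ range (n + 1), (i : ℚ) *
      ∑ p : n.Partition, p.parts.count i * p.parts.toFinsupp.prod f := by
    simp only [coeff_genFun, mul_sum]
    rw [sum_comm]
    refine sum_congr rfl fun p _ => ?_
    have hn := congrArg (Nat.cast : ℕ → ℚ) (sum_mul_count p)
    push_cast at hn
    rw [← hn, sum_mul]
    exact sum_congr rfl fun i _ => mul_assoc _ _ _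
  rw [h1]
  refine sum_congr rfl fun i _ => ?_
  rcases Nat.eq_zero_or_pos i with rfl | hi
  · simp
  split_ifs with h
  · obtain ⟨m, rfl⟩ := Nat.exists_eq_add_of_le' h
    rw [sum_count_mul_prod h0 hi (hlow i hi) (hg i hi), Nat.add_sub_cancel]
  · rw [sum_eq_zero, mul_zero]
    intro p _
    have hc : p.parts.count i < k := by
      by_contra! hk
      exact h ((Nat.mul_le_mul_left i hk).trans (mul_count_le p i))
    rw [toFinsupp_prod_eq_prod_range h0 p (Nat.le_add_right n i),
      ← mul_prod_erase _ (fun j => f j (p.parts.count j)) (mem_range.2 (by omega : i < n + i + 1)),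
      ← mul_assoc, hlow i hi _ hc, zero_mul]

end GenFun

section Weights

open Nat.Partition

theorem cycleWeight_zero (i : ℕ) : cycleWeight i 0 = 1 := by simp [cycleWeight]

theorem cycleWeight_nonneg (i c : ℕ) : 0 ≤ cycleWeight i c := by
  unfold cycleWeight
  positivity

/-- Weights for permutations all of whose cycle lengths are coprime to `r`. -/
def coprimeWeight (r i c : ℕ) : ℚ := if r ∣ i then (if c = 0 then 1 else 0) else cycleWeight i c

/-- Weights for permutations all of whose cycle lengths are divisible by `r`. -/
def dvdWeight (r i c : ℕ) : ℚ := if r ∣ i then cycleWeight i c else if c = 0 then 1 else 0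

/-- Weights for permutations all of whose cycle lengths are divisible by `r`, each occurring
a multiple of `r` times. -/
def dvdRootWeight (r i c : ℕ) : ℚ :=
  if r ∣ i then (if r ∣ c then cycleWeight i c else 0) else if c = 0 then 1 else 0

theorem genFun_cycleWeight_eq_mul (r : ℕ) :
    genFun cycleWeight = genFun (coprimeWeight r) * genFun (dvdWeight r) :=
  genFun_eq_mul fun i => by
    by_cases h : r ∣ i <;> simp [coprimeWeight, dvdWeight, h]

theorem genFun_rootWeight_eq_mul (r : ℕ) :
    genFun (fun i c => if r ∣ i → r ∣ c then cycleWeight i c else 0) =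
      genFun (coprimeWeight r) * genFun (dvdRootWeight r) :=
  genFun_eq_mul fun i => by
    by_cases h : r ∣ i <;> simp [coprimeWeight, dvdRootWeight, h]

theorem mul_coeff_genFun_dvdWeight (r n : ℕ) :
    n * (genFun (dvdWeight r)).coeff n =
      ∑ i ∈ range (n + 1), if i ≠ 0 ∧ r ∣ i then (genFun (dvdWeight r)).coeff (n - i) else 0 := by
  rw [mul_coeff_genFun (k := 1) (g := fun i _ => if r ∣ i then 1 / (i : ℚ) else 0)
    (fun i => by simp [dvdWeight, cycleWeight_zero])
    (fun i _ c hc => by rw [Nat.lt_one_iff.1 hc, Nat.cast_zero, zero_mul])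
    (fun i hi c => ?_)]
  · refine sum_congr rfl fun i hi => ?_
    rw [mul_one, if_pos (Nat.lt_succ_iff.1 (mem_range.1 hi)), ← mul_sum, ← coeff_genFun]
    rcases Nat.eq_zero_or_pos i with rfl | h
    · simp
    · by_cases hr : r ∣ i
      · simp [hr, h.ne']
      · simp [hr]
  · have : (i : ℚ) ≠ 0 := by positivity
    by_cases hr : r ∣ i
    · simp only [dvdWeight, hr, cycleWeight, if_true, Nat.factorial_succ]
      push_cast
      field_simp
      ring
    · simp [dvdWeight, hr]

theorem succ_le_choose_add {r : ℕ} (hr : 0 < r) (c : ℕ) : c + 1 ≤ (c + r).choose r := by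
  induction r, hr using Nat.le_induction with
  | base => simp
  | succ k hk ih => exact ih.trans (by rw [← add_assoc, Nat.choose_succ_succ]; omega)

theorem add_mul_factorial_le {r : ℕ} (hr : 0 < r) (c : ℕ) :
    (c + r) * (r.factorial * c.factorial) ≤ r * (c + r).factorial := by
  rw [← Nat.add_choose_mul_factorial_mul_factorial c r]
  have h := succ_le_choose_add hr c
  calc (c + r) * (r.factorial * c.factorial)
      ≤ (r * (c + r).choose r) * (r.factorial * c.factorial) := by
        refine Nat.mul_le_mul_right _ ?_
        nlinarith
    _ = _ := by rw [← Nat.choose_symm_add (a := c) (b := r)]; ring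

theorem dvdRootWeight_nonneg (r i c : ℕ) : 0 ≤ dvdRootWeight r i c := by
  unfold dvdRootWeight
  split_ifs <;> simp [cycleWeight_nonneg]

theorem coeff_genFun_dvdRootWeight_nonneg (r n : ℕ) :
    0 ≤ (genFun (dvdRootWeight r)).coeff n := by
  rw [coeff_genFun]
  exact sum_nonneg fun p _ => prod_nonneg fun i _ => dvdRootWeight_nonneg r _ _

theorem mul_coeff_genFun_dvdRootWeight_le {r : ℕ} (hr : 0 < r) (n : ℕ) :
    n * (genFun (dvdRootWeight r)).coeff n ≤
      ∑ i ∈ range (n + 1), if i * r ≤ n then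
        i * (r / (i ^ r * r.factorial)) * (genFun (dvdRootWeight r)).coeff (n - i * r) else 0 := by
  rw [mul_coeff_genFun (k := r) (g := fun i c => if r ∣ i then
      ((c + r : ℕ) : ℚ) * c.factorial / (i ^ r * (c + r).factorial) else 0)
    (fun i => by simp [dvdRootWeight, cycleWeight_zero]) (fun i _ c hc => ?_) (fun i hi c => ?_)]
  · refine sum_le_sum fun i hi => ?_
    by_cases h : i * r ≤ n
    · rw [if_pos h, if_pos h, mul_assoc]
      refine mul_le_mul_of_nonneg_left ?_ (Nat.cast_nonneg i)
      rw [coeff_genFun, mul_sum]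
      refine sum_le_sum fun q _ => mul_le_mul_of_nonneg_right ?_
        (prod_nonneg fun i _ => dvdRootWeight_nonneg r _ _)
      split_ifs
      · rcases Nat.eq_zero_or_pos i with rfl | hi0
        · simp [hr.ne']
        rw [div_le_div_iff₀ (by positivity) (by positivity)]
        have := add_mul_factorial_le hr (q.parts.count i)
        have : ((q.parts.count i + r : ℕ) : ℚ) *
          (r.factorial * (q.parts.count i).factorial) ≤
            r * (q.parts.count i + r).factorial := by exact_mod_cast this
        have := mul_le_mul_of_nonneg_left this (by positivity : (0 : ℚ) ≤ i ^ r)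
        linarith
      · positivity
    · rw [if_neg h, if_neg h]
  · rcases Nat.eq_zero_or_pos c with rfl | h
    · simp
    · simp [dvdRootWeight, h.ne', Nat.not_dvd_of_pos_of_lt h hc]
  · have : (i : ℚ) ≠ 0 := by positivity
    by_cases hri : r ∣ i
    · simp only [dvdRootWeight, hri, if_true, Nat.dvd_add_self_right]
      split_ifs
      · simp only [cycleWeight, pow_add]
        field_simp
      · simp
    · simp [dvdRootWeight, hri, hr.ne']

end Weights

section PowerSeries

theorem coeff_X_mul_derivative (A : ℚ⟦X⟧) (n : ℕ) :
    coeff n (X * d⁄dX ℚ A) = n * coeff n A := by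
  cases n with
  | zero => simp
  | succ n =>
    rw [coeff_succ_X_mul, coeff_derivative]
    push_cast
    ring

/-- The power series `∑ X ^ i` over the positive multiples `i` of `r`. -/
noncomputable def multiplesSeries (r : ℕ) : ℚ⟦X⟧ :=
  PowerSeries.mk fun i => if i ≠ 0 ∧ r ∣ i then 1 else 0

theorem one_sub_X_pow_mul_multiplesSeries {r : ℕ} (hr : 0 < r) :
    (1 - X ^ r) * multiplesSeries r = X ^ r := by
  ext n
  rw [sub_mul, one_mul, map_sub, coeff_X_pow_mul', coeff_X_pow, multiplesSeries, coeff_mk]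
  by_cases h : r ≤ n
  · obtain ⟨m, rfl⟩ := Nat.exists_eq_add_of_le h
    rcases Nat.eq_zero_or_pos m with rfl | hm
    · simp [hr.ne']
    · simp [hr.ne', hm.ne']
  · have h1 : ¬(n ≠ 0 ∧ r ∣ n) := fun ⟨h0, hdvd⟩ =>
      h (Nat.le_of_dvd (Nat.pos_of_ne_zero h0) hdvd)
    rw [if_neg h1, if_neg h, if_neg (by omega), sub_zero]

theorem coeff_recurrence {r : ℕ} (hr : 0 < r) {D B : ℚ⟦X⟧} (hDB : D * B = 1)
    (hB : ∀ n : ℕ, n * B.coeff n =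
      ∑ i ∈ range (n + 1), if i ≠ 0 ∧ r ∣ i then B.coeff (n - i) else 0) (n : ℕ) :
    (n : ℚ) * D.coeff n = if r ≤ n then ((n : ℚ) - r - 1) * D.coeff (n - r) else 0 := by
  have hXB : X * d⁄dX ℚ B = multiplesSeries r * B := by
    ext n
    rw [coeff_X_mul_derivative, hB, coeff_mul, Nat.sum_antidiagonal_eq_sum_range_succ_mk]
    exact sum_congr rfl fun i _ => by simp [multiplesSeries]
  have hB0 : B ≠ 0 := right_ne_zero_of_mul_eq_one hDB
  have hder : D * d⁄dX ℚ B + B * d⁄dX ℚ D = 0 := by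
    have := congrArg (d⁄dX ℚ) hDB
    simpa [Derivation.leibniz] using this
  have hXD : X * d⁄dX ℚ D = - (multiplesSeries r * D) := by
    apply mul_right_cancel₀ hB0
    linear_combination X * hder - D * hXB
  have hmain : X * d⁄dX ℚ D = X ^ r * (X * d⁄dX ℚ D) - X ^ r * D := by
    linear_combination (1 - X ^ r) * hXD - D * one_sub_X_pow_mul_multiplesSeries hr
  have := congrArg (coeff n) hmain
  rw [map_sub, coeff_X_mul_derivative, coeff_X_pow_mul', coeff_X_pow_mul'] at this
  rw [this]
  split_ifs with h
  · rw [coeff_X_mul_derivative]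
    push_cast [h]
    ring
  · simp

variable {r : ℕ} {d : ℕ → ℚ}

theorem nonpos_of_recurrence (hr : 2 ≤ r) (h0 : d 0 = 1)
    (hd : ∀ n : ℕ, (n : ℚ) * d n = if r ≤ n then ((n : ℚ) - r - 1) * d (n - r) else 0)
    (n : ℕ) (hn : 0 < n) : d n ≤ 0 := by
  induction n using Nat.strong_induction_on with
  | _ n ih =>
  have hn' : (0 : ℚ) < n := by positivity
  refine nonpos_of_mul_nonpos_right (le_of_eq_of_le (hd n) ?_) hn'
  split_ifs with h
  · obtain ⟨m, rfl⟩ := Nat.exists_eq_add_of_le h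
    rw [Nat.add_sub_cancel_left]
    rcases Nat.eq_zero_or_pos m with rfl | hm
    · simp [h0]
    · have h1 : (1 : ℚ) ≤ m := by exact_mod_cast hm
      refine mul_nonpos_of_nonneg_of_nonpos ?_ (ih m (by omega) hm)
      push_cast
      linarith
  · exact le_rfl

theorem le_neg_one_div_of_recurrence (hr : 2 ≤ r) (h0 : d 0 = 1)
    (hd : ∀ n : ℕ, (n : ℚ) * d n = if r ≤ n then ((n : ℚ) - r - 1) * d (n - r) else 0)
    (k : ℕ) : 1 / (r * (k + 1) ^ 2 : ℚ) ≤ -d ((k + 1) * r) := by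
  have hr' : (2 : ℚ) ≤ r := by exact_mod_cast hr
  induction k with
  | zero =>
    have := hd r
    rw [if_pos le_rfl, Nat.sub_self, h0] at this
    rw [div_le_iff₀ (by positivity)]
    simp only [zero_add, one_mul]
    push_cast
    linarith
  | succ k ih =>
    have := hd ((k + 1 + 1) * r)
    rw [if_pos (by nlinarith), add_mul (k + 1) 1 r, one_mul, Nat.add_sub_cancel,
      ← Nat.succ_mul, Nat.succ_eq_add_one] at this
    push_cast at this ⊢
    have hk : (0 : ℚ) ≤ k := k.cast_nonneg
    set e := d ((k + 1) * r)
    set e' := d ((k + 1 + 1) * r)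
    have hpos : (0 : ℚ) < (k + 1 + 1) * r := by positivity
    refine le_of_mul_le_mul_left ?_ hpos
    have hc : (0 : ℚ) ≤ (k + 1) * r - 1 := by nlinarith
    calc ((k + 1 + 1) * r : ℚ) * (1 / (r * (k + 1 + 1) ^ 2)) = 1 / (k + 1 + 1) := by
          field_simp
      _ ≤ ((k + 1) * r - 1) * (1 / (r * (k + 1) ^ 2)) := by
          rw [mul_one_div, div_le_div_iff₀ (by positivity) (by positivity)]
          nlinarith [mul_nonneg hk (sub_nonneg.2 hr')]
      _ ≤ ((k + 1) * r - 1) * (-e) := mul_le_mul_of_nonneg_left ih hc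
      _ = (k + 1 + 1) * r * -e' := by linarith

end PowerSeries

section Monotonicity

open Nat.Partition

theorem mul_div_factorial_le {r i n : ℕ} (hr : 2 ≤ r) (hi : 0 < i) (hin : i * r ≤ n) :
    (i * (r / (i ^ r * r.factorial)) : ℚ) ≤ n * (1 / (r * i ^ 2)) := by
  have hr0 : 0 < r := by omega
  have h1 : (r : ℚ) ≤ r.factorial := by exact_mod_cast r.self_le_factorial
  have h2 : (i : ℚ) ^ 2 ≤ i ^ r := pow_le_pow_right₀ (by exact_mod_cast hi) hr
  have h3 : (i : ℚ) * r ≤ n := by exact_mod_cast hin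
  calc (i * (r / (i ^ r * r.factorial)) : ℚ) = i * r * (1 / (r.factorial * i ^ r)) := by
        field_simp
    _ ≤ n * (1 / (r * i ^ 2)) := by gcongr

theorem coeff_mul_nonpos {r : ℕ} (hr : 2 ≤ r) {D G : ℚ⟦X⟧} (hD0 : D.coeff 0 = 1)
    (hDrec : ∀ n : ℕ, (n : ℚ) * D.coeff n =
      if r ≤ n then ((n : ℚ) - r - 1) * D.coeff (n - r) else 0)
    (hG : ∀ n, 0 ≤ G.coeff n)
    (hGrec : ∀ n : ℕ, n * G.coeff n ≤ ∑ i ∈ range (n + 1), if i * r ≤ n then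
        i * (r / (i ^ r * r.factorial)) * G.coeff (n - i * r) else 0)
    (n : ℕ) (hn : 0 < n) : (D * G).coeff n ≤ 0 := by
  have hr0 : 0 < r := by omega
  have hn' : (0 : ℚ) < n := by positivity
  have hDneg : ∀ k, 0 < k → 0 ≤ -D.coeff k := fun k hk =>
    neg_nonneg.2 (nonpos_of_recurrence hr hD0 hDrec k hk)
  have hterm : ∀ i ∈ range (n + 1), (if i * r ≤ n then
      (i * (r / (i ^ r * r.factorial)) : ℚ) * G.coeff (n - i * r) else 0) ≤
      n * if 0 < i ∧ i * r ≤ n then -D.coeff (i * r) * G.coeff (n - i * r) else 0 := by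
    intro i _
    by_cases h : i * r ≤ n
    · rcases Nat.eq_zero_or_pos i with rfl | hi
      · simp
      rw [if_pos h, if_pos ⟨hi, h⟩, ← mul_assoc]
      refine mul_le_mul_of_nonneg_right ?_ (hG _)
      refine (mul_div_factorial_le hr hi h).trans (mul_le_mul_of_nonneg_left ?_ hn'.le)
      obtain ⟨k, rfl⟩ := Nat.exists_eq_add_of_le' hi
      exact_mod_cast le_neg_one_div_of_recurrence hr hD0 hDrec k
    · rw [if_neg h, if_neg (fun h' => h h'.2), mul_zero]
  have hsum : G.coeff n ≤
      ∑ i ∈ range (n + 1) with 0 < i ∧ i * r ≤ n, -D.coeff (i * r) * G.coeff (n - i * r) := by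
    rw [sum_filter]
    refine le_of_mul_le_mul_left ?_ hn'
    rw [mul_sum]
    exact (hGrec n).trans (sum_le_sum hterm)
  have hinj : Function.Injective fun i : ℕ => i * r :=
    fun _ _ h => Nat.eq_of_mul_eq_mul_right hr0 h
  have hle : ∑ i ∈ range (n + 1) with 0 < i ∧ i * r ≤ n, -D.coeff (i * r) * G.coeff (n - i * r) ≤
      ∑ k ∈ (range (n + 1)).erase 0, -D.coeff k * G.coeff (n - k) := by
    rw [← sum_image (f := fun k => -D.coeff k * G.coeff (n - k)) hinj.injOn]
    refine sum_le_sum_of_subset_of_nonneg ?_ fun k hk _ =>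
      mul_nonneg (hDneg k (Nat.pos_of_ne_zero (ne_of_mem_erase hk))) (hG _)
    intro k hk
    obtain ⟨i, hi, rfl⟩ := mem_image.1 hk
    obtain ⟨-, hi0, hin⟩ := mem_filter.1 hi
    exact mem_erase.2 ⟨(Nat.mul_pos hi0 hr0).ne', mem_range.2 (Nat.lt_succ_of_le hin)⟩
  rw [coeff_mul, Nat.sum_antidiagonal_eq_sum_range_succ_mk,
    ← add_sum_erase _ _ (mem_range.2 n.succ_pos)]
  have := hsum.trans hle
  simp only [neg_mul, sum_neg_distrib] at this
  simp only [hD0, Nat.sub_zero, one_mul]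
  linarith

theorem coeff_genFun_cycleWeight (n : ℕ) : (genFun cycleWeight).coeff n = 1 := by
  have h := card_div_factorial_eq_coeff (α := Fin n) fun _ _ => True
  simp only [imp_true_iff, filter_true, if_true, card_univ, Fintype.card_perm,
    Fintype.card_fin] at h
  rw [← h, div_self (by positivity)]

theorem one_sub_X_mul_genFun_cycleWeight : (1 - X) * genFun cycleWeight = 1 := by
  have h : genFun cycleWeight = PowerSeries.mk 1 := by
    ext n
    rw [coeff_genFun_cycleWeight, coeff_mk, Pi.one_apply]
  rw [h, mul_comm, mk_one_mul_one_sub_eq_one]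

theorem forall_dvd_count_iff {α : Type*} [Fintype α] [DecidableEq α] {r : ℕ} (hr : r ≠ 1)
    (σ : Equiv.Perm α) :
    (∀ l, r ∣ l → r ∣ σ.cycleType.count l) ↔
      ∀ i ∈ σ.partition.parts, r ∣ i → r ∣ σ.partition.parts.count i := by
  have hcount : ∀ l, r ∣ l → σ.partition.parts.count l = σ.cycleType.count l := by
    intro l hl
    have h1 : 1 ≠ l := by
      rintro rfl
      exact hr (Nat.dvd_one.1 hl)
    rw [Equiv.Perm.parts_partition, Multiset.count_add, Multiset.count_replicate, if_neg h1,
      add_zero]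
  refine ⟨fun h i _ hi => hcount i hi ▸ h i hi, fun h l hl => ?_⟩
  rw [← hcount l hl]
  by_cases hmem : l ∈ σ.partition.parts
  · exact h l hmem hl
  · rw [Multiset.count_eq_zero_of_notMem hmem]
    exact dvd_zero r

theorem card_exists_pow_div_factorial {r : ℕ} (hr : r.Prime) (n : ℕ) :
    (Nat.card {σ : Equiv.Perm (Fin n) // ∃ τ : Equiv.Perm (Fin n), τ ^ r = σ} : ℚ) /
      (n.factorial : ℚ) =
    (genFun fun i c => if r ∣ i → r ∣ c then cycleWeight i c else 0).coeff n := by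
  have h := card_div_factorial_eq_coeff (α := Fin n) fun i c => r ∣ i → r ∣ c
  simp only [← forall_dvd_count_iff hr.ne_one, ← exists_pow_eq_iff hr] at h
  rw [Nat.card_eq_fintype_card, Fintype.card_subtype]
  simpa only [Fintype.card_fin] using h

end Monotonicity

end RthRoot

/-- For a prime `r`, the probability `p_r(n)` that a uniformly random
permutation in `S_n` has an `r`-th root is monotonically nonincreasing in `n`. -/
theorem prob_rth_root_antitone (r : ℕ) (hr : r.Prime) (n : ℕ) (hn : 1 ≤ n) :
    (Nat.card {σ : Equiv.Perm (Fin (n + 1)) // ∃ τ : Equiv.Perm (Fin (n + 1)), τ ^ r = σ} : ℚ) /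
        (Nat.factorial (n + 1) : ℚ) ≤
      (Nat.card {σ : Equiv.Perm (Fin n) // ∃ τ : Equiv.Perm (Fin n), τ ^ r = σ} : ℚ) /
        (Nat.factorial n : ℚ) := by
  rw [RthRoot.card_exists_pow_div_factorial hr, RthRoot.card_exists_pow_div_factorial hr]
  set P := Nat.Partition.genFun fun i c => if r ∣ i → r ∣ c then RthRoot.cycleWeight i c else 0
    with hP
  set D := (1 - PowerSeries.X) * Nat.Partition.genFun (RthRoot.coprimeWeight r) with hD
  have hDB : D * Nat.Partition.genFun (RthRoot.dvdWeight r) = 1 := by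
    rw [hD, mul_assoc, ← RthRoot.genFun_cycleWeight_eq_mul,
      RthRoot.one_sub_X_mul_genFun_cycleWeight]
  have hD0 : D.coeff 0 = 1 := by
    rw [hD, PowerSeries.coeff_mul, Finset.Nat.antidiagonal_zero, Finset.sum_singleton,
      Nat.Partition.coeff_genFun]
    simp
  have h := RthRoot.coeff_mul_nonpos hr.two_le hD0
    (RthRoot.coeff_recurrence hr.pos hDB (RthRoot.mul_coeff_genFun_dvdWeight r))
    (RthRoot.coeff_genFun_dvdRootWeight_nonneg r)
    (RthRoot.mul_coeff_genFun_dvdRootWeight_le hr.pos) (n + 1) n.succ_pos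
  rw [hD, mul_assoc, ← RthRoot.genFun_rootWeight_eq_mul, ← hP, sub_mul, one_mul, map_sub,
    PowerSeries.coeff_succ_X_mul] at h
  exact sub_nonpos.1 h
end

section
/- Let G be a finite group. Then the number of real conjugacy classes of G equals s(2)/|G|, where s(2) = #{(a, b) ∈ G × G : a² b² = 1}. In particular, |G| divides s(2). -/
open scoped Pointwise

theorem ConjClasses.carrier_inv_eq_iff {G : Type*} [Group G] (c : G) :
    (ConjClasses.mk c).carrier⁻¹ = (ConjClasses.mk c).carrier ↔ IsConj c c⁻¹ := by
  have hmem (x : G) : x ∈ (ConjClasses.mk c).carrier ↔ IsConj c x := by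
    rw [ConjClasses.mem_carrier_iff_mk_eq, ConjClasses.mk_eq_mk_iff_isConj, isConj_comm]
  have inv {x y : G} (h : IsConj x y) : IsConj x⁻¹ y⁻¹ := by
    obtain ⟨g, rfl⟩ := isConj_iff.1 h
    exact isConj_iff.2 ⟨g, by group⟩
  constructor
  · intro h
    rw [← hmem, ← Set.mem_inv, h, hmem]
  · intro h
    ext x
    rw [Set.mem_inv, hmem, hmem]
    exact ⟨fun hx => h.trans (by simpa using inv hx), fun hx => h.trans (inv hx)⟩

/-- The substitution `c = a * b` turns `a ^ 2 * b ^ 2 = 1` into `a * c * a⁻¹ = c⁻¹`. -/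
def sqMulSqEqOneEquiv (G : Type*) [Group G] :
    {x : G × G // x.1 ^ 2 * x.2 ^ 2 = 1} ≃ {x : G × G // x.1 * x.2 * x.1⁻¹ = x.2⁻¹} where
  toFun x := ⟨(x.1.1, x.1.1 * x.1.2), by
    refine eq_inv_iff_mul_eq_one.2 (Eq.trans ?_ x.2)
    simp only [pow_two]; group⟩
  invFun x := ⟨(x.1.1, x.1.1⁻¹ * x.1.2), by
    refine Eq.trans ?_ (eq_inv_iff_mul_eq_one.1 x.2)
    simp only [pow_two]; group⟩
  left_inv x := by ext <;> simp
  right_inv x := by ext <;> simp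

/-- Elements carrying `x` to `c` correspond to elements inverting `c`, once one of each
kind is given. -/
def conjToEquivInverting {G : Type*} [Group G] {x c h k : G} (hh : h * x * h⁻¹ = c)
    (hk : k * c * k⁻¹ = c⁻¹) :
    {g : G // g * x * g⁻¹ = c} ≃ {a : G // a * c * a⁻¹ = c⁻¹} where
  toFun g := ⟨k * g * h⁻¹, by
    calc k * g * h⁻¹ * c * (k * g * h⁻¹)⁻¹
      _ = k * g * h⁻¹ * (h * x * h⁻¹) * (k * g * h⁻¹)⁻¹ := by rw [hh]
      _ = k * (g * x * (g : G)⁻¹) * k⁻¹ := by group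
      _ = c⁻¹ := by rw [g.2, hk]⟩
  invFun a := ⟨k⁻¹ * a * h, by
    calc k⁻¹ * a * h * x * (k⁻¹ * a * h)⁻¹ = k⁻¹ * (a * (h * x * h⁻¹) * (a : G)⁻¹) * k := by group
      _ = c := by rw [hh, a.2, ← hk]; group⟩
  left_inv g := by ext; simp [mul_assoc]
  right_inv a := by ext; simp [mul_assoc]

/-- Inverting pairs whose second entry lies in a fixed real class are in bijection with `G`. -/
theorem ConjClasses.nonempty_equiv_inverting {G : Type*} [Group G] (C : ConjClasses G)
    (hC : C.carrier⁻¹ = C.carrier) :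
    Nonempty ((Σ c : {c : G // ConjClasses.mk c = C}, {a : G // a * c * a⁻¹ = (c : G)⁻¹}) ≃ G) := by
  obtain ⟨x, rfl⟩ := C.exists_rep
  have key (c : {c : G // ConjClasses.mk c = ConjClasses.mk x}) :
      Nonempty ({g : G // g * x * g⁻¹ = c} ≃ {a : G // a * c * a⁻¹ = (c : G)⁻¹}) := by
    obtain ⟨c, hc⟩ := c
    obtain ⟨h, hh⟩ := isConj_iff.1 (ConjClasses.mk_eq_mk_iff_isConj.1 hc.symm)
    obtain ⟨k, hk⟩ := isConj_iff.1 ((ConjClasses.carrier_inv_eq_iff c).1 (by rw [hc]; exact hC))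
    exact ⟨conjToEquivInverting hh hk⟩
  let f (g : G) : {c : G // ConjClasses.mk c = ConjClasses.mk x} :=
    ⟨g * x * g⁻¹, (ConjClasses.mk_eq_mk_iff_isConj.2 (isConj_iff.2 ⟨g, rfl⟩)).symm⟩
  exact ⟨(Equiv.sigmaCongrRight fun c => (key c).some.symm.trans
    (Equiv.subtypeEquivRight fun g => (Subtype.ext_iff (a1 := f g) (a2 := c)).symm)).trans
    (Equiv.sigmaFiberEquiv f)⟩

theorem card_inverting_pairs (G : Type*) [Group G] :
    Nat.card {x : G × G // x.1 * x.2 * x.1⁻¹ = x.2⁻¹} =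
      Nat.card {C : ConjClasses G // C.carrier⁻¹ = C.carrier} * Nat.card G := by
  let e : {x : G × G // x.1 * x.2 * x.1⁻¹ = x.2⁻¹} ≃
      Σ C : {C : ConjClasses G // C.carrier⁻¹ = C.carrier},
        Σ c : {c : G // ConjClasses.mk c = C}, {a : G // a * c * a⁻¹ = (c : G)⁻¹} :=
    { toFun x := ⟨⟨ConjClasses.mk x.1.2, (ConjClasses.carrier_inv_eq_iff _).2
        (isConj_iff.2 ⟨x.1.1, x.2⟩)⟩, ⟨x.1.2, rfl⟩, ⟨x.1.1, x.2⟩⟩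
      invFun y := ⟨(y.2.2, y.2.1), y.2.2.2⟩
      left_inv _ := rfl
      right_inv := by
        rintro ⟨⟨C, hC⟩, ⟨c, hc⟩, a⟩
        change ConjClasses.mk c = C at hc
        subst hc
        rfl }
  let e' := Equiv.sigmaCongrRight fun C : {C : ConjClasses G // C.carrier⁻¹ = C.carrier} =>
    (ConjClasses.nonempty_equiv_inverting C.1 C.2).some
  rw [Nat.card_congr (e.trans (e'.trans (Equiv.sigmaEquivProd _ _))), Nat.card_prod]

/-- Murray–Sambale. For a finite group `G`, the number of real conjugacy
classes of `G` (classes `𝒞` with `𝒞⁻¹ = 𝒞`) equals `s(2)/|G|`, where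
`s(2) = #{(a,b) : a²b² = 1}`; in particular `|G|` divides `s(2)`. -/
theorem real_classes_eq_s2_div_card (G : Type*) [Group G] [Finite G] :
    Nat.card G ∣ Nat.card {x : G × G // x.1 ^ 2 * x.2 ^ 2 = 1} ∧
    Nat.card {C : ConjClasses G // C.carrier⁻¹ = C.carrier} =
      Nat.card {x : G × G // x.1 ^ 2 * x.2 ^ 2 = 1} / Nat.card G := by
  rw [Nat.card_congr (sqMulSqEqOneEquiv G), card_inverting_pairs]
  exact ⟨dvd_mul_left _ _, (Nat.mul_div_cancel _ Nat.card_pos).symm⟩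
end

section
/- There exists a constant C (which can be taken to be 87) such that for every nontrivial word w (an element w ≠ 1 of a free group F_t on t generators) there is a positive integer d(w) with the property that for all integers d > d(w), every element of SL_d(ℤ) is a product of at most C elements of the image w(SL_d(ℤ)) of the word map w on SL_d(ℤ). -/
open scoped Pointwise MatrixGroups

/-- The image of the word map on `G` associated with an element `w` of the free group
on `t` generators. -/
def wordImage {t : ℕ} (w : FreeGroup (Fin t)) (G : Type*) [Group G] : Set G :=
  Set.range (fun g : Fin t → G => FreeGroup.lift g w)

set_option linter.unusedSectionVars false

section Embedding

variable {α β ι κ : Type} [Fintype α] [DecidableEq α] [Fintype β] [DecidableEq β]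
  [Fintype ι] [DecidableEq ι] [Fintype κ] [DecidableEq κ]

/-- The matrix of the inclusion `ℤ^α → ℤ^ι` induced by an embedding `α ↪ ι`. -/
def inclMat (e : α ↪ ι) : Matrix ι α ℤ := fun i a => if i = e a then 1 else 0

theorem inclMat_transpose_mul_self (e : α ↪ ι) : (inclMat e).transpose * inclMat e = 1 := by
  ext a b
  simp [Matrix.mul_apply, inclMat, Matrix.one_apply, eq_comm]

theorem inclMat_transpose_mul_of_disjoint (e : α ↪ ι) (f : β ↪ ι) (h : ∀ a b, e a ≠ f b) :
    (inclMat e).transpose * inclMat f = 0 := by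
  ext a b
  simpa [Matrix.mul_apply, inclMat] using (h a b).symm

theorem inclMat_trans (e : α ↪ ι) (f : ι ↪ κ) :
    inclMat (e.trans f) = inclMat f * inclMat e := by
  ext a b
  simp [Matrix.mul_apply, inclMat]

/-- Extension of a matrix by the identity along an embedding of index types. -/
def extMat (e : α ↪ ι) (x : Matrix α α ℤ) : Matrix ι ι ℤ :=
  1 + inclMat e * (x - 1) * (inclMat e).transpose

theorem extMat_one (e : α ↪ ι) : extMat e 1 = 1 := by simp [extMat]

theorem extMat_mul (e : α ↪ ι) (x y : Matrix α α ℤ) :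
    extMat e (x * y) = extMat e x * extMat e y := by
  have h := inclMat_transpose_mul_self e
  simp only [extMat]
  generalize inclMat e = P at *
  have : P * (x - 1) * P.transpose * (P * (y - 1) * P.transpose)
      = P * ((x - 1) * (y - 1)) * P.transpose := by
    calc _ = P * (x - 1) * (P.transpose * P) * (y - 1) * P.transpose := by
          simp only [Matrix.mul_assoc]
      _ = _ := by rw [h, Matrix.mul_one, Matrix.mul_assoc P]
  rw [mul_add, add_mul, add_mul, this]
  simp only [one_mul, mul_one]
  rw [show x * y - 1 = (x - 1) + (y - 1) + (x - 1) * (y - 1) by noncomm_ring]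
  simp only [Matrix.mul_add, Matrix.add_mul]
  abel

theorem det_extMat (e : α ↪ ι) (x : Matrix α α ℤ) : (extMat e x).det = x.det := by
  rw [extMat, Matrix.mul_assoc, Matrix.det_one_add_mul_comm, Matrix.mul_assoc,
    inclMat_transpose_mul_self]
  simp

theorem extMat_trans (e : α ↪ ι) (f : ι ↪ κ) (x : Matrix α α ℤ) :
    extMat (e.trans f) x = extMat f (extMat e x) := by
  simp only [extMat, inclMat_trans, Matrix.transpose_mul, add_sub_cancel_left, Matrix.mul_assoc]

theorem extMat_mul_of_disjoint (e : α ↪ ι) (f : β ↪ ι) (h : ∀ a b, e a ≠ f b)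
    (x : Matrix α α ℤ) (y : Matrix β β ℤ) :
    extMat e x * extMat f y = 1 + inclMat e * (x - 1) * (inclMat e).transpose
      + inclMat f * (y - 1) * (inclMat f).transpose := by
  have h := inclMat_transpose_mul_of_disjoint e f h
  have : inclMat e * (x - 1) * (inclMat e).transpose * (inclMat f * (y - 1) * (inclMat f).transpose)
      = 0 := by
    calc _ = inclMat e * (x - 1) * ((inclMat e).transpose * inclMat f) * (y - 1) *
          (inclMat f).transpose := by simp only [Matrix.mul_assoc]
      _ = _ := by simp [h]
  rw [extMat, extMat, mul_add, add_mul, add_mul, this]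
  simp

theorem inclMat_mul_mul_transpose_apply_ne_zero (e : α ↪ ι) {x : Matrix α α ℤ} {i j : ι}
    (h : (inclMat e * x * (inclMat e).transpose) i j ≠ 0) :
    ∃ a b, i = e a ∧ j = e b ∧ x a b ≠ 0 := by
  rw [Matrix.mul_apply] at h
  obtain ⟨b, -, hb⟩ := Finset.exists_ne_zero_of_sum_ne_zero h
  rw [Matrix.mul_apply] at hb
  have hb1 := left_ne_zero_of_mul hb
  obtain ⟨a, -, ha⟩ := Finset.exists_ne_zero_of_sum_ne_zero hb1
  refine ⟨a, b, ?_, ?_, right_ne_zero_of_mul ha⟩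
  · simpa [inclMat] using left_ne_zero_of_mul ha
  · simpa [inclMat] using right_ne_zero_of_mul hb

/-- Extension by the identity along an embedding, as a homomorphism of special linear groups. -/
def extSL (e : α ↪ ι) :
    Matrix.SpecialLinearGroup α ℤ →* Matrix.SpecialLinearGroup ι ℤ where
  toFun x := ⟨extMat e x.1, by rw [det_extMat, x.2]⟩
  map_one' := Subtype.ext (extMat_one e)
  map_mul' x y := Subtype.ext (extMat_mul e x.1 y.1)

theorem extSL_val (e : α ↪ ι) (x : Matrix.SpecialLinearGroup α ℤ) :
    (extSL e x).1 = extMat e x.1 := rfl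

theorem extSL_trans (e : α ↪ ι) (f : ι ↪ κ) (x : Matrix.SpecialLinearGroup α ℤ) :
    extSL (e.trans f) x = extSL f (extSL e x) :=
  Subtype.ext (extMat_trans e f x.1)

theorem extSL_commute (e : α ↪ ι) (f : β ↪ ι) (h : ∀ a b, e a ≠ f b)
    (x : Matrix.SpecialLinearGroup α ℤ) (y : Matrix.SpecialLinearGroup β ℤ) :
    Commute (extSL e x) (extSL f y) := by
  apply Subtype.ext
  change extMat e x.1 * extMat f y.1 = extMat f y.1 * extMat e x.1
  rw [extMat_mul_of_disjoint e f h, extMat_mul_of_disjoint f e (fun a b => (h b a).symm)]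
  abel

theorem extSL_refl (x : Matrix.SpecialLinearGroup α ℤ) :
    extSL (Function.Embedding.refl α) x = x := by
  apply Subtype.ext
  have : inclMat (Function.Embedding.refl α) = 1 := by
    ext a b
    simp [inclMat, Matrix.one_apply]
  simp [extSL_val, extMat, this]

theorem extMat_inl (x : Matrix α α ℤ) :
    extMat (Function.Embedding.inl : α ↪ α ⊕ β) x = Matrix.fromBlocks x 0 0 1 := by
  have : inclMat (Function.Embedding.inl : α ↪ α ⊕ β) = Matrix.fromRows 1 0 := by
    ext (i | i) j <;> simp [inclMat, Matrix.one_apply]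
  rw [extMat, this, Matrix.transpose_fromRows, Matrix.fromRows_mul, Matrix.fromRows_mul_fromCols,
    ← Matrix.fromBlocks_one, Matrix.fromBlocks_add]
  simp

theorem extMat_inr (x : Matrix β β ℤ) :
    extMat (Function.Embedding.inr : β ↪ α ⊕ β) x = Matrix.fromBlocks 1 0 0 x := by
  have : inclMat (Function.Embedding.inr : β ↪ α ⊕ β) = Matrix.fromRows 0 1 := by
    ext (i | i) j <;> simp [inclMat, Matrix.one_apply]
  rw [extMat, this, Matrix.transpose_fromRows, Matrix.fromRows_mul, Matrix.fromRows_mul_fromCols,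
    ← Matrix.fromBlocks_one, Matrix.fromBlocks_add]
  simp

end Embedding

section UnipotentPairs

variable {α β ι κ : Type} [Fintype α] [DecidableEq α] [Fintype β] [DecidableEq β]
  [Fintype ι] [DecidableEq ι] [Fintype κ] [DecidableEq κ]

/-- `x - 1` is supported on the block with rows in `s` and columns outside `s`. -/
def IsBlockUnipotent (s : Set ι) (x : Matrix.SpecialLinearGroup ι ℤ) : Prop :=
  ∀ i j, (x.1 - 1) i j ≠ 0 → i ∈ s ∧ j ∉ s

/-- Products of two opposite block unipotent matrices. -/
def unipPairs (ι : Type) [Fintype ι] [DecidableEq ι] : Set (Matrix.SpecialLinearGroup ι ℤ) :=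
  {x | ∃ s u l, IsBlockUnipotent s u ∧ IsBlockUnipotent sᶜ l ∧ x = u * l}

theorem isBlockUnipotent_one (s : Set ι) : IsBlockUnipotent s 1 := by
  intro i j h
  simp at h

theorem IsBlockUnipotent.inv {s : Set ι} {x : Matrix.SpecialLinearGroup ι ℤ}
    (h : IsBlockUnipotent s x) : IsBlockUnipotent s x⁻¹ := by
  have hsq : (x.1 - 1) * (x.1 - 1) = 0 := by
    ext i j
    rw [Matrix.mul_apply]
    refine Finset.sum_eq_zero fun k _ => ?_
    by_contra hk
    exact (h _ _ (left_ne_zero_of_mul hk)).2 (h _ _ (right_ne_zero_of_mul hk)).1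
  have hinv : (x⁻¹).1 - 1 = -(x.1 - 1) := by
    have h1 : x.1 * (1 - (x.1 - 1)) = 1 := by
      have : x.1 * (1 - (x.1 - 1)) = 1 - (x.1 - 1) * (x.1 - 1) := by noncomm_ring
      rw [this, hsq, sub_zero]
    have h2 : (x⁻¹).1 * x.1 = 1 := congrArg Subtype.val (inv_mul_cancel x)
    have h3 : (x⁻¹).1 = 1 - (x.1 - 1) := by
      calc (x⁻¹).1 = (x⁻¹).1 * (x.1 * (1 - (x.1 - 1))) := by rw [h1, mul_one]
        _ = _ := by rw [← mul_assoc, h2, one_mul]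
    rw [h3]
    abel
  intro i j hij
  rw [hinv, Matrix.neg_apply] at hij
  exact h i j (neg_ne_zero.1 hij)

theorem one_mem_unipPairs : (1 : Matrix.SpecialLinearGroup ι ℤ) ∈ unipPairs ι :=
  ⟨∅, 1, 1, isBlockUnipotent_one _, isBlockUnipotent_one _, by simp⟩

theorem inv_mem_unipPairs {x : Matrix.SpecialLinearGroup ι ℤ} (h : x ∈ unipPairs ι) :
    x⁻¹ ∈ unipPairs ι := by
  obtain ⟨s, u, l, hu, hl, rfl⟩ := h
  exact ⟨sᶜ, l⁻¹, u⁻¹, hl.inv, by simpa using hu.inv, by simp⟩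

theorem IsBlockUnipotent.mem_unipPairs {s : Set ι} {x : Matrix.SpecialLinearGroup ι ℤ}
    (h : IsBlockUnipotent s x) : x ∈ unipPairs ι :=
  ⟨s, x, 1, h, isBlockUnipotent_one _, by simp⟩

theorem IsBlockUnipotent.mul_mem_unipPairs {s : Set ι} {x y : Matrix.SpecialLinearGroup ι ℤ}
    (h : IsBlockUnipotent s x) (h' : IsBlockUnipotent sᶜ y) : x * y ∈ unipPairs ι :=
  ⟨s, x, y, h, h', rfl⟩

theorem IsBlockUnipotent.mul_mem_unipPairs' {s : Set ι} {x y : Matrix.SpecialLinearGroup ι ℤ}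
    (h : IsBlockUnipotent sᶜ x) (h' : IsBlockUnipotent s y) : x * y ∈ unipPairs ι :=
  ⟨sᶜ, x, y, h, by simpa using h', rfl⟩

theorem IsBlockUnipotent.extSL_mul {x : Matrix.SpecialLinearGroup α ℤ}
    {y : Matrix.SpecialLinearGroup β ℤ} {s : Set α} {t : Set β} (hx : IsBlockUnipotent s x)
    (hy : IsBlockUnipotent t y) (e : α ↪ ι) (f : β ↪ ι) (h : ∀ a b, e a ≠ f b) {r : Set ι}
    (hs : ∀ a, e a ∈ r ↔ a ∈ s) (ht : ∀ b, f b ∈ r ↔ b ∈ t) :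
    IsBlockUnipotent r (extSL e x * extSL f y) := by
  intro i j hij
  change (extMat e x.1 * extMat f y.1 - 1) i j ≠ 0 at hij
  rw [extMat_mul_of_disjoint e f h, add_assoc, add_sub_cancel_left, Matrix.add_apply] at hij
  by_cases h0 : (inclMat e * (x.1 - 1) * (inclMat e).transpose : Matrix ι ι ℤ) i j = 0
  · rw [h0, zero_add] at hij
    obtain ⟨a, b, rfl, rfl, hab⟩ := inclMat_mul_mul_transpose_apply_ne_zero f hij
    rw [ht, ht]
    exact hy a b hab
  · obtain ⟨a, b, rfl, rfl, hab⟩ := inclMat_mul_mul_transpose_apply_ne_zero e h0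
    rw [hs, hs]
    exact hx a b hab

theorem extSL_mul_mem_unipPairs {x : Matrix.SpecialLinearGroup α ℤ}
    {y : Matrix.SpecialLinearGroup β ℤ} (hx : x ∈ unipPairs α) (hy : y ∈ unipPairs β)
    (e : α ↪ ι) (f : β ↪ ι) (h : ∀ a b, e a ≠ f b) :
    extSL e x * extSL f y ∈ unipPairs ι := by
  obtain ⟨s, u, l, hu, hl, rfl⟩ := hx
  obtain ⟨t, v, m, hv, hm, rfl⟩ := hy
  have hs : ∀ a, e a ∈ e '' s ∪ f '' t ↔ a ∈ s := fun a => by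
    simp [fun b => (h a b).symm]
  have ht : ∀ b, f b ∈ e '' s ∪ f '' t ↔ b ∈ t := fun b => by
    simp [fun a => h a b]
  refine ⟨e '' s ∪ f '' t, extSL e u * extSL f v, extSL e l * extSL f m,
    hu.extSL_mul hv e f h hs ht, hl.extSL_mul hm e f h ?_ ?_, ?_⟩
  · intro a; simp only [Set.mem_compl_iff, hs]
  · intro a; simp only [Set.mem_compl_iff, ht]
  · rw [map_mul, map_mul, mul_assoc, ← mul_assoc (extSL e l),
      (extSL_commute e f h l v).eq]
    simp only [mul_assoc]

theorem mem_unipPairs_pow_mono {m n : ℕ} (h : m ≤ n) {x : Matrix.SpecialLinearGroup ι ℤ}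
    (hx : x ∈ unipPairs ι ^ m) : x ∈ unipPairs ι ^ n :=
  Set.pow_subset_pow_right one_mem_unipPairs h hx

theorem mul_mem_unipPairs_pow {m n k : ℕ} (h : m + n ≤ k) {x y : Matrix.SpecialLinearGroup ι ℤ}
    (hx : x ∈ unipPairs ι ^ m) (hy : y ∈ unipPairs ι ^ n) : x * y ∈ unipPairs ι ^ k :=
  mem_unipPairs_pow_mono h (pow_add (unipPairs ι) m n ▸ Set.mul_mem_mul hx hy)

theorem one_mem_unipPairs_pow (n : ℕ) : (1 : Matrix.SpecialLinearGroup ι ℤ) ∈ unipPairs ι ^ n :=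
  mem_unipPairs_pow_mono (Nat.zero_le n) (by simp)

theorem inv_mem_unipPairs_pow {n : ℕ} {x : Matrix.SpecialLinearGroup ι ℤ}
    (hx : x ∈ unipPairs ι ^ n) : x⁻¹ ∈ unipPairs ι ^ n := by
  have : (unipPairs ι)⁻¹ = unipPairs ι := by
    ext x
    exact ⟨fun h => by simpa using inv_mem_unipPairs h, fun h => inv_mem_unipPairs h⟩
  rw [← this, inv_pow]
  simpa using hx

theorem extSL_mul_mem_unipPairs_pow {n : ℕ} {x : Matrix.SpecialLinearGroup α ℤ}
    {y : Matrix.SpecialLinearGroup β ℤ} (hx : x ∈ unipPairs α ^ n) (hy : y ∈ unipPairs β ^ n)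
    (e : α ↪ ι) (f : β ↪ ι) (h : ∀ a b, e a ≠ f b) :
    extSL e x * extSL f y ∈ unipPairs ι ^ n := by
  induction n generalizing x y with
  | zero =>
    simp only [pow_zero, Set.mem_one] at hx hy
    simp [hx, hy]
  | succ n ih =>
    rw [pow_succ] at hx hy
    obtain ⟨x₁, hx₁, x₂, hx₂, rfl⟩ := Set.mem_mul.1 hx
    obtain ⟨y₁, hy₁, y₂, hy₂, rfl⟩ := Set.mem_mul.1 hy
    have : extSL e (x₁ * x₂) * extSL f (y₁ * y₂)
        = (extSL e x₁ * extSL f y₁) * (extSL e x₂ * extSL f y₂) := by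
      rw [map_mul, map_mul, mul_assoc, ← mul_assoc (extSL e x₂), (extSL_commute e f h x₂ y₁).eq]
      simp only [mul_assoc]
    rw [this, pow_succ]
    exact Set.mul_mem_mul (ih hx₁ hy₁) (extSL_mul_mem_unipPairs hx₂ hy₂ e f h)

theorem extSL_mem_unipPairs_pow {n : ℕ} {x : Matrix.SpecialLinearGroup α ℤ}
    (hx : x ∈ unipPairs α ^ n) (e : α ↪ ι) : extSL e x ∈ unipPairs ι ^ n := by
  have h : (1 : Matrix.SpecialLinearGroup Empty ℤ) ∈ unipPairs Empty ^ n := one_mem_unipPairs_pow n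
  simpa using extSL_mul_mem_unipPairs_pow hx h e (Function.Embedding.ofIsEmpty) (fun _ b => b.elim)

end UnipotentPairs

section Swindle

variable {α β ι κ : Type} [Fintype α] [DecidableEq α] [Fintype β] [DecidableEq β]
  [Fintype ι] [DecidableEq ι] [Fintype κ] [DecidableEq κ]

/-- The block unipotent matrix with upper right block `X`. -/
def upperSL (X : Matrix α β ℤ) : Matrix.SpecialLinearGroup (α ⊕ β) ℤ :=
  ⟨Matrix.fromBlocks 1 X 0 1, by simp⟩

/-- The block unipotent matrix with lower left block `Y`. -/
def lowerSL (Y : Matrix β α ℤ) : Matrix.SpecialLinearGroup (α ⊕ β) ℤ :=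
  ⟨Matrix.fromBlocks 1 0 Y 1, by simp⟩

theorem isBlockUnipotent_upperSL (X : Matrix α β ℤ) :
    IsBlockUnipotent (Set.range Sum.inl) (upperSL X) := by
  rintro (i | i) (j | j) h <;>
    simp [upperSL, ← Matrix.fromBlocks_one, Matrix.one_apply] at h ⊢

theorem isBlockUnipotent_lowerSL (Y : Matrix β α ℤ) :
    IsBlockUnipotent (Set.range Sum.inl)ᶜ (lowerSL Y) := by
  rintro (i | i) (j | j) h <;>
    simp [lowerSL, ← Matrix.fromBlocks_one, Matrix.one_apply] at h ⊢

theorem upperSL_mul_neg (X : Matrix α β ℤ) : upperSL X * upperSL (-X) = 1 := by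
  apply Subtype.ext
  change Matrix.fromBlocks 1 X 0 1 * Matrix.fromBlocks 1 (-X) 0 1 = (1 : Matrix _ _ ℤ)
  simp [Matrix.fromBlocks_multiply]

theorem lowerSL_mul_neg (Y : Matrix β α ℤ) : lowerSL Y * lowerSL (-Y) = 1 := by
  apply Subtype.ext
  change Matrix.fromBlocks 1 0 Y 1 * Matrix.fromBlocks 1 0 (-Y) 1 = (1 : Matrix _ _ ℤ)
  simp [Matrix.fromBlocks_multiply]

theorem extSL_inl_mul_extSL_inr_val (x : Matrix.SpecialLinearGroup α ℤ)
    (y : Matrix.SpecialLinearGroup β ℤ) :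
    (extSL (Function.Embedding.inl : α ↪ α ⊕ β) x *
      extSL (Function.Embedding.inr : β ↪ α ⊕ β) y).1 = Matrix.fromBlocks x.1 0 0 y.1 := by
  change extMat _ _ * extMat _ _ = _
  rw [extMat_inl, extMat_inr, Matrix.fromBlocks_multiply]
  simp

theorem upperSL_mul_lowerSL_eq (X : Matrix α β ℤ) (Y : Matrix β α ℤ)
    (M : Matrix.SpecialLinearGroup α ℤ) (N : Matrix.SpecialLinearGroup β ℤ)
    (hM : M.1 = 1 + X * Y) (hN : N.1 = 1 + Y * X) :
    upperSL X * lowerSL Y = lowerSL (Y * (M⁻¹).1) *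
      (extSL (Function.Embedding.inl : α ↪ α ⊕ β) M *
        extSL (Function.Embedding.inr : β ↪ α ⊕ β) N⁻¹) * upperSL ((M⁻¹).1 * X) := by
  have hM1 : M.1 * (M⁻¹).1 = 1 := congrArg Subtype.val (mul_inv_cancel M)
  have hM2 : (M⁻¹).1 * M.1 = 1 := congrArg Subtype.val (inv_mul_cancel M)
  have hN2 : (N⁻¹).1 * N.1 = 1 := congrArg Subtype.val (inv_mul_cancel N)
  have hYM : Y * (M⁻¹).1 = (N⁻¹).1 * Y := by
    have : N.1 * Y = Y * M.1 := by
      rw [hM, hN, Matrix.mul_add, Matrix.add_mul, Matrix.mul_assoc, Matrix.mul_one, Matrix.one_mul]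
    calc Y * (M⁻¹).1 = (N⁻¹).1 * N.1 * Y * (M⁻¹).1 := by rw [hN2, Matrix.one_mul]
      _ = (N⁻¹).1 * (Y * M.1) * (M⁻¹).1 := by rw [← this]; simp only [Matrix.mul_assoc]
      _ = _ := by
        rw [Matrix.mul_assoc, Matrix.mul_assoc Y, hM1, Matrix.mul_one]
  apply Subtype.ext
  change Matrix.fromBlocks 1 X 0 1 * Matrix.fromBlocks 1 0 Y 1 =
    Matrix.fromBlocks 1 0 (Y * (M⁻¹).1) 1 * (_ : Matrix.SpecialLinearGroup _ ℤ).1 *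
      Matrix.fromBlocks 1 ((M⁻¹).1 * X) 0 1
  rw [extSL_inl_mul_extSL_inr_val]
  simp only [Matrix.fromBlocks_multiply, Matrix.one_mul, Matrix.mul_one, Matrix.zero_mul,
    Matrix.mul_zero, add_zero, zero_add]
  congr 1
  · exact hM.symm
  · rw [← Matrix.mul_assoc, hM1, Matrix.one_mul]
  · rw [Matrix.mul_assoc, hM2, Matrix.mul_one]
  · rw [Matrix.mul_assoc, ← Matrix.mul_assoc _ _ X, hM1, Matrix.one_mul, hYM, Matrix.mul_assoc,
      ← hN2, hN, Matrix.mul_add, Matrix.mul_one, add_comm]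

/-- The embedding of a disjoint union induced by two embeddings with disjoint ranges. -/
def sumEmb (e : α ↪ ι) (f : β ↪ ι) (h : ∀ a b, e a ≠ f b) : α ⊕ β ↪ ι :=
  ⟨Sum.elim e f, e.injective.sumElim f.injective h⟩

theorem extSL_sumEmb_inl (e : α ↪ ι) (f : β ↪ ι) (h : ∀ a b, e a ≠ f b)
    (x : Matrix.SpecialLinearGroup α ℤ) :
    extSL (sumEmb e f h) (extSL Function.Embedding.inl x) = extSL e x := by
  rw [← extSL_trans]
  rfl

theorem extSL_sumEmb_inr (e : α ↪ ι) (f : β ↪ ι) (h : ∀ a b, e a ≠ f b)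
    (x : Matrix.SpecialLinearGroup β ℤ) :
    extSL (sumEmb e f h) (extSL Function.Embedding.inr x) = extSL f x := by
  rw [← extSL_trans]
  rfl

theorem extSL_mul_extSL_inv_mem_of_swap (e : α ↪ ι) (f : β ↪ ι) (h : ∀ a b, e a ≠ f b)
    (X : Matrix α β ℤ) (Y : Matrix β α ℤ)
    (M : Matrix.SpecialLinearGroup α ℤ) (N : Matrix.SpecialLinearGroup β ℤ)
    (hM : M.1 = 1 + X * Y) (hN : N.1 = 1 + Y * X) :
    extSL e M * extSL f N⁻¹ ∈ unipPairs ι ^ 2 := by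
  rw [← extSL_sumEmb_inl e f h, ← extSL_sumEmb_inr e f h, ← map_mul]
  apply extSL_mem_unipPairs_pow
  have h1 := upperSL_mul_lowerSL_eq X Y M N hM hN
  have h2 : extSL (Function.Embedding.inl : α ↪ α ⊕ β) M *
      extSL (Function.Embedding.inr : β ↪ α ⊕ β) N⁻¹ =
      (lowerSL (-(Y * (M⁻¹).1)) * upperSL X) * (lowerSL Y * upperSL (-((M⁻¹).1 * X))) := by
    have h3 := lowerSL_mul_neg (-(Y * (M⁻¹).1))
    rw [neg_neg] at h3
    have h4 := upperSL_mul_neg ((M⁻¹).1 * X)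
    calc _ = (lowerSL (-(Y * (M⁻¹).1)) * lowerSL (Y * (M⁻¹).1)) *
          (extSL (Function.Embedding.inl : α ↪ α ⊕ β) M *
      extSL (Function.Embedding.inr : β ↪ α ⊕ β) N⁻¹) *
          (upperSL ((M⁻¹).1 * X) * upperSL (-((M⁻¹).1 * X))) := by rw [h3, h4]; simp
      _ = lowerSL (-(Y * (M⁻¹).1)) * (lowerSL (Y * (M⁻¹).1) *
          (extSL (Function.Embedding.inl : α ↪ α ⊕ β) M *
      extSL (Function.Embedding.inr : β ↪ α ⊕ β) N⁻¹) *
          upperSL ((M⁻¹).1 * X)) * upperSL (-((M⁻¹).1 * X)) := by simp only [mul_assoc]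
      _ = _ := by rw [← h1]; simp only [mul_assoc]
  rw [h2, pow_two]
  exact Set.mul_mem_mul
    ((isBlockUnipotent_lowerSL _).mul_mem_unipPairs' (isBlockUnipotent_upperSL _))
    ((isBlockUnipotent_lowerSL _).mul_mem_unipPairs' (isBlockUnipotent_upperSL _))

theorem extSL_mul_extSL_inv_mem (e f : α ↪ ι) (h : ∀ a b, e a ≠ f b)
    (V : Matrix.SpecialLinearGroup α ℤ) :
    extSL e V * extSL f V⁻¹ ∈ unipPairs ι ^ 2 :=
  extSL_mul_extSL_inv_mem_of_swap e f h 1 (V.1 - 1) V V (by simp) (by simp)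

end Swindle

section Reduction

variable {α β γ ι κ : Type} [Fintype α] [DecidableEq α] [Fintype β] [DecidableEq β]
  [Fintype ι] [DecidableEq ι] [Fintype κ] [DecidableEq κ] [Fintype γ] [DecidableEq γ]

theorem exists_mulVec_eq_zero_and_dotProduct_eq_one (T : Matrix β α ℤ)
    (h : Fintype.card β < Fintype.card α) :
    ∃ k y : α → ℤ, T.mulVec k = 0 ∧ y ⬝ᵥ k = 1 := by
  have hT : ∃ k, T.mulVec k = 0 ∧ k ≠ 0 := by
    by_contra! hk
    have hinj : Function.Injective T.mulVecLin := by
      rw [← LinearMap.ker_eq_bot, LinearMap.ker_eq_bot']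
      exact hk
    have := LinearMap.finrank_le_finrank_of_injective hinj
    simp at this
    omega
  obtain ⟨k, hk, hk0⟩ := hT
  have hne : (Finset.univ : Finset α).Nonempty := by
    obtain ⟨a, -⟩ := Function.ne_iff.1 hk0
    exact ⟨a, Finset.mem_univ a⟩
  obtain ⟨g, hg, hg1⟩ := Finset.extract_gcd k hne
  obtain ⟨y, hy⟩ := Finset.gcd_eq_sum_mul Finset.univ g
  have hkg : k = Finset.univ.gcd k • g := by
    ext a
    simpa using hg a (Finset.mem_univ a)
  have hc : Finset.univ.gcd k ≠ 0 := by
    intro hc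
    rw [hc, zero_smul] at hkg
    exact hk0 hkg
  refine ⟨g, y, ?_, ?_⟩
  · rw [hkg, Matrix.mulVec_smul] at hk
    exact (smul_eq_zero.1 hk).resolve_left hc
  · rw [hg1] at hy
    rw [hy, dotProduct_comm]
    rfl

theorem exists_range_add_mul (R : Matrix β α ℤ) (S : Matrix β γ ℤ)
    (h : Fintype.card β < Fintype.card α) (t : Finset γ) :
    ∃ Y : Matrix γ α ℤ, (∀ x, ∃ x', (R + S * Y).mulVec x' = R.mulVec x) ∧
      ∀ j ∈ t, ∃ x', (R + S * Y).mulVec x' = S.col j := by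
  induction t using Finset.induction_on with
  | empty => exact ⟨0, fun x => ⟨x, by simp⟩, by simp⟩
  | insert j t hj ih =>
    obtain ⟨Y, hR, hS⟩ := ih
    obtain ⟨k, y, hk, hy⟩ := exists_mulVec_eq_zero_and_dotProduct_eq_one (R + S * Y) h
    have key : ∀ x, (R + S * (Y + Matrix.vecMulVec (Pi.single j 1) y)).mulVec x
        = (R + S * Y).mulVec x + (y ⬝ᵥ x) • S.col j := by
      intro x
      rw [Matrix.mul_add, ← add_assoc, Matrix.add_mulVec, ← Matrix.mulVec_mulVec (M := S),
        Matrix.vecMulVec_mulVec]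
      congr 1
      ext i
      simp [Matrix.mulVec, dotProduct, mul_comm, Pi.single_apply]
    have lift : ∀ z x, (R + S * Y).mulVec x = z →
        ∃ x', (R + S * (Y + Matrix.vecMulVec (Pi.single j 1) y)).mulVec x' = z := by
      rintro z x rfl
      refine ⟨x - (y ⬝ᵥ x) • k, ?_⟩
      rw [key, Matrix.mulVec_sub, Matrix.mulVec_smul, hk, dotProduct_sub, dotProduct_smul, hy]
      simp
    refine ⟨Y + Matrix.vecMulVec (Pi.single j 1) y, fun x => ?_, fun i hi => ?_⟩
    · obtain ⟨x', hx'⟩ := hR x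
      exact lift _ _ hx'
    · obtain rfl | hi := Finset.mem_insert.1 hi
      · exact ⟨k, by rw [key, hk, hy]; simp⟩
      · obtain ⟨x', hx'⟩ := hS i hi
        exact lift _ _ hx'

/-- Stable range reduction. -/
theorem exists_eq_upperSL_mul_extSL_mul (h : Fintype.card β < Fintype.card α)
    (g : Matrix.SpecialLinearGroup (α ⊕ β) ℤ) :
    ∃ (Q Z : Matrix α β ℤ) (R Y : Matrix β α ℤ) (x : Matrix.SpecialLinearGroup α ℤ),
      g = upperSL Q * extSL Function.Embedding.inl x *
        (lowerSL R * upperSL Z * lowerSL Y) := by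
  set P := g.1.toBlocks₁₁
  set Q := g.1.toBlocks₁₂
  set R := g.1.toBlocks₂₁
  set S := g.1.toBlocks₂₂
  have hg : g.1 = Matrix.fromBlocks P Q R S := (Matrix.fromBlocks_toBlocks g.1).symm
  have hg1 : g.1 * (g⁻¹).1 = 1 := congrArg Subtype.val (mul_inv_cancel g)
  obtain ⟨Y, hR, hS⟩ := exists_range_add_mul R S h Finset.univ
  have hsurj : ∀ z, ∃ x, (R + S * Y).mulVec x = z := by
    intro z
    set v := (g⁻¹).1.mulVec (Sum.elim (0 : α → ℤ) z)
    have hv : g.1.mulVec v = Sum.elim (0 : α → ℤ) z := by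
      rw [Matrix.mulVec_mulVec, hg1, Matrix.one_mulVec]
    rw [hg, Matrix.fromBlocks_mulVec] at hv
    have hv2 : R.mulVec (v ∘ Sum.inl) + S.mulVec (v ∘ Sum.inr) = z := by
      ext i
      simpa using congrFun hv (Sum.inr i)
    obtain ⟨x1, hx1⟩ := hR (v ∘ Sum.inl)
    choose x2 hx2 using fun j => hS j (Finset.mem_univ j)
    refine ⟨x1 + ∑ j, v (Sum.inr j) • x2 j, ?_⟩
    rw [Matrix.mulVec_add, hx1, ← hv2, Matrix.mulVec_sum]
    congr 1
    simp only [Matrix.mulVec_smul, hx2]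
    ext i
    simp [Matrix.mulVec, dotProduct, mul_comm]
  choose f hf using hsurj
  set R' := R + S * Y
  obtain ⟨Z, hZ⟩ : ∃ Z : Matrix α β ℤ, R' * Z = 1 - S := by
    refine ⟨Matrix.of fun i j => f ((1 - S).col j) i, ?_⟩
    ext i j
    exact congrFun (hf ((1 - S).col j)) i
  set Q' := (P + Q * Y) * Z + Q
  set P' := P + Q * Y
  have e1 : g.1 * (lowerSL Y).1 * (upperSL Z).1 = Matrix.fromBlocks P' Q' R' 1 := by
    rw [hg]
    simp only [lowerSL, upperSL, Matrix.fromBlocks_multiply]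
    simp [hZ, P', Q', R']
  set G := upperSL (-Q') * (g * lowerSL Y * upperSL Z) * lowerSL (-R')
  have e2 : G.1 = Matrix.fromBlocks (P' - Q' * R') 0 0 1 := by
    change (upperSL (-Q')).1 * (g.1 * (lowerSL Y).1 * (upperSL Z).1) * (lowerSL (-R')).1 = _
    rw [e1]
    simp only [lowerSL, upperSL, Matrix.fromBlocks_multiply]
    simp [sub_eq_add_neg]
  have hdet : (P' - Q' * R').det = 1 := by
    have := G.2
    rw [e2] at this
    simpa using this
  obtain ⟨x, hx⟩ : ∃ x : Matrix.SpecialLinearGroup α ℤ, x.1 = P' - Q' * R' := ⟨⟨_, hdet⟩, rfl⟩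
  refine ⟨Q', -Z, R', -Y, x, ?_⟩
  have e3 : extSL Function.Embedding.inl x = G := by
    apply Subtype.ext
    rw [e2, extSL_val, extMat_inl, hx]
  have h1 := upperSL_mul_neg Q'
  have h2 := lowerSL_mul_neg (-R')
  have h3 := upperSL_mul_neg Z
  have h4 := lowerSL_mul_neg Y
  rw [neg_neg] at h2
  rw [e3]
  simp only [G]
  calc g = (upperSL Q' * upperSL (-Q')) * g * (lowerSL Y * (upperSL Z *
        (lowerSL (-R') * lowerSL R') * upperSL (-Z)) * lowerSL (-Y)) := by
        rw [h1, h2, mul_one, h3, mul_one, h4]; simp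
    _ = _ := by simp only [mul_assoc]

theorem exists_eq_mul_extSL_mul (e : α ↪ ι) (f : β ↪ ι) (hd : ∀ a b, e a ≠ f b)
    (hcard : Fintype.card ι = Fintype.card α + Fintype.card β)
    (h : Fintype.card β < Fintype.card α) (g : Matrix.SpecialLinearGroup ι ℤ) :
    ∃ p ∈ unipPairs ι ^ 1, ∃ q ∈ unipPairs ι ^ 2, ∃ x, g = p * extSL e x * q := by
  have hbij : Function.Bijective (sumEmb e f hd) := by
    rw [Fintype.bijective_iff_injective_and_card]
    exact ⟨(sumEmb e f hd).injective, by simp [hcard]⟩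
  set E := Equiv.ofBijective _ hbij
  obtain ⟨Q, Z, R, Y, x, hx⟩ := exists_eq_upperSL_mul_extSL_mul h (extSL E.symm.toEmbedding g)
  have hg : extSL (sumEmb e f hd) (extSL E.symm.toEmbedding g) = g := by
    rw [← extSL_trans]
    have : E.symm.toEmbedding.trans (sumEmb e f hd) = Function.Embedding.refl ι := by
      ext i
      exact E.apply_symm_apply i
    rw [this, extSL_refl]
  refine ⟨extSL (sumEmb e f hd) (upperSL Q), ?_,
    extSL (sumEmb e f hd) (lowerSL R * upperSL Z * lowerSL Y), ?_, x, ?_⟩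
  · apply extSL_mem_unipPairs_pow
    rw [pow_one]
    exact (isBlockUnipotent_upperSL Q).mem_unipPairs
  · apply extSL_mem_unipPairs_pow
    rw [pow_two]
    exact Set.mul_mem_mul
      ((isBlockUnipotent_lowerSL _).mul_mem_unipPairs' (isBlockUnipotent_upperSL _))
      (isBlockUnipotent_lowerSL _).mem_unipPairs
  · rw [← hg, hx, map_mul, map_mul, extSL_sumEmb_inl]

end Reduction

section Recursion

variable {α β γ ι κ : Type} [Fintype α] [DecidableEq α] [Fintype β] [DecidableEq β]
  [Fintype ι] [DecidableEq ι] [Fintype κ] [DecidableEq κ] [Fintype γ] [DecidableEq γ]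

theorem exists_disjoint_embeddings {a b : ℕ} (h : a + b ≤ Fintype.card ι) :
    ∃ (e : Fin a ↪ ι) (f : Fin b ↪ ι), ∀ i j, e i ≠ f j := by
  obtain ⟨E⟩ : Nonempty (Fin a ⊕ Fin b ↪ ι) :=
    Function.Embedding.nonempty_of_card_le (by simpa using h)
  exact ⟨Function.Embedding.inl.trans E, Function.Embedding.inr.trans E,
    fun i j hij => by simpa using E.injective hij⟩

theorem exists_embedding_forall_eq_mul_extSL_mul {n m : ℕ} (hn : Fintype.card ι = n) (h1 : m ≤ n)
    (h2 : n < 2 * m) : ∃ e : Fin m ↪ ι, ∀ g : Matrix.SpecialLinearGroup ι ℤ,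
      ∃ p ∈ unipPairs ι ^ 1, ∃ q ∈ unipPairs ι ^ 2, ∃ x, g = p * extSL e x * q := by
  obtain ⟨e, f, h⟩ := exists_disjoint_embeddings (ι := ι) (a := m) (b := n - m) (by omega)
  exact ⟨e, exists_eq_mul_extSL_mul e f h (by simp; omega) (by simp; omega)⟩

theorem extSL_mul_mul_mul {e : α ↪ ι} {f : β ↪ ι} {g : γ ↪ ι} (h1 : ∀ a b, e a ≠ f b)
    (h2 : ∀ a c, e a ≠ g c) (h3 : ∀ b c, f b ≠ g c) (x x' : Matrix.SpecialLinearGroup α ℤ)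
    (y y' : Matrix.SpecialLinearGroup β ℤ) (z z' : Matrix.SpecialLinearGroup γ ℤ) :
    extSL e x * extSL f y * extSL g z * (extSL e x' * extSL f y' * extSL g z')
      = extSL e (x * x') * extSL f (y * y') * extSL g (z * z') := by
  have c1 := (extSL_commute e f h1 x' y).eq
  have c2 := (extSL_commute e g h2 x' z).eq
  have c3 := (extSL_commute f g h3 y' z).eq
  simp only [map_mul]
  generalize extSL e x = X, extSL e x' = X', extSL f y = Y, extSL f y' = Y',
    extSL g z = Z, extSL g z' = Z' at *
  calc X * Y * Z * (X' * Y' * Z') = X * Y * (Z * X') * Y' * Z' := by simp only [mul_assoc]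
    _ = X * (Y * X') * (Z * Y') * Z' := by rw [← c2]; simp only [mul_assoc]
    _ = _ := by rw [← c1, ← c3]; simp only [mul_assoc]

theorem extSL_mul_mul_mem_unipPairs_pow {e : α ↪ ι} {f : β ↪ ι} {g : γ ↪ ι}
    (h1 : ∀ a b, e a ≠ f b) (h2 : ∀ a c, e a ≠ g c) (h3 : ∀ b c, f b ≠ g c)
    {x : Matrix.SpecialLinearGroup α ℤ} {y : Matrix.SpecialLinearGroup β ℤ}
    {z : Matrix.SpecialLinearGroup γ ℤ} {n : ℕ}
    (hxy : extSL (Function.Embedding.inl : α ↪ α ⊕ β) x *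
      extSL (Function.Embedding.inr : β ↪ α ⊕ β) y ∈ unipPairs (α ⊕ β) ^ n)
    (hz : z ∈ unipPairs γ ^ n) :
    extSL e x * extSL f y * extSL g z ∈ unipPairs ι ^ n := by
  rw [← extSL_sumEmb_inl e f h1, ← extSL_sumEmb_inr e f h1, ← map_mul]
  apply extSL_mul_mem_unipPairs_pow hxy hz
  rintro (a | b) c
  · exact h2 a c
  · exact h3 b c

theorem extSL_inl_mul_extSL_inr_mem {n : ℕ} {x : Matrix.SpecialLinearGroup α ℤ}
    {y : Matrix.SpecialLinearGroup β ℤ} (hx : x ∈ unipPairs α ^ n) (hy : y ∈ unipPairs β ^ n) :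
    extSL (Function.Embedding.inl : α ↪ α ⊕ β) x *
      extSL (Function.Embedding.inr : β ↪ α ⊕ β) y ∈ unipPairs (α ⊕ β) ^ n :=
  extSL_mul_mem_unipPairs_pow hx hy _ _ (by simp)

theorem exists_extSL_eq_of_base {m : ℕ} (hm : 2 ≤ m)
    (base : ∀ h : Matrix.SpecialLinearGroup (Fin 2) ℤ,
      extSL (Function.Embedding.inl : Fin 2 ↪ Fin 2 ⊕ Fin 2) h ∈ unipPairs (Fin 2 ⊕ Fin 2) ^ m)
    (n : ℕ) (hn : 2 ≤ n) (h : Matrix.SpecialLinearGroup (Fin n) ℤ) :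
    ∃ P ∈ unipPairs (Fin n ⊕ Fin (4 * n)) ^ 1, ∃ E ∈ unipPairs (Fin n ⊕ Fin (4 * n)) ^ 2,
      ∃ M ∈ unipPairs (Fin n ⊕ Fin (4 * n)) ^ m, ∃ F ∈ unipPairs (Fin (4 * n)) ^ 2,
      ∃ Q ∈ unipPairs (Fin (4 * n)) ^ 2,
        extSL Function.Embedding.inl h = P * E * M * extSL Function.Embedding.inr F *
          extSL Function.Embedding.inr Q := by
  induction n using Nat.strong_induction_on with
  | _ n ih =>
  obtain rfl | hn3 := hn.eq_or_lt
  · refine ⟨1, one_mem_unipPairs_pow _, 1, one_mem_unipPairs_pow _,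
      extSL (sumEmb (Function.Embedding.inl) ((Fin.castLEEmb (n := 2) (by simp)).trans
        Function.Embedding.inr) (by simp)) (extSL Function.Embedding.inl h), ?_,
      1, one_mem_unipPairs_pow _, 1, one_mem_unipPairs_pow _, ?_⟩
    · exact extSL_mem_unipPairs_pow (base h) _
    · rw [extSL_sumEmb_inl]
      simp
  obtain ⟨n₁, hn₁⟩ : ∃ n₁, n₁ = n / 2 + 1 := ⟨_, rfl⟩
  obtain ⟨n₂, hn₂⟩ : ∃ n₂, n₂ = n₁ / 2 + 1 := ⟨_, rfl⟩
  obtain ⟨e₁, he₁⟩ := exists_embedding_forall_eq_mul_extSL_mul (ι := Fin n) (n := n) (m := n₁)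
    (by simp) (by omega) (by omega)
  obtain ⟨e₂, he₂⟩ := exists_embedding_forall_eq_mul_extSL_mul (ι := Fin n₁) (n := n₁) (m := n₂)
    (by simp) (by omega) (by omega)
  obtain ⟨a, ha, q, hq, h₁, rfl⟩ := he₁ h
  obtain ⟨p, hp, r, hr, h₂, hh₁⟩ := he₂ h₁
  obtain ⟨P, hP, E, hE, M, hM, F, hF, Q, hQ, hh₂⟩ := ih n₂ (by omega) (by omega) h₂
  obtain ⟨D⟩ : Nonempty (Fin n₁ ⊕ (Fin n₂ ⊕ Fin (4 * n₂)) ↪ Fin (4 * n)) :=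
    Function.Embedding.nonempty_of_card_le (by simp; omega)
  obtain ⟨f, g, hfg⟩ : ∃ (f : Fin n₁ ↪ Fin (4 * n)) (g : Fin n₂ ⊕ Fin (4 * n₂) ↪ Fin (4 * n)),
      ∀ i j, f i ≠ g j :=
    ⟨Function.Embedding.inl.trans D, Function.Embedding.inr.trans D,
      fun i j hij => by simpa using D.injective hij⟩
  set I : Fin n ↪ Fin n ⊕ Fin (4 * n) := Function.Embedding.inl
  set J : Fin (4 * n) ↪ Fin n ⊕ Fin (4 * n) := Function.Embedding.inr
  have hIJ : ∀ i j, I i ≠ J j := fun i j => by simp [I, J]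
  clear_value I J
  have hd1 : ∀ i j, I i ≠ (f.trans J) j := fun i j => hIJ _ _
  have hd2 : ∀ i j, I i ≠ (g.trans J) j := fun i j => hIJ _ _
  have hd3 : ∀ i j, (f.trans J) i ≠ (g.trans J) j := fun i j hij => hfg i j (J.injective hij)
  set y3 := extSL (Function.Embedding.inl : Fin n₂ ↪ Fin n₂ ⊕ Fin (4 * n₂)) h₂ with hy3
  set F' := extSL (Function.Embedding.inr : Fin (4 * n₂) ↪ Fin n₂ ⊕ Fin (4 * n₂)) F with hF'
  set Q' := extSL (Function.Embedding.inr : Fin (4 * n₂) ↪ Fin n₂ ⊕ Fin (4 * n₂)) Q with hQ'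
  have hcF : Commute y3 F' := extSL_commute _ _ (by simp) _ _
  have hcQ : Commute y3 Q' := extSL_commute _ _ (by simp) _ _
  have hz : P * E * M * (y3⁻¹ * F') * Q' = 1 := by
    rw [hcF.inv_left.eq]
    calc P * E * M * (F' * y3⁻¹) * Q' = P * E * M * F' * (y3⁻¹ * Q') := by simp only [mul_assoc]
      _ = 1 := by rw [hcQ.inv_left.eq, ← mul_assoc, ← hh₂, mul_inv_cancel]
  refine ⟨extSL I a * extSL (f.trans J) 1 * extSL (g.trans J) P, ?_,
    extSL I (extSL e₁ h₁) * extSL (f.trans J) h₁⁻¹ * extSL (g.trans J) E, ?_,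
    extSL I q * extSL (f.trans J) p * extSL (g.trans J) M, ?_,
    extSL f (extSL e₂ h₂) * extSL g (y3⁻¹ * F'), ?_,
    extSL f r * extSL g Q', ?_, ?_⟩
  · exact extSL_mul_mul_mem_unipPairs_pow hd1 hd2 hd3
      (extSL_inl_mul_extSL_inr_mem ha (one_mem_unipPairs_pow _)) hP
  · have hd1' : ∀ i j, (e₁.trans I) i ≠ (f.trans J) j := fun i j => hd1 (e₁ i) j
    have hd2' : ∀ i j, (e₁.trans I) i ≠ (g.trans J) j := fun i j => hd2 (e₁ i) j
    rw [← extSL_trans]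
    refine extSL_mul_mul_mem_unipPairs_pow hd1' hd2' hd3 ?_ hE
    exact extSL_mul_extSL_inv_mem Function.Embedding.inl Function.Embedding.inr (by simp) h₁
  · exact extSL_mul_mul_mem_unipPairs_pow hd1 hd2 hd3
      (extSL_inl_mul_extSL_inr_mem (mem_unipPairs_pow_mono hm hq)
        (mem_unipPairs_pow_mono (by omega) hp)) hM
  · rw [map_mul, ← mul_assoc, hy3, ← map_inv, hF', ← extSL_trans, ← extSL_trans, ← extSL_trans]
    have h12 : ∀ i j, (e₂.trans f) i ≠ (Function.Embedding.inl.trans g) j :=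
      fun i j => hfg (e₂ i) (Sum.inl j)
    have h13 : ∀ i j, (e₂.trans f) i ≠ (Function.Embedding.inr.trans g) j :=
      fun i j => hfg (e₂ i) (Sum.inr j)
    have h23 : ∀ i j, (Function.Embedding.inl.trans g) i ≠ (Function.Embedding.inr.trans g) j :=
      fun i j hij => by simpa using g.injective hij
    refine extSL_mul_mul_mem_unipPairs_pow h12 h13 h23 ?_ hF
    exact extSL_mul_extSL_inv_mem Function.Embedding.inl Function.Embedding.inr (by simp) h₂
  · exact extSL_mul_mem_unipPairs_pow hr (extSL_mem_unipPairs_pow hQ _) f g hfg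
  · have e1 : ∀ (y : Matrix.SpecialLinearGroup (Fin n₁) ℤ) z, extSL J (extSL f y * extSL g z) =
        extSL I 1 * extSL (f.trans J) y * extSL (g.trans J) z := by
      intro y z
      rw [map_mul, ← extSL_trans, ← extSL_trans, map_one, one_mul]
    rw [e1, e1]
    simp only [extSL_mul_mul_mul hd1 hd2 hd3]
    rw [hz]
    have hy : 1 * h₁⁻¹ * p * extSL e₂ h₂ * r = 1 := by
      rw [one_mul, mul_assoc, mul_assoc, ← mul_assoc p, ← hh₁, inv_mul_cancel]
    rw [hy]
    simp

theorem extSL_mem_of_base {m : ℕ} (hm : 2 ≤ m)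
    (base : ∀ h : Matrix.SpecialLinearGroup (Fin 2) ℤ,
      extSL (Function.Embedding.inl : Fin 2 ↪ Fin 2 ⊕ Fin 2) h ∈ unipPairs (Fin 2 ⊕ Fin 2) ^ m)
    {n : ℕ} (hn : 2 ≤ n) (hι : 5 * n ≤ Fintype.card ι) (e : Fin n ↪ ι)
    (h : Matrix.SpecialLinearGroup (Fin n) ℤ) : extSL e h ∈ unipPairs ι ^ (m + 7) := by
  obtain ⟨P, hP, E, hE, M, hM, F, hF, Q, hQ, hh⟩ := exists_extSL_eq_of_base hm base n hn h
  have hmem : extSL (Function.Embedding.inl : Fin n ↪ Fin n ⊕ Fin (4 * n)) h ∈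
      unipPairs (Fin n ⊕ Fin (4 * n)) ^ (m + 7) := by
    rw [hh]
    refine mul_mem_unipPairs_pow (m := m + 5) le_rfl (mul_mem_unipPairs_pow (m := m + 3) le_rfl
      (mul_mem_unipPairs_pow (m := 3) (by omega) (mul_mem_unipPairs_pow (m := 1) le_rfl hP hE)
      hM) (extSL_mem_unipPairs_pow hF _)) (extSL_mem_unipPairs_pow hQ _)
  obtain ⟨f⟩ : Nonempty (Fin (4 * n) ↪ {i : ι // i ∉ Set.range e}) := by
    refine Function.Embedding.nonempty_of_card_le ?_
    have := Fintype.card_subtype_compl (fun i : ι => i ∈ Set.range e)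
    have h2 : Fintype.card {i : ι // i ∈ Set.range e} = n := by
      rw [← Fintype.card_congr (Equiv.ofInjective e e.injective)]
      simp
    rw [this, h2]
    simp
    omega
  rw [← extSL_sumEmb_inl e (f.trans (Function.Embedding.subtype _))
    (fun a b hab => (f b).2 ⟨a, hab⟩)]
  exact extSL_mem_unipPairs_pow hmem _

theorem mem_unipPairs_pow_of_base {m : ℕ} (hm : 2 ≤ m)
    (base : ∀ h : Matrix.SpecialLinearGroup (Fin 2) ℤ,
      extSL (Function.Embedding.inl : Fin 2 ↪ Fin 2 ⊕ Fin 2) h ∈ unipPairs (Fin 2 ⊕ Fin 2) ^ m)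
    (hι : 50 ≤ Fintype.card ι) (g : Matrix.SpecialLinearGroup ι ℤ) :
    g ∈ unipPairs ι ^ (m + 16) := by
  obtain ⟨n, hn⟩ : ∃ n, n = Fintype.card ι := ⟨_, rfl⟩
  obtain ⟨n₁, hn₁⟩ : ∃ n₁, n₁ = n / 2 + 1 := ⟨_, rfl⟩
  obtain ⟨n₂, hn₂⟩ : ∃ n₂, n₂ = n₁ / 2 + 1 := ⟨_, rfl⟩
  obtain ⟨n₃, hn₃⟩ : ∃ n₃, n₃ = n₂ / 2 + 1 := ⟨_, rfl⟩
  obtain ⟨e₁, he₁⟩ := exists_embedding_forall_eq_mul_extSL_mul (ι := ι) (n := n) (m := n₁)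
    hn.symm (by omega) (by omega)
  obtain ⟨e₂, he₂⟩ := exists_embedding_forall_eq_mul_extSL_mul (ι := Fin n₁) (n := n₁) (m := n₂)
    (by simp) (by omega) (by omega)
  obtain ⟨e₃, he₃⟩ := exists_embedding_forall_eq_mul_extSL_mul (ι := Fin n₂) (n := n₂) (m := n₃)
    (by simp) (by omega) (by omega)
  obtain ⟨p₁, hp₁, q₁, hq₁, x₁, rfl⟩ := he₁ g
  obtain ⟨p₂, hp₂, q₂, hq₂, x₂, rfl⟩ := he₂ x₁
  obtain ⟨p₃, hp₃, q₃, hq₃, x₃, rfl⟩ := he₃ x₂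
  simp only [map_mul, ← extSL_trans]
  have h3 := extSL_mem_of_base hm base (n := n₃) (by omega) (by omega) (e₃.trans (e₂.trans e₁)) x₃
  have hp₃' := extSL_mem_unipPairs_pow hp₃ (e₂.trans e₁)
  have hq₃' := extSL_mem_unipPairs_pow hq₃ (e₂.trans e₁)
  have hp₂' := extSL_mem_unipPairs_pow hp₂ e₁
  have hq₂' := extSL_mem_unipPairs_pow hq₂ e₁
  have h2 := mul_mem_unipPairs_pow (k := m + 10) (by omega)
    (mul_mem_unipPairs_pow (k := m + 8) (by omega) hp₃' h3) hq₃'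
  have h1 := mul_mem_unipPairs_pow (k := m + 13) (by omega)
    (mul_mem_unipPairs_pow (k := m + 11) (by omega) hp₂' h2) hq₂'
  exact mul_mem_unipPairs_pow (by omega)
    (mul_mem_unipPairs_pow (k := m + 14) (by omega) hp₁ h1) hq₁

end Recursion

section SLTwo

/-- After stabilization to size four, the matrix is a product of `n` unipotent pairs. -/
def IsPairProduct (n : ℕ) (x : SL(2, ℤ)) : Prop :=
  extSL (Function.Embedding.inl : Fin 2 ↪ Fin 2 ⊕ Fin 2) x ∈ unipPairs (Fin 2 ⊕ Fin 2) ^ n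

theorem IsPairProduct.mono {m n : ℕ} {x : SL(2, ℤ)} (h : IsPairProduct m x) (hmn : m ≤ n) :
    IsPairProduct n x :=
  mem_unipPairs_pow_mono hmn h

theorem IsPairProduct.mul {m n : ℕ} {x y : SL(2, ℤ)} (h : IsPairProduct m x)
    (h' : IsPairProduct n y) : IsPairProduct (m + n) (x * y) := by
  unfold IsPairProduct
  rw [map_mul]
  exact mul_mem_unipPairs_pow le_rfl h h'

theorem IsPairProduct.inv {n : ℕ} {x : SL(2, ℤ)} (h : IsPairProduct n x) :
    IsPairProduct n x⁻¹ := by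
  unfold IsPairProduct
  rw [map_inv]
  exact inv_mem_unipPairs_pow h

/-- The elementary matrix with upper right entry `t`. -/
def e12 (t : ℤ) : SL(2, ℤ) := ⟨!![1, t; 0, 1], by simp⟩

/-- The elementary matrix with lower left entry `t`. -/
def e21 (t : ℤ) : SL(2, ℤ) := ⟨!![1, 0; t, 1], by simp⟩

theorem isBlockUnipotent_e12 (t : ℤ) : IsBlockUnipotent {0} (e12 t) := by
  intro i j h
  fin_cases i <;> fin_cases j <;> simp [e12] at h ⊢

theorem isBlockUnipotent_e21 (t : ℤ) : IsBlockUnipotent {0}ᶜ (e21 t) := by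
  intro i j h
  fin_cases i <;> fin_cases j <;> simp [e21] at h ⊢

theorem isPairProduct_e12_mul_e21 (s t : ℤ) : IsPairProduct 1 (e12 s * e21 t) :=
  extSL_mem_unipPairs_pow (by
    rw [pow_one]
    exact (isBlockUnipotent_e12 s).mul_mem_unipPairs (isBlockUnipotent_e21 t)) _

theorem isPairProduct_e21_mul_e12 (s t : ℤ) : IsPairProduct 1 (e21 s * e12 t) :=
  extSL_mem_unipPairs_pow (by
    rw [pow_one]
    exact (isBlockUnipotent_e21 s).mul_mem_unipPairs' (isBlockUnipotent_e12 t)) _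

theorem e12_zero : e12 0 = 1 := by
  apply Subtype.ext
  ext i j
  fin_cases i <;> fin_cases j <;> simp [e12]

theorem e21_zero : e21 0 = 1 := by
  apply Subtype.ext
  ext i j
  fin_cases i <;> fin_cases j <;> simp [e21]

theorem isPairProduct_e12 (t : ℤ) : IsPairProduct 1 (e12 t) := by
  simpa [e21_zero] using isPairProduct_e12_mul_e21 t 0

theorem isPairProduct_e21 (t : ℤ) : IsPairProduct 1 (e21 t) := by
  simpa [e12_zero] using isPairProduct_e12_mul_e21 0 t

theorem isPairProduct_of_row {M : SL(2, ℤ)} {k : ℤ} (h : M.1 0 0 = 1 + M.1 0 1 * k) :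
    IsPairProduct 2 M := by
  have hM := M.2
  rw [Matrix.det_fin_two] at hM
  have : M = (e21 (M.1 1 0 - M.1 1 1 * k) * e12 (M.1 0 1)) * e21 k := by
    apply Subtype.ext
    change M.1 = !![1, 0; _, 1] * !![1, _; 0, 1] * !![1, 0; _, 1]
    ext i j
    fin_cases i <;> fin_cases j
    · simp [h]
    · simp
    · simp
      linear_combination k * hM - k * M.1 1 1 * h
    · simp
      linear_combination hM - M.1 1 1 * h
  rw [this]
  exact (isPairProduct_e21_mul_e12 _ _).mul (isPairProduct_e21 _)

/-- The central involution of `SL(2, ℤ)`. -/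
def negOne : SL(2, ℤ) := ⟨-1, by simp [Matrix.det_neg]⟩

theorem negOne_mul_negOne : negOne * negOne = 1 := by
  apply Subtype.ext
  change (-1 : Matrix (Fin 2) (Fin 2) ℤ) * -1 = 1
  simp

theorem negOne_mul_val (x : SL(2, ℤ)) : (negOne * x).1 = -x.1 := by
  change (-1 : Matrix (Fin 2) (Fin 2) ℤ) * x.1 = -x.1
  simp

theorem isPairProduct_negOne : IsPairProduct 3 negOne := by
  have : negOne = (e12 1 * e21 (-1)) * (e12 2 * e21 (-1)) * e12 1 := by
    apply Subtype.ext
    change -1 = !![1, _; 0, 1] * !![1, 0; _, 1] * (!![1, _; 0, 1] * !![1, 0; _, 1]) * !![1, _; 0, 1]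
    ext i j
    fin_cases i <;> fin_cases j <;> simp
  rw [this]
  exact ((isPairProduct_e12_mul_e21 _ _).mul (isPairProduct_e12_mul_e21 _ _)).mul
    (isPairProduct_e12 _)

theorem extSL_inr_mem {n : ℕ} {x : SL(2, ℤ)} (h : IsPairProduct n x) :
    extSL (Function.Embedding.inr : Fin 2 ↪ Fin 2 ⊕ Fin 2) x ∈ unipPairs (Fin 2 ⊕ Fin 2) ^ n := by
  have h1 := extSL_mem_unipPairs_pow h (Equiv.sumComm (Fin 2) (Fin 2)).toEmbedding
  rw [← extSL_trans] at h1
  exact h1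

theorem IsPairProduct.of_swap {n : ℕ} {M N : SL(2, ℤ)} (hN : IsPairProduct n N)
    {X Y : Matrix (Fin 2) (Fin 2) ℤ} (h1 : M.1 = 1 + X * Y) (h2 : N.1 = 1 + Y * X) :
    IsPairProduct (2 + n) M := by
  have h := mul_mem_unipPairs_pow le_rfl (extSL_mul_extSL_inv_mem_of_swap
    (Function.Embedding.inl : Fin 2 ↪ Fin 2 ⊕ Fin 2) Function.Embedding.inr (by simp) X Y M N h1 h2)
    (extSL_inr_mem hN)
  rw [mul_assoc, ← map_mul, inv_mul_cancel, map_one, mul_one] at h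
  exact h

theorem IsPairProduct.of_neg_swap {n : ℕ} {M N : SL(2, ℤ)} (hN : IsPairProduct n N)
    {X Y : Matrix (Fin 2) (Fin 2) ℤ} (h1 : -M.1 = 1 + X * Y) (h2 : -N.1 = 1 + Y * X) :
    IsPairProduct (4 + n) M := by
  set i : Fin 2 ↪ Fin 2 ⊕ Fin 2 := Function.Embedding.inl
  set j : Fin 2 ↪ Fin 2 ⊕ Fin 2 := Function.Embedding.inr
  have hij : ∀ a b, i a ≠ j b := by simp [i, j]
  have hs1 := extSL_mul_extSL_inv_mem_of_swap i j hij X Y (negOne * M) (negOne * N)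
    (by rw [negOne_mul_val, h1]) (by rw [negOne_mul_val, h2])
  have hs2 := extSL_mul_extSL_inv_mem_of_swap i j hij 1 (-2) negOne negOne
    (by simp only [negOne]; norm_num) (by simp only [negOne]; norm_num)
  have h := mul_mem_unipPairs_pow le_rfl (mul_mem_unipPairs_pow (k := 4) le_rfl hs2 hs1)
    (extSL_inr_mem hN)
  have hc := (extSL_commute i j hij (negOne * M) negOne⁻¹).eq
  have e : extSL i negOne * extSL j negOne⁻¹ * (extSL i (negOne * M) * extSL j (negOne * N)⁻¹) *
      extSL j N = extSL i M := by
    calc _ = extSL i negOne * (extSL j negOne⁻¹ * extSL i (negOne * M)) *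
          (extSL j (negOne * N)⁻¹ * extSL j N) := by simp only [mul_assoc]
      _ = extSL i negOne * extSL i (negOne * M) *
          (extSL j negOne⁻¹ * (extSL j (negOne * N)⁻¹ * extSL j N)) := by
        rw [← hc]; simp only [mul_assoc]
      _ = extSL i (negOne * negOne * M) := by
        rw [← map_mul, ← map_mul, ← map_mul]
        have : negOne⁻¹ * ((negOne * N)⁻¹ * N) = 1 := by
          rw [mul_inv_rev, ← negOne_mul_negOne, mul_assoc]
          have hcomm : negOne⁻¹ * N = N * negOne⁻¹ := by
            have h3 : negOne * N = N * negOne := by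
              apply Subtype.ext
              rw [negOne_mul_val]
              change -N.1 = N.1 * -1
              simp
            rw [inv_mul_eq_iff_eq_mul, ← mul_assoc, h3]; simp
          rw [hcomm, inv_mul_cancel_left, negOne_mul_negOne, ← mul_inv_rev, negOne_mul_negOne,
            inv_one]
        rw [this]
        simp [mul_assoc]
      _ = _ := by rw [negOne_mul_negOne, one_mul]
  rw [e] at h
  exact h

theorem IsPairProduct.of_reverse {n : ℕ} {M N : SL(2, ℤ)} (hN : IsPairProduct n N)
    (h : ∀ i j, N.1 i j = M.1 (Equiv.swap 0 1 i) (Equiv.swap 0 1 j)) : IsPairProduct n M := by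
  have hM : extSL (Equiv.swap (0 : Fin 2) 1).toEmbedding N = M := by
    apply Subtype.ext
    rw [extSL_val, extMat]
    ext i j
    fin_cases i <;> fin_cases j <;>
      simp [inclMat, Matrix.mul_apply, Fin.sum_univ_two, h, Matrix.transpose_apply]
  have h1 := extSL_mem_unipPairs_pow hN (Equiv.sumCongr (Equiv.swap (0 : Fin 2) 1)
    (Equiv.refl (Fin 2))).toEmbedding
  rw [← extSL_trans] at h1
  unfold IsPairProduct
  rw [← hM, ← extSL_trans]
  exact h1

end SLTwo

section SLTwoPowers

theorem exists_pow_val_eq (A : SL(2, ℤ)) (l : ℕ) :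
    ∃ y y' : ℤ, (A ^ l).1 = !![y * A.1 0 0 - y', y * A.1 0 1; y * A.1 1 0, y * A.1 1 1 - y'] ∧
      y' ^ 2 - y * y' * A.1.trace + y ^ 2 = 1 := by
  induction l with
  | zero => exact ⟨0, -1, by simp [Matrix.one_fin_two], by norm_num⟩
  | succ l ih =>
    obtain ⟨y, y', h, h'⟩ := ih
    refine ⟨y * A.1.trace - y', y, ?_, by linear_combination h'⟩
    have hA := A.2
    rw [Matrix.det_fin_two] at hA
    rw [pow_succ]
    change (A ^ l).1 * A.1 = _
    rw [h, Matrix.trace_fin_two]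
    ext i j
    fin_cases i <;> fin_cases j <;> simp [Matrix.mul_apply, Fin.sum_univ_two]
    · linear_combination (-y) * hA
    · ring
    · ring
    · linear_combination (-y) * hA

theorem exists_pow_apply_eq (A : SL(2, ℤ)) (n : ℕ) :
    ∃ k r : ℤ, (A ^ n).1 0 0 = A.1 0 0 ^ n + A.1 0 1 * k ∧ (A ^ n).1 0 1 = A.1 0 1 * r := by
  induction n with
  | zero => exact ⟨0, 0, by simp, by simp⟩
  | succ n ih =>
    obtain ⟨k, r, h, h'⟩ := ih
    refine ⟨k * A.1 0 0 + r * A.1 1 0, A.1 0 0 ^ n + A.1 0 1 * k + r * A.1 1 1, ?_, ?_⟩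
    · rw [pow_succ]
      change ((A ^ n).1 * A.1) 0 0 = _
      rw [Matrix.mul_apply, Fin.sum_univ_two, h, h']
      ring
    · rw [pow_succ]
      change ((A ^ n).1 * A.1) 0 1 = _
      rw [Matrix.mul_apply, Fin.sum_univ_two, h, h']
      ring

theorem exists_val_eq_one_add_mul {X Y : Matrix (Fin 2) (Fin 2) ℤ} {M : SL(2, ℤ)}
    (h : M.1 = 1 + X * Y) : ∃ N : SL(2, ℤ), N.1 = 1 + Y * X :=
  ⟨⟨1 + Y * X, by rw [Matrix.det_one_add_mul_comm, ← h, M.2]⟩, rfl⟩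

theorem isPairProduct_pow (A : SL(2, ℤ)) (l : ℕ) (h : A.1 0 1 ∣ A.1 0 0 ^ (2 * l) - 1) :
    IsPairProduct 8 (A ^ (2 * l)) := by
  obtain ⟨y, y', hy, hy'⟩ := exists_pow_val_eq A l
  obtain ⟨k, r, hk, -⟩ := exists_pow_apply_eq A (2 * l)
  have hA := A.2
  rw [Matrix.det_fin_two] at hA
  rw [Matrix.trace_fin_two] at hy'
  have hsq : (A ^ (2 * l)).1 = (A ^ l).1 * (A ^ l).1 := by
    rw [two_mul, pow_add]
    rfl
  set a := A.1 0 0 with ha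
  set b := A.1 0 1 with hb
  set c := A.1 1 0 with hc
  set d := A.1 1 1 with hd
  set v := y * (a + d) - 2 * y' with hv
  set z := (a + d) * y' - 2 * y with hz
  have hM : (A ^ (2 * l)).1 =
      !![1 + y * (v * a + z), y * (v * b); y * (v * c), 1 + y * (v * d + z)] := by
    rw [hsq, hy]
    ext i j
    fin_cases i <;> fin_cases j <;> simp [Matrix.mul_apply, Fin.sum_univ_two]
    · linear_combination hy' - y ^ 2 * hA
    · ring
    · ring
    · linear_combination hy' - y ^ 2 * hA
  have h1 : (A ^ (2 * l)).1 = 1 + !![y, 0; 0, 1] *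
      !![v * a + z, v * b; y * (v * c), y * (v * d + z)] := by
    rw [hM]
    ext i j
    fin_cases i <;> fin_cases j <;> simp
  obtain ⟨M₁, hM₁⟩ := exists_val_eq_one_add_mul h1
  have h2 : -M₁.1 = 1 + !![v, 0; 0, 1] *
      !![y' - y * a, -b; -(v * y ^ 2 * c), v * (y' - y * d)] := by
    rw [hM₁]
    ext i j
    fin_cases i <;> fin_cases j <;> simp
    · linear_combination 2 * hy'
    · ring
    · linear_combination 2 * hy'
  have h2' : (negOne * M₁).1 = _ := (negOne_mul_val M₁).trans h2
  obtain ⟨N₂, hN₂⟩ := exists_val_eq_one_add_mul h2'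
  have h3 : -(negOne * N₂).1 = 1 + !![y' - y * a, -b; -(v * y ^ 2 * c), v * (y' - y * d)] *
      !![v, 0; 0, 1] := by
    rw [negOne_mul_val, neg_neg]
    exact hN₂
  have hrow : IsPairProduct 2 (negOne * N₂) := by
    have e1 : (negOne * N₂).1 0 1 = b := by
      rw [negOne_mul_val, hN₂]
      simp
    have e2 : (negOne * N₂).1 0 0 = (A ^ (2 * l)).1 0 0 := by
      rw [negOne_mul_val, hN₂, hM]
      simp
      linear_combination 2 * hy'
    obtain ⟨q, hq⟩ := h
    apply isPairProduct_of_row (k := q + k)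
    rw [e1, e2, hk]
    linear_combination hq
  exact ((hrow.of_neg_swap h2 h3).of_swap h1 hM₁).mono (by norm_num)

end SLTwoPowers

section SLTwoBound

theorem Int.exists_dvd_sub_and_dvd_sub {m n : ℤ} (h : IsCoprime m n) (p q : ℤ) :
    ∃ r, m ∣ r - p ∧ n ∣ r - q := by
  obtain ⟨x, y, hxy⟩ := h
  refine ⟨p + m * x * (q - p), ⟨x * (q - p), by ring⟩, ⟨(p - q) * y, ?_⟩⟩
  linear_combination (q - p) * hxy

theorem IsCoprime.of_dvd_sub {m r p : ℤ} (h : IsCoprime p m) (hd : m ∣ r - p) : IsCoprime r m := by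
  obtain ⟨k, hk⟩ := hd
  have : r = p + m * k := by linear_combination hk
  rw [this]
  exact (IsCoprime.add_mul_left_left_iff).2 h

theorem Int.exists_prime_dvd_sub {m r : ℤ} (hm : m ≠ 0) (h : IsCoprime r m) :
    ∃ p : ℕ, p.Prime ∧ m ∣ p - r := by
  have : NeZero m.natAbs := ⟨by simpa using hm⟩
  have hu : IsUnit (r : ZMod m.natAbs) := by
    obtain ⟨x, y, hxy⟩ := h
    have h1 : ((m : ℤ) : ZMod m.natAbs) = 0 := by
      rw [ZMod.intCast_zmod_eq_zero_iff_dvd]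
      exact Int.natAbs_dvd.2 dvd_rfl
    have h2 := congrArg (Int.cast : ℤ → ZMod m.natAbs) hxy
    push_cast at h2
    rw [h1, mul_zero, add_zero] at h2
    exact IsUnit.of_mul_eq_one_right _ h2
  obtain ⟨p, -, hp, hpr⟩ := Nat.forall_exists_prime_gt_and_eq_mod hu 0
  refine ⟨p, hp, ?_⟩
  rw [← Int.natAbs_dvd, ← ZMod.intCast_zmod_eq_zero_iff_dvd]
  push_cast
  rw [hpr, sub_self]

theorem exists_eq_e21_mul {x y : SL(2, ℤ)} (h0 : x.1 0 0 = y.1 0 0) (h1 : x.1 0 1 = y.1 0 1) :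
    ∃ m, x = e21 m * y := by
  have hx := x.2
  have hy := y.2
  rw [Matrix.det_fin_two] at hx hy
  refine ⟨x.1 1 0 * y.1 1 1 - x.1 1 1 * y.1 1 0, ?_⟩
  apply Subtype.ext
  change x.1 = !![1, 0; _, 1] * y.1
  ext i j
  fin_cases i <;> fin_cases j <;> simp [Matrix.mul_apply, Fin.sum_univ_two, h0, h1]
  · rw [h0, h1] at hx
    linear_combination y.1 1 0 * hx - x.1 1 0 * hy
  · rw [h0, h1] at hx
    linear_combination y.1 1 1 * hx - x.1 1 1 * hy

theorem isPairProduct_sq (A : SL(2, ℤ)) {b c : ℕ} (hb : b.Prime) (hc : c.Prime)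
    (h1 : (b : ℤ) ∣ A.1 0 1) (h2 : A.1 0 1 ∣ b) (h3 : A.1 1 0 = c) (h4 : b - 1 ∣ c + 1)
    (h5 : 2 ∣ b - 1) : IsPairProduct 16 (A ^ 2) := by
  have hA := A.2
  rw [Matrix.det_fin_two] at hA
  obtain ⟨l, hl⟩ := h5.trans h4
  have hl1 : 1 ≤ l := by omega
  have hpow : A ^ 2 = A ^ (2 * l) * (A ^ (2 * (l - 1)))⁻¹ := by
    rw [eq_mul_inv_iff_mul_eq, ← pow_add]
    congr 1
    omega
  have p1 : IsPairProduct 8 (A ^ (2 * l)) := by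
    apply isPairProduct_pow
    refine h2.trans ?_
    have hco : IsCoprime (A.1 0 0) b := by
      obtain ⟨k, hk⟩ := h1
      exact ⟨A.1 1 1, -(k * A.1 1 0), by rw [hk] at hA; linear_combination hA⟩
    have := Int.ModEq.pow_card_sub_one_eq_one hb hco
    rw [← hl]
    obtain ⟨k, hk⟩ := h4
    rw [hk, pow_mul]
    exact (this.pow k).symm.dvd.trans (by simp)
  have p2 : IsPairProduct 8 (A ^ (2 * (l - 1))) := by
    obtain ⟨B, hB⟩ : ∃ B : SL(2, ℤ), B.1 = !![A.1 1 1, A.1 1 0; A.1 0 1, A.1 0 0] :=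
      ⟨⟨_, by rw [Matrix.det_fin_two]; simp; linear_combination hA⟩, rfl⟩
    have hBpow : ∀ n, ∀ i j, (B ^ n).1 i j =
        (A ^ n).1 (Equiv.swap 0 1 i) (Equiv.swap 0 1 j) := by
      intro n
      induction n with
      | zero =>
        intro i j
        fin_cases i <;> fin_cases j <;> simp
      | succ n ih =>
        intro i j
        rw [pow_succ, pow_succ]
        change ((B ^ n).1 * B.1) i j = ((A ^ n).1 * A.1) _ _
        rw [Matrix.mul_apply, Matrix.mul_apply, Fin.sum_univ_two, Fin.sum_univ_two, ih, ih, hB]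
        fin_cases j <;> simp [add_comm]
    have hB8 : IsPairProduct 8 (B ^ (2 * (l - 1))) := by
      apply isPairProduct_pow
      have e0 : B.1 0 0 = A.1 1 1 := by simp [hB]
      have e1 : B.1 0 1 = c := by simp [hB, h3]
      rw [e0, e1]
      have hco : IsCoprime (A.1 1 1) c :=
        ⟨A.1 0 0, -A.1 0 1, by rw [h3] at hA; linear_combination hA⟩
      have := Int.ModEq.pow_card_sub_one_eq_one hc hco
      have hcl : 2 * (l - 1) = c - 1 := by omega
      rw [hcl]
      exact this.symm.dvd
    exact hB8.of_reverse (hBpow _)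
  rw [hpow]
  exact p1.mul p2.inv

theorem exists_eq_e21_mul_mul_e21 (g : SL(2, ℤ)) {a : ℤ} {b : ℕ} (hb : b.Prime)
    (h5 : 2 ∣ b - 1) (ha0 : a ≠ 0) (hab : IsCoprime a (b - 1)) (h0 : g.1 0 0 = a ^ 2)
    (h1 : (b : ℤ) ∣ g.1 0 1) (h2 : g.1 0 1 ∣ b) :
    ∃ s r N, g = e21 s * N * e21 r ∧ IsPairProduct 20 N ∧ IsPairProduct 21 (negOne * N) := by
  have hg := g.2
  rw [Matrix.det_fin_two, h0] at hg
  set β := g.1 0 1 with hβ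
  obtain ⟨c₁, hc₁, hc₂⟩ := Int.exists_dvd_sub_and_dvd_sub hab (g.1 1 0) (-1)
  have hac : a ∣ 1 + β * c₁ := by
    obtain ⟨k, hk⟩ := hc₁
    exact ⟨a * g.1 1 1 + β * k, by linear_combination β * hk - hg⟩
  have hc₁' : IsCoprime c₁ (a * (b - 1)) := by
    refine IsCoprime.mul_right ?_ ?_
    · obtain ⟨k, hk⟩ := hac
      exact ⟨-β, k, by linear_combination -hk⟩
    · exact IsCoprime.of_dvd_sub (isCoprime_one_left.neg_left) hc₂
  have hb1 : (b : ℤ) - 1 ≠ 0 := by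
    have := hb.two_le
    omega
  obtain ⟨c, hc, hcd⟩ := Int.exists_prime_dvd_sub (mul_ne_zero ha0 hb1) hc₁'
  have hca : a ∣ 1 + β * c := by
    have : (1 : ℤ) + β * c = (1 + β * c₁) + β * (c - c₁) := by ring
    rw [this]
    exact dvd_add hac (((Dvd.intro _ rfl).trans hcd).mul_left _)
  have hcb : (b : ℤ) - 1 ∣ c + 1 := by
    have : (c : ℤ) + 1 = (c₁ - -1) + (c - c₁) := by ring
    rw [this]
    exact dvd_add hc₂ ((Dvd.intro_left _ rfl).trans hcd)
  have hcb' : b - 1 ∣ c + 1 := by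
    have := hb.one_le
    zify [this]
    exact hcb
  obtain ⟨d, hd⟩ := hca
  obtain ⟨A, hA⟩ : ∃ A : SL(2, ℤ), A.1 = !![a, β; (c : ℤ), d] :=
    ⟨⟨_, by rw [Matrix.det_fin_two]; simp; linear_combination -hd⟩, rfl⟩
  have hA16 : IsPairProduct 16 (A ^ 2) := isPairProduct_sq A hb hc (by simpa [hA] using h1)
    (by simpa [hA] using h2) (by simp [hA]) hcb' h5
  have e1 : -(A ^ 2).1 = 1 + !![a + d, 0; 0, 1] * !![-a, -β; -((a + d) * c), -((a + d) * d)] := by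
    rw [pow_two]
    change -(A.1 * A.1) = _
    rw [hA]
    ext i j
    fin_cases i <;> fin_cases j <;> simp
    · linear_combination -hd
    · ring
    · ring
    · linear_combination -hd
  have e2 : (negOne * A ^ 2).1 = _ := (negOne_mul_val (A ^ 2)).trans e1
  obtain ⟨N', hN'⟩ := exists_val_eq_one_add_mul e2
  have e3 : -(negOne * N').1 = 1 + !![-a, -β; -((a + d) * c), -((a + d) * d)] *
      !![a + d, 0; 0, 1] := by
    rw [negOne_mul_val, neg_neg, hN']
  have hN20 : IsPairProduct 20 (negOne * N') := hA16.of_neg_swap e3 e1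
  have hN21 : IsPairProduct 21 N' :=
    ((isPairProduct_negOne.mul hA16).of_swap hN' e2).mono (by norm_num)
  obtain ⟨s, hs⟩ := exists_eq_e21_mul (x := g) (y := negOne * N' * e21 (-c)) (by
      change _ = ((negOne * N').1 * (e21 (-c)).1) 0 0
      rw [negOne_mul_val, hN', h0]
      simp [e21, Matrix.mul_apply, Fin.sum_univ_two]
      linear_combination hd) (by
      change _ = ((negOne * N').1 * (e21 (-c)).1) 0 1
      rw [negOne_mul_val, hN']
      simp [e21, Matrix.mul_apply, Fin.sum_univ_two, ← hβ])
  refine ⟨s, -c, negOne * N', by rw [hs]; simp only [mul_assoc], hN20, ?_⟩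
  rw [← mul_assoc, negOne_mul_negOne, one_mul]
  exact hN21

theorem isPairProduct_of_SL_two (h : SL(2, ℤ)) : IsPairProduct 24 h := by
  have hdet := h.2
  rw [Matrix.det_fin_two] at hdet
  obtain ⟨j, hj⟩ : ∃ j : ℤ, ¬ (2 : ℤ) ∣ h.1 0 0 + j * h.1 0 1 := by
    by_cases h0 : (2 : ℤ) ∣ h.1 0 0
    · refine ⟨1, fun h1 => ?_⟩
      have h2 : (2 : ℤ) ∣ h.1 0 1 := by
        have := dvd_sub h1 h0
        simpa using this
      have h3 : (2 : ℤ) ∣ 1 := hdet ▸ dvd_sub (h0.mul_right _) (h2.mul_right _)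
      omega
    · exact ⟨0, by simpa using h0⟩
  obtain ⟨u, hu⟩ : ∃ u, u = h.1 0 0 + j * h.1 0 1 := ⟨_, rfl⟩
  obtain ⟨v, hv⟩ : ∃ v, v = h.1 0 1 := ⟨_, rfl⟩
  rw [← hu] at hj
  have hu0 : u ≠ 0 := by
    rintro h0
    simp [h0] at hj
  have huv : IsCoprime v u :=
    ⟨-(h.1 1 0 + j * h.1 1 1), h.1 1 1, by rw [hu, hv]; linear_combination hdet⟩
  have hu2 : IsCoprime u 2 := by
    rw [isCoprime_comm]
    exact (Int.prime_two.coprime_iff_not_dvd).2 hj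
  have hu4 : IsCoprime u 4 := by
    have := hu2.pow_right (n := 2)
    norm_num at this
    exact this
  obtain ⟨r, hr1, hr2⟩ := Int.exists_dvd_sub_and_dvd_sub hu4 v 3
  have hr : IsCoprime r (u * 4) :=
    IsCoprime.mul_right (huv.of_dvd_sub hr1) (IsCoprime.of_dvd_sub ⟨-1, 1, by norm_num⟩ hr2)
  obtain ⟨b, hb, hbr⟩ := Int.exists_prime_dvd_sub (mul_ne_zero hu0 (by norm_num)) hr
  have hbv : u ∣ b - v := by
    have : (b : ℤ) - v = (b - r) + (r - v) := by ring
    rw [this]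
    exact dvd_add ((Dvd.intro _ rfl).trans hbr) hr1
  have hb4 : (4 : ℤ) ∣ b - 3 := by
    have : (b : ℤ) - 3 = (b - r) + (r - 3) := by ring
    rw [this]
    exact dvd_add ((Dvd.intro_left _ rfl).trans hbr) hr2
  obtain ⟨k, hk⟩ : ∃ k : ℕ, b = 4 * k + 3 := ⟨b / 4, by omega⟩
  obtain ⟨t, ht⟩ := hbv
  have hub : IsCoprime u b := (huv.of_dvd_sub ⟨t, ht⟩).symm
  have hfermat : (b : ℤ) ∣ (u ^ (2 * k + 1) - 1) * (u ^ (2 * k + 1) - -1) := by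
    have h1 := (Int.ModEq.pow_card_sub_one_eq_one hb hub).symm.dvd
    have h2 : b - 1 = (2 * k + 1) * 2 := by omega
    rw [h2, pow_mul] at h1
    convert h1 using 1
    ring
  obtain ⟨ε, hε, hεd⟩ : ∃ ε : ℤ, (ε = 1 ∨ ε = -1) ∧ (b : ℤ) ∣ u ^ (2 * k + 1) - ε := by
    rcases (Nat.prime_iff_prime_int.1 hb).dvd_or_dvd hfermat with h1 | h1
    · exact ⟨1, Or.inl rfl, h1⟩
    · exact ⟨-1, Or.inr rfl, h1⟩
  obtain ⟨a, ha1, ha2⟩ := Int.exists_dvd_sub_and_dvd_sub (m := b) (n := b - 1)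
    ⟨1, -1, by ring⟩ (u ^ (k + 1)) 1
  have hab : IsCoprime a b := (hub.pow_left (m := k + 1)).of_dvd_sub ha1
  have ha0 : a ≠ 0 := by
    rintro rfl
    rw [isCoprime_zero_left, Int.isUnit_iff] at hab
    have := hb.two_le
    omega
  have hab1 : IsCoprime a (b - 1) := isCoprime_one_left.of_dvd_sub ha2
  have hsq : (b : ℤ) ∣ ε * a ^ 2 - u := by
    have hεε : ε * ε = 1 := by rcases hε with rfl | rfl <;> norm_num
    have : ε * a ^ 2 - u = ε * ((a - u ^ (k + 1)) * (a + u ^ (k + 1)) +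
        u * (u ^ (2 * k + 1) - ε)) := by
      linear_combination u * hεε
    rw [this]
    exact (dvd_add (ha1.mul_right _) (hεd.mul_left _)).mul_left _
  obtain ⟨t', ht'⟩ := hsq
  set g := h * e21 j * e12 t * e21 t' with hgdef
  have hg0 : g.1 0 0 = ε * a ^ 2 := by
    change (h.1 * (e21 j).1 * (e12 t).1 * (e21 t').1) 0 0 = _
    simp [e12, e21, Matrix.mul_apply, Fin.sum_univ_two, ← hv]
    rw [hv] at *
    linear_combination -hu - ht' - t' * ht - t' * t * hu
  have hg1 : g.1 0 1 = b := by
    change (h.1 * (e21 j).1 * (e12 t).1 * (e21 t').1) 0 1 = _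
    simp [e12, e21, Matrix.mul_apply, Fin.sum_univ_two, ← hv]
    rw [hv] at *
    linear_combination -ht - t * hu
  have hh : h = g * (e21 (-t') * e12 (-t) * e21 (-j)) := by
    have i1 : e21 (-t') = (e21 t')⁻¹ := by
      rw [eq_inv_iff_mul_eq_one]
      apply Subtype.ext
      change !![1, 0; _, 1] * !![1, 0; _, 1] = (1 : Matrix (Fin 2) (Fin 2) ℤ)
      simp [Matrix.one_fin_two]
    have i2 : e12 (-t) = (e12 t)⁻¹ := by
      rw [eq_inv_iff_mul_eq_one]
      apply Subtype.ext
      change !![1, _; 0, 1] * !![1, _; 0, 1] = (1 : Matrix (Fin 2) (Fin 2) ℤ)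
      simp [Matrix.one_fin_two]
    have i3 : e21 (-j) = (e21 j)⁻¹ := by
      rw [eq_inv_iff_mul_eq_one]
      apply Subtype.ext
      change !![1, 0; _, 1] * !![1, 0; _, 1] = (1 : Matrix (Fin 2) (Fin 2) ℤ)
      simp [Matrix.one_fin_two]
    rw [hgdef, i1, i2, i3]
    group
  obtain ⟨s, r', N, hgN, hN⟩ : ∃ s r' N, g = e21 s * N * e21 r' ∧ IsPairProduct 21 N := by
    have hb2 : 2 ∣ b - 1 := by omega
    rcases hε with rfl | rfl
    · obtain ⟨s, r', N, h1, h2, -⟩ := exists_eq_e21_mul_mul_e21 g hb hb2 ha0 hab1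
        (by simpa using hg0) (by rw [hg1]) (by rw [hg1])
      exact ⟨s, r', N, h1, h2.mono (by norm_num)⟩
    · obtain ⟨s, r', N, h1, -, h2⟩ := exists_eq_e21_mul_mul_e21 (negOne * g) hb hb2 ha0 hab1
        (by rw [negOne_mul_val]; simp [hg0]) (by rw [negOne_mul_val]; simp [hg1])
        (by rw [negOne_mul_val]; simp [hg1])
      refine ⟨s, r', negOne * N, ?_, h2⟩
      have hc : e21 s * negOne = negOne * e21 s := by
        apply Subtype.ext
        rw [negOne_mul_val]
        change (e21 s).1 * -1 = _
        simp
      rw [← mul_assoc, hc, mul_assoc, mul_assoc, ← mul_assoc _ N, ← h1, ← mul_assoc,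
        negOne_mul_negOne, one_mul]
  have he : e21 r' * e21 (-t') = e21 (r' - t') := by
    apply Subtype.ext
    change !![1, 0; _, 1] * !![1, 0; _, 1] = !![1, 0; _, 1]
    simp [sub_eq_add_neg]
  have : h = e21 s * N * (e21 (r' - t') * e12 (-t)) * e21 (-j) := by
    rw [hh, hgN, ← he]
    simp only [mul_assoc]
  rw [this]
  exact ((((isPairProduct_e21 s).mul hN).mul (isPairProduct_e21_mul_e12 _ _)).mul
    (isPairProduct_e21 _)).mono (by norm_num)

end SLTwoBound

theorem map_mem_wordImage {t : ℕ} {w : FreeGroup (Fin t)} {G H : Type*} [Group G] [Group H]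
    (f : G →* H) {x : G} (hx : x ∈ wordImage w G) : f x ∈ wordImage w H := by
  obtain ⟨g, rfl⟩ := hx
  refine ⟨f ∘ g, ?_⟩
  have : FreeGroup.lift (f ∘ g) = f.comp (FreeGroup.lift g) := by
    ext i
    simp
  simp [this]

theorem conj_mem_wordImage {t : ℕ} {w : FreeGroup (Fin t)} {G : Type*} [Group G] {x : G}
    (hx : x ∈ wordImage w G) (v : G) : v * x * v⁻¹ ∈ wordImage w G :=
  map_mem_wordImage (MulAut.conj v).toMonoidHom hx

section Trace

open Polynomial

/-- A `2 × 2` matrix of integer polynomials whose lower right entry has leading coefficient `±1`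
and dominates the other entries. -/
def IsDominated (M : Matrix (Fin 2) (Fin 2) ℤ[X]) : Prop :=
  IsUnit (M 1 1).leadingCoeff ∧ (M 0 0).degree ≤ (M 1 1).degree ∧
    (M 0 1).degree < (M 1 1).degree ∧ (M 1 0).degree < (M 1 1).degree

theorem isDominated_one : IsDominated 1 := by
  simp [IsDominated]

theorem IsDominated.neg {M : Matrix (Fin 2) (Fin 2) ℤ[X]} (h : IsDominated M) :
    IsDominated (-M) := by
  simpa [IsDominated] using h

theorem IsDominated.step {M : Matrix (Fin 2) (Fin 2) ℤ[X]} (h : IsDominated M) {c : ℤ[X]}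
    (hc : IsUnit c.leadingCoeff) (hc' : 0 < c.degree) :
    IsDominated (!![0, -1; 1, c] * M) ∧
      ((!![0, -1; 1, c] * M) 0 0).degree < ((!![0, -1; 1, c] * M) 1 1).degree ∧
      0 < ((!![0, -1; 1, c] * M) 1 1).degree := by
  obtain ⟨h1, h2, h3, h4⟩ := h
  have hM : M 1 1 ≠ 0 := by
    rintro h
    simp [h] at h1
  have hc0 : c ≠ 0 := by
    rintro rfl
    simp at hc
  have hbot : (M 1 1).degree ≠ ⊥ := by simpa using hM
  have hlt : (M 1 1).degree < (c * M 1 1).degree := by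
    rw [degree_mul]
    rw [degree_eq_natDegree hM, degree_eq_natDegree hc0] at *
    norm_cast at *
    omega
  have e11 : (!![0, -1; 1, c] * M) 1 1 = M 0 1 + c * M 1 1 := by
    simp [Matrix.mul_apply, Fin.sum_univ_two]
  have e10 : (!![0, -1; 1, c] * M) 1 0 = M 0 0 + c * M 1 0 := by
    simp [Matrix.mul_apply, Fin.sum_univ_two]
  have e01 : (!![0, -1; 1, c] * M) 0 1 = -M 1 1 := by
    simp [Matrix.mul_apply, Fin.sum_univ_two]
  have e00 : (!![0, -1; 1, c] * M) 0 0 = -M 1 0 := by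
    simp [Matrix.mul_apply, Fin.sum_univ_two]
  have hd : (M 0 1 + c * M 1 1).degree = (c * M 1 1).degree :=
    degree_add_eq_right_of_degree_lt (h3.trans hlt)
  have h00 : (M 1 0).degree < (M 0 1 + c * M 1 1).degree := hd ▸ h4.trans hlt
  have hmul : (c * M 1 0).degree < (c * M 1 1).degree := by
    rw [degree_mul, degree_mul]
    rw [degree_eq_natDegree hc0]
    exact WithBot.add_lt_add_left (by simp) h4
  refine ⟨⟨?_, ?_, ?_, ?_⟩, ?_, ?_⟩
  · rw [e11, leadingCoeff_add_of_degree_lt (h3.trans hlt), leadingCoeff_mul]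
    exact hc.mul h1
  · rw [e00, e11, degree_neg]
    exact h00.le
  · rw [e01, e11, degree_neg, hd]
    exact hlt
  · rw [e10, e11, hd]
    exact (degree_add_le _ _).trans_lt (max_lt (h2.trans_lt hlt) hmul)
  · rwa [e00, e11, degree_neg]
  · rw [e11, hd]
    refine lt_of_le_of_lt ?_ hlt
    rw [degree_eq_natDegree hM]
    exact_mod_cast Nat.zero_le _

/-- The unipotent matrix with upper right entry `q`. -/
noncomputable def polyTrans (q : ℤ[X]) : SL(2, ℤ[X]) := ⟨!![1, q; 0, 1], by simp⟩

/-- The Weyl element. -/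
noncomputable def polyWeyl : SL(2, ℤ[X]) := ⟨!![0, -1; 1, 0], by simp⟩

theorem polyTrans_add (p q : ℤ[X]) : polyTrans (p + q) = polyTrans p * polyTrans q := by
  apply Subtype.ext
  change !![1, p + q; 0, 1] = !![1, p; 0, 1] * !![1, q; 0, 1]
  simp [add_comm]

theorem polyTrans_neg (q : ℤ[X]) : polyTrans (-q) = (polyTrans q)⁻¹ := by
  rw [eq_inv_iff_mul_eq_one, ← polyTrans_add, neg_add_cancel]
  apply Subtype.ext
  change !![1, 0; 0, 1] = (1 : Matrix (Fin 2) (Fin 2) ℤ[X])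
  rw [Matrix.one_fin_two]

/-- The sign of a letter. -/
noncomputable def letterSign (b : Bool) : ℤ[X] := if b then 1 else -1

/-- The polynomial attached to the left side of a letter. -/
noncomputable def leftPoly {t : ℕ} (x : Fin t × Bool) : ℤ[X] :=
  letterSign x.2 * X ^ (2 * x.1.val + if x.2 then 1 else 2)

/-- The polynomial attached to the right side of a letter. -/
noncomputable def rightPoly {t : ℕ} (x : Fin t × Bool) : ℤ[X] :=
  letterSign x.2 * X ^ (2 * x.1.val + if x.2 then 2 else 1)

theorem degree_letterSign_add {m n : ℕ} (h : n < m) (a b : Bool) :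
    IsUnit (letterSign a * X ^ m + letterSign b * X ^ n).leadingCoeff ∧
      0 < (letterSign a * X ^ m + letterSign b * X ^ n).degree := by
  have hlt : (letterSign b * X ^ n).degree < (letterSign a * X ^ m : ℤ[X]).degree := by
    cases a <;> cases b <;> simpa [letterSign] using h
  rw [leadingCoeff_add_of_degree_lt' hlt, degree_add_eq_left_of_degree_lt hlt]
  have : 0 < m := by omega
  cases a <;> simpa [letterSign] using this

theorem rightPoly_add_leftPoly {t : ℕ} {x y : Fin t × Bool} (h : x.1 = y.1 → x.2 = y.2) :
    IsUnit (rightPoly x + leftPoly y).leadingCoeff ∧ 0 < (rightPoly x + leftPoly y).degree := by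
  rcases lt_trichotomy (2 * x.1.val + if x.2 then 2 else 1)
    (2 * y.1.val + if y.2 then 1 else 2) with hlt | heq | hlt
  · rw [add_comm]
    exact degree_letterSign_add hlt _ _
  · exfalso
    obtain ⟨⟨i, hi⟩, a⟩ := x
    obtain ⟨⟨j, hj⟩, b⟩ := y
    simp only [Fin.mk.injEq] at h heq
    cases a <;> cases b <;> simp at h heq <;> omega
  · exact degree_letterSign_add hlt _ _

/-- The matrices substituted for the generators. -/
noncomputable def polyGen {t : ℕ} (i : Fin t) : SL(2, ℤ[X]) :=
  polyTrans (leftPoly (i, true)) * polyWeyl * polyTrans (rightPoly (i, true))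

theorem letter_eq {t : ℕ} (x : Fin t × Bool) :
    ∃ ε : ℤ[X], (ε = 1 ∨ ε = -1) ∧ (cond x.2 (polyGen x.1) (polyGen x.1)⁻¹).1 =
      ε • ((polyTrans (leftPoly x)).1 * polyWeyl.1 * (polyTrans (rightPoly x)).1) := by
  obtain ⟨i, b⟩ := x
  cases b
  · refine ⟨-1, Or.inr rfl, ?_⟩
    have h1 : leftPoly (i, false) = -rightPoly (i, true) := by
      simp [leftPoly, rightPoly, letterSign]
    have h2 : rightPoly (i, false) = -leftPoly (i, true) := by
      simp [leftPoly, rightPoly, letterSign]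
    have h3 : (polyWeyl⁻¹).1 = -polyWeyl.1 := by
      rw [Matrix.SpecialLinearGroup.coe_inv]
      simp [polyWeyl, Matrix.adjugate_fin_two]
    simp only [cond_false, polyGen, mul_inv_rev, ← polyTrans_neg, ← h1, ← h2]
    change (polyTrans _).1 * ((polyWeyl⁻¹).1 * (polyTrans _).1) = _
    rw [h3]
    simp [mul_assoc]
  · exact ⟨1, Or.inl rfl, by simp [polyGen]⟩

theorem IsDominated.exists_letter_mul {t : ℕ} {x y : Fin t × Bool} (hxy : x.1 = y.1 → x.2 = y.2)
    {M N : Matrix (Fin 2) (Fin 2) ℤ[X]} (hM : IsDominated M)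
    (hN : N = (polyTrans (leftPoly y)).1 * M) :
    ∃ M' : Matrix (Fin 2) (Fin 2) ℤ[X], IsDominated M' ∧ (M' 0 0).degree < (M' 1 1).degree ∧
      0 < (M' 1 1).degree ∧ (cond x.2 (polyGen x.1) (polyGen x.1)⁻¹).1 * N =
        (polyTrans (leftPoly x)).1 * M' := by
  obtain ⟨ε, hε, hx⟩ := letter_eq x
  obtain ⟨hc, hc'⟩ := rightPoly_add_leftPoly hxy
  obtain ⟨s1, s2, s3⟩ := hM.step hc hc'
  have e : (cond x.2 (polyGen x.1) (polyGen x.1)⁻¹).1 * N = (polyTrans (leftPoly x)).1 *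
      (ε • (!![0, -1; 1, rightPoly x + leftPoly y] * M)) := by
    have : (polyWeyl.1 * (polyTrans (rightPoly x)).1) * (polyTrans (leftPoly y)).1 =
        !![0, -1; 1, rightPoly x + leftPoly y] := by
      simp [polyWeyl, polyTrans, add_comm]
    rw [hx, hN, ← this]
    simp only [Matrix.smul_mul, Matrix.mul_smul, Matrix.mul_assoc]
  rcases hε with rfl | rfl
  · exact ⟨_, s1, s2, s3, by rw [e, one_smul]⟩
  · refine ⟨_, s1.neg, ?_, ?_, by rw [e, neg_smul, one_smul]⟩ <;>
      simpa only [Matrix.neg_apply, degree_neg]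

theorem exists_isDominated_prod {t : ℕ} (L : List (Fin t × Bool)) (x z : Fin t × Bool)
    (h : List.IsChain (fun a b => a.1 = b.1 → a.2 = b.2) (x :: (L ++ [z]))) :
    ∃ M : Matrix (Fin 2) (Fin 2) ℤ[X], IsDominated M ∧ (M 0 0).degree < (M 1 1).degree ∧
      0 < (M 1 1).degree ∧
      (((x :: L).map fun x => cond x.2 (polyGen x.1) (polyGen x.1)⁻¹).prod).1 *
        (polyTrans (leftPoly z)).1 = (polyTrans (leftPoly x)).1 * M := by
  induction L generalizing x with
  | nil =>
    have hxz : x.1 = z.1 → x.2 = z.2 := by simpa using h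
    obtain ⟨M', h1, h2, h3, h4⟩ := isDominated_one.exists_letter_mul hxz (mul_one _).symm
    exact ⟨M', h1, h2, h3, by simpa using h4⟩
  | cons y L ih =>
    rw [List.cons_append, List.isChain_cons_cons] at h
    obtain ⟨M, h1, -, -, h4⟩ := ih y h.2
    obtain ⟨M', h1', h2', h3', h4'⟩ := h1.exists_letter_mul h.1 h4
    refine ⟨M', h1', h2', h3', ?_⟩
    rw [List.map_cons, List.prod_cons, ← h4']
    simp [Matrix.mul_assoc]

/-- Every nontrivial word takes a value in `SL₂(ℤ[X])` with non-constant trace whose leading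
coefficient is `±1`. -/
theorem exists_trace_lift {t : ℕ} (w : FreeGroup (Fin t)) (hw : w ≠ 1) :
    ∃ g : Fin t → SL(2, ℤ[X]), IsUnit (FreeGroup.lift g w).1.trace.leadingCoeff ∧
      0 < (FreeGroup.lift g w).1.trace.degree := by
  refine ⟨polyGen, ?_⟩
  set L := FreeGroup.reduceCyclically w.toWord with hL
  set c := FreeGroup.mk (FreeGroup.reduceCyclically.conjugator w.toWord) with hc
  have hwc : w = c * FreeGroup.mk L * c⁻¹ := by
    rw [hc, hL, FreeGroup.inv_mk, FreeGroup.mul_mk, FreeGroup.mul_mk,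
      FreeGroup.reduceCyclically.conj_conjugator_reduceCyclically, FreeGroup.mk_toWord]
  have hcyc : FreeGroup.IsCyclicallyReduced L :=
    FreeGroup.reduceCyclically.isCyclicallyReduced FreeGroup.isReduced_toWord
  have htr : (FreeGroup.lift polyGen w).1.trace =
      (FreeGroup.lift polyGen (FreeGroup.mk L)).1.trace := by
    rw [hwc, map_mul, map_mul, map_inv]
    generalize FreeGroup.lift polyGen c = v
    change (v.1 * _ * (v⁻¹).1).trace = _
    rw [Matrix.trace_mul_comm, ← Matrix.mul_assoc]
    change ((v⁻¹ * v).1 * _).trace = _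
    simp
  rw [htr, FreeGroup.lift_mk]
  match L, hcyc with
  | [], _ => exact absurd (by rw [hwc, ← FreeGroup.one_eq_mk]; simp) hw
  | x :: L, h =>
    obtain ⟨M, h1, h2, h3, h4⟩ := exists_isDominated_prod L x x (by
      rw [← List.cons_append, List.isChain_append]
      refine ⟨h.1, by simp, ?_⟩
      intro a ha b hb
      exact h.2 a ha b (by simpa using hb))
    have hM : ((((x :: L).map fun x => cond x.2 (polyGen x.1) (polyGen x.1)⁻¹).prod).1).trace =
        M.trace := by
      have hT : (polyTrans (leftPoly x)).1 * ((polyTrans (leftPoly x))⁻¹).1 = 1 := by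
        change (polyTrans (leftPoly x) * (polyTrans (leftPoly x))⁻¹).1 = 1
        simp
      have hT' : ((polyTrans (leftPoly x))⁻¹).1 * (polyTrans (leftPoly x)).1 = 1 := by
        change ((polyTrans (leftPoly x))⁻¹ * polyTrans (leftPoly x)).1 = 1
        simp
      generalize (((x :: L).map fun x => cond x.2 (polyGen x.1) (polyGen x.1)⁻¹).prod).1 = N at h4 ⊢
      rw [← Matrix.mul_one N, ← hT, ← Matrix.mul_assoc, h4, Matrix.trace_mul_comm,
        ← Matrix.mul_assoc, hT', Matrix.one_mul]
    rw [hM, Matrix.trace_fin_two, leadingCoeff_add_of_degree_lt h2,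
      degree_add_eq_right_of_degree_lt h2]
    exact ⟨h1.1, h3⟩

end Trace

section OrderSix

variable {α β δ ι : Type} [Fintype α] [DecidableEq α] [Fintype β] [DecidableEq β]
  [Fintype δ] [DecidableEq δ] [Fintype ι] [DecidableEq ι]

theorem inclMat_transpose_mul_apply (e : δ ↪ ι) (x : Matrix ι ι ℤ) (a : δ) (j : ι) :
    ((inclMat e).transpose * x) a j = x (e a) j := by
  simp [Matrix.mul_apply, inclMat]

theorem mul_inclMat_apply (e : δ ↪ ι) (x : Matrix ι ι ℤ) (i : ι) (a : δ) :
    (x * inclMat e) i a = x i (e a) := by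
  simp [Matrix.mul_apply, inclMat]

theorem inclMat_mul_transpose (e : δ ↪ ι) [DecidablePred (· ∈ Set.range e)] :
    inclMat e * (inclMat e).transpose =
      Matrix.diagonal fun i => if i ∈ Set.range e then (1 : ℤ) else 0 := by
  ext i j
  rw [Matrix.mul_apply, Matrix.diagonal_apply]
  simp only [inclMat, Matrix.transpose_apply]
  by_cases hi : i ∈ Set.range e
  · obtain ⟨a, rfl⟩ := hi
    rw [if_pos (Set.mem_range_self a), Finset.sum_eq_single a]
    · by_cases h : j = e a <;> simp [h, eq_comm]
    · intro b _ hb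
      simp [hb.symm]
    · simp
  · rw [if_neg hi, ite_self]
    refine Finset.sum_eq_zero fun a _ => ?_
    rw [if_neg (fun h => hi ⟨a, h.symm⟩), zero_mul]

theorem mul_mul_eq_of_isBlockUnipotent (e : δ ↪ ι) {D : Matrix.SpecialLinearGroup δ ℤ}
    (hD : D.1 * D.1 - D.1 + 1 = 0) {x : Matrix.SpecialLinearGroup ι ℤ}
    (hx : IsBlockUnipotent (Set.range e) x ∨ IsBlockUnipotent (Set.range e)ᶜ x) :
    extSL e D * x * extSL e D = x * extSL e D * extSL e D * x := by
  classical
  have hPP := inclMat_mul_transpose e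
  have hP := inclMat_transpose_mul_self e
  apply Subtype.ext
  change extMat e D.1 * x.1 * extMat e D.1 = x.1 * extMat e D.1 * extMat e D.1 * x.1
  obtain ⟨X, hX⟩ : ∃ X, X = x.1 - 1 := ⟨_, rfl⟩
  have hx1 : x.1 = 1 + X := by rw [hX]; abel
  have hDD : D.1 * D.1 = D.1 - 1 := by
    rw [← sub_eq_zero, ← hD]
    abel
  have hEE : extMat e D.1 * extMat e D.1 =
      extMat e D.1 - inclMat e * (inclMat e).transpose := by
    rw [← extMat_mul, hDD]
    simp only [extMat, Matrix.mul_sub, Matrix.sub_mul, Matrix.mul_one]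
    abel
  have hor : (X * extMat e D.1 = X ∧ inclMat e * (inclMat e).transpose * X = X ∧
      X * (inclMat e * (inclMat e).transpose) = 0 ∧ X * X = 0) ∨
      (extMat e D.1 * X = X ∧ X * (inclMat e * (inclMat e).transpose) = X ∧
      inclMat e * (inclMat e).transpose * X = 0 ∧ X * X = 0) := by
    refine hx.imp (fun h => ?_) (fun h => ?_)
    · have h1 : X * inclMat e = 0 := by
        ext i a
        rw [mul_inclMat_apply, Matrix.zero_apply]
        by_contra hne
        exact (h i (e a) (hX ▸ hne)).2 ⟨a, rfl⟩
      have h2 : inclMat e * (inclMat e).transpose * X = X := by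
        rw [hPP]
        ext i j
        rw [Matrix.diagonal_mul]
        split_ifs with hi
        · rw [one_mul]
        · by_contra hne
          exact hi (h i j (hX ▸ fun h0 => hne (by rw [h0, zero_mul]))).1
      refine ⟨?_, h2, by rw [← Matrix.mul_assoc, h1, Matrix.zero_mul], ?_⟩
      · rw [extMat, Matrix.mul_add, ← Matrix.mul_assoc, ← Matrix.mul_assoc, h1]
        simp
      · rw [← h2, ← Matrix.mul_assoc, ← Matrix.mul_assoc, Matrix.mul_assoc _ _ X, Matrix.mul_assoc,
          Matrix.mul_assoc, Matrix.mul_assoc, ← Matrix.mul_assoc X, h1]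
        simp
    · have h1 : (inclMat e).transpose * X = 0 := by
        ext a j
        rw [inclMat_transpose_mul_apply, Matrix.zero_apply]
        by_contra hne
        exact (h (e a) j (hX ▸ hne)).1 ⟨a, rfl⟩
      have h2 : X * (inclMat e * (inclMat e).transpose) = X := by
        rw [hPP]
        ext i j
        rw [Matrix.mul_diagonal]
        split_ifs with hi
        · rw [mul_one]
        · by_contra hne
          exact (h i j (hX ▸ fun h0 => hne (by rw [h0, mul_zero]))).2 hi
      refine ⟨?_, h2, by rw [Matrix.mul_assoc, h1, Matrix.mul_zero], ?_⟩
      · rw [extMat, Matrix.add_mul, Matrix.mul_assoc, h1]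
        simp
      · nth_rw 1 [← h2]
        rw [Matrix.mul_assoc, Matrix.mul_assoc, h1]
        simp
  rw [hx1]
  generalize inclMat e * (inclMat e).transpose = Q at *
  generalize extMat e D.1 = E at *
  rcases hor with ⟨h1, h2, h3, h4⟩ | ⟨h1, h2, h3, h4⟩
  · have e1 : E * (1 + X) * E = E * E + E * X := by
      rw [mul_add, mul_one, add_mul, mul_assoc E X, h1]
    have e2 : (1 + X) * E * E * (1 + X) = E * E + E * E * X + X := by
      rw [add_mul, one_mul, h1, add_mul, h1, mul_add, mul_one, add_mul, h4]
      abel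
    rw [e1, e2, hEE, sub_mul, h2]
    abel
  · have e1 : E * (1 + X) * E = E * E + X * E := by
      rw [mul_add, mul_one, add_mul, h1]
    have e2 : (1 + X) * E * E * (1 + X) = E * E + X * (E * E) + X := by
      rw [mul_assoc, mul_assoc, ← mul_assoc E, mul_add (E * E), mul_one, mul_assoc E E X, h1, h1,
        add_mul, one_mul, mul_add, h4]
      abel
    rw [e1, e2, hEE, mul_sub, h2]
    abel

theorem mul_mem_wordImage_mul {t : ℕ} {w : FreeGroup (Fin t)} (e : δ ↪ ι)
    {D : Matrix.SpecialLinearGroup δ ℤ} (hD : D.1 * D.1 - D.1 + 1 = 0)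
    (hDw : D ∈ wordImage w (Matrix.SpecialLinearGroup δ ℤ))
    (hDw' : D⁻¹ ∈ wordImage w (Matrix.SpecialLinearGroup δ ℤ))
    {x y : Matrix.SpecialLinearGroup ι ℤ}
    (hx : IsBlockUnipotent (Set.range e) x ∨ IsBlockUnipotent (Set.range e)ᶜ x)
    (hy : IsBlockUnipotent (Set.range e) y ∨ IsBlockUnipotent (Set.range e)ᶜ y) :
    x * y ∈ wordImage w (Matrix.SpecialLinearGroup ι ℤ) ^ 2 := by
  have hx' := mul_mul_eq_of_isBlockUnipotent e hD hx
  have hy' := mul_mul_eq_of_isBlockUnipotent e hD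
    (hy.imp IsBlockUnipotent.inv IsBlockUnipotent.inv)
  have h1 := map_mem_wordImage (extSL e) hDw
  have h2 := map_mem_wordImage (extSL e) hDw'
  rw [map_inv] at h2
  generalize extSL e D = E at *
  have e1 : x * E = (E * x * E⁻¹) * E * (E * x * E⁻¹)⁻¹ := by
    have : E * x * E⁻¹ * E * (E * x * E⁻¹)⁻¹ = (E * x * E) * x⁻¹ * E⁻¹ := by group
    rw [this, hx']
    group
  have e2 : E⁻¹ * y = (E * y⁻¹ * E⁻¹) * E⁻¹ * (E * y⁻¹ * E⁻¹)⁻¹ := by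
    have : E * y⁻¹ * E⁻¹ * E⁻¹ * (E * y⁻¹ * E⁻¹)⁻¹ = ((E * y⁻¹ * E) * y * E⁻¹)⁻¹ := by group
    rw [this, hy']
    group
  have : x * y = (x * E) * (E⁻¹ * y) := by group
  rw [this, pow_two, e1, e2]
  exact Set.mul_mem_mul (conj_mem_wordImage h1 _) (conj_mem_wordImage h2 _)

/-- In every dimension divisible by `k` there is a value `D` of the word `w`, whose inverse is also
a value of `w`, with `D² - D + 1 = 0`. -/
def HasOrderSixValues {t : ℕ} (w : FreeGroup (Fin t)) (k : ℕ) : Prop :=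
  ∀ q : ℕ, ∃ (δ : Type) (_ : Fintype δ) (_ : DecidableEq δ) (D : Matrix.SpecialLinearGroup δ ℤ),
    Fintype.card δ = k * q ∧ D.1 * D.1 - D.1 + 1 = 0 ∧
      D ∈ wordImage w (Matrix.SpecialLinearGroup δ ℤ) ∧
      D⁻¹ ∈ wordImage w (Matrix.SpecialLinearGroup δ ℤ)

theorem HasOrderSixValues.mul_mem {t : ℕ} {w : FreeGroup (Fin t)} {k : ℕ}
    (hw : HasOrderSixValues w k) (s : Finset ι) (hs : k ∣ s.card)
    {x y : Matrix.SpecialLinearGroup ι ℤ}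
    (hx : IsBlockUnipotent (s : Set ι) x ∨ IsBlockUnipotent (s : Set ι)ᶜ x)
    (hy : IsBlockUnipotent (s : Set ι) y ∨ IsBlockUnipotent (s : Set ι)ᶜ y) :
    x * y ∈ wordImage w (Matrix.SpecialLinearGroup ι ℤ) ^ 2 := by
  obtain ⟨q, hq⟩ := hs
  obtain ⟨δ, _, _, D, hδ, h1, h2, h3⟩ := hw q
  have e : δ ≃ s := Fintype.equivOfCardEq (by rw [hδ, Fintype.card_coe, hq])
  have he : Set.range (e.toEmbedding.trans (Function.Embedding.subtype _)) = (s : Set ι) := by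
    ext i
    constructor
    · rintro ⟨a, rfl⟩
      exact (e a).2
    · intro hi
      exact ⟨e.symm ⟨i, hi⟩, by simp⟩
  rw [← he] at hx hy
  exact mul_mem_wordImage_mul _ h1 h2 h3 hx hy

theorem IsBlockUnipotent.extSL {x : Matrix.SpecialLinearGroup α ℤ} {s : Set α}
    (hx : IsBlockUnipotent s x) (e : α ↪ ι) {r : Set ι} (hr : ∀ a, e a ∈ r ↔ a ∈ s) :
    IsBlockUnipotent r (extSL e x) := by
  intro i j hij
  have : (_root_.extSL e x).1 - 1 = inclMat e * (x.1 - 1) * (inclMat e).transpose := by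
    rw [extSL_val, extMat, add_sub_cancel_left]
  rw [this] at hij
  obtain ⟨a, b, rfl, rfl, h⟩ := inclMat_mul_mul_transpose_apply_ne_zero e hij
  rw [hr, hr]
  exact hx a b h

theorem HasOrderSixValues.extSL_inl_mem {t : ℕ} {w : FreeGroup (Fin t)} {k : ℕ}
    (hw : HasOrderSixValues w k) (hk : 0 < k) (hβ : Fintype.card β = k)
    {x : Matrix.SpecialLinearGroup α ℤ} (hx : x ∈ unipPairs α) :
    extSL (Function.Embedding.inl : α ↪ α ⊕ β) x ∈
      wordImage w (Matrix.SpecialLinearGroup (α ⊕ β) ℤ) ^ 2 := by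
  classical
  obtain ⟨s, u, l, hu, hl, rfl⟩ := hx
  have hmod : s.toFinset.card % k < k := Nat.mod_lt _ hk
  obtain ⟨T, -, hT⟩ := Finset.exists_subset_card_eq (s := (Finset.univ : Finset β))
    (n := (k - s.toFinset.card % k) % k) (by
      rw [Finset.card_univ, hβ]
      exact (Nat.mod_lt _ hk).le)
  rw [map_mul]
  refine hw.mul_mem (s.toFinset.disjSum T) ?_ (Or.inl (hu.extSL _ ?_)) (Or.inr (hl.extSL _ ?_))
  · rw [Finset.card_disjSum, hT, Nat.dvd_iff_mod_eq_zero, Nat.add_mod_mod, ← Nat.mod_add_mod,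
      Nat.add_sub_cancel' hmod.le, Nat.mod_self]
  · simp
  · simp

theorem HasOrderSixValues.extSL_inl_mem_pow {t : ℕ} {w : FreeGroup (Fin t)} {k : ℕ}
    (hw : HasOrderSixValues w k) (hk : 0 < k) (hβ : Fintype.card β = k) (n : ℕ)
    {x : Matrix.SpecialLinearGroup α ℤ} (hx : x ∈ unipPairs α ^ n) :
    extSL (Function.Embedding.inl : α ↪ α ⊕ β) x ∈
      wordImage w (Matrix.SpecialLinearGroup (α ⊕ β) ℤ) ^ (2 * n) := by
  induction n generalizing x with
  | zero =>
    rw [pow_zero, Set.mem_one] at hx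
    simp [hx]
  | succ n ih =>
    rw [pow_succ] at hx
    obtain ⟨y, hy, z, hz, rfl⟩ := hx
    rw [mul_add, pow_add, map_mul]
    exact Set.mul_mem_mul (ih hy) (hw.extSL_inl_mem hk hβ hz)

theorem HasOrderSixValues.mem_wordImage_pow_sum {t : ℕ} {w : FreeGroup (Fin t)} {k : ℕ}
    (hw : HasOrderSixValues w k) (hk : 0 < k) (hβ : Fintype.card β = k)
    (hα : 50 ≤ Fintype.card α) (hαk : k < Fintype.card α)
    (g : Matrix.SpecialLinearGroup (α ⊕ β) ℤ) :
    g ∈ wordImage w (Matrix.SpecialLinearGroup (α ⊕ β) ℤ) ^ 86 := by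
  classical
  obtain ⟨Q, Z, R, Y, x, rfl⟩ := exists_eq_upperSL_mul_extSL_mul (hβ ▸ hαk) g
  have hx := hw.extSL_inl_mem_pow hk hβ (24 + 16)
    (mem_unipPairs_pow_of_base (by norm_num) isPairProduct_of_SL_two hα x)
  have hset : ((Finset.univ.map (Function.Embedding.inr : β ↪ α ⊕ β) : Finset (α ⊕ β)) :
      Set (α ⊕ β)) = (Set.range Sum.inl)ᶜ := by
    ext (i | i) <;> simp
  have hpair : ∀ {x y : Matrix.SpecialLinearGroup (α ⊕ β) ℤ},
      (IsBlockUnipotent (Set.range Sum.inl)ᶜ x ∨ IsBlockUnipotent (Set.range Sum.inl) x) →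
      (IsBlockUnipotent (Set.range Sum.inl)ᶜ y ∨ IsBlockUnipotent (Set.range Sum.inl) y) →
      x * y ∈ wordImage w (Matrix.SpecialLinearGroup (α ⊕ β) ℤ) ^ 2 := by
    intro x y hx hy
    refine hw.mul_mem (Finset.univ.map (Function.Embedding.inr : β ↪ α ⊕ β)) (by simp [hβ]) ?_ ?_
    · rwa [hset, compl_compl]
    · rwa [hset, compl_compl]
  have h1 := hpair (Or.inr (isBlockUnipotent_upperSL Q)) (Or.inl (isBlockUnipotent_one _))
  have h2 := hpair (Or.inl (isBlockUnipotent_lowerSL R)) (Or.inr (isBlockUnipotent_upperSL Z))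
  have h3 := hpair (Or.inl (isBlockUnipotent_lowerSL Y)) (Or.inl (isBlockUnipotent_one _))
  rw [mul_one] at h1 h3
  have := Set.mul_mem_mul (Set.mul_mem_mul h1 hx) (Set.mul_mem_mul h2 h3)
  simpa only [← pow_add] using this

theorem HasOrderSixValues.mem_wordImage_pow {t : ℕ} {w : FreeGroup (Fin t)} {k : ℕ}
    (hw : HasOrderSixValues w k) (hk : 0 < k) {d : ℕ} (hd : 2 * k + 50 < d)
    (g : Matrix.SpecialLinearGroup (Fin d) ℤ) :
    g ∈ wordImage w (Matrix.SpecialLinearGroup (Fin d) ℤ) ^ 86 := by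
  have e : Fin (d - k) ⊕ Fin k ≃ Fin d := Fintype.equivOfCardEq (by simp; omega)
  have h := hw.mem_wordImage_pow_sum hk (Fintype.card_fin k) (α := Fin (d - k))
    (by simp; omega) (by simp; omega) (extSL e.symm.toEmbedding g)
  have hg : extSL e.toEmbedding (extSL e.symm.toEmbedding g) = g := by
    rw [← extSL_trans]
    convert extSL_refl g
    ext i
    simp
  have himg := Set.mem_image_of_mem (extSL e.toEmbedding) h
  rw [hg, Set.image_pow] at himg
  refine Set.pow_subset_pow_left ?_ himg
  rintro _ ⟨y, hy, rfl⟩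
  exact map_mem_wordImage _ hy

end OrderSix

section Eisenstein

open NumberField Polynomial

theorem isTorsionFree_of_isIntegral {O M : Type} [CommRing O] [IsDomain O] [Algebra.IsIntegral ℤ O]
    [AddCommGroup M] [Module.IsTorsionFree ℤ M] [Module O M] : Module.IsTorsionFree O M := by
  refine ⟨fun r hr x y hxy => ?_⟩
  obtain ⟨n, hn, s, hs⟩ := (Algebra.IsIntegral.isIntegral (R := ℤ) r).isAlgebraic.exists_nonzero_dvd
    (mem_nonZeroDivisors_of_ne_zero hr.ne_zero)
  have : (n : ℤ) • (x - y) = 0 := by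
    have h0 : r • (x - y) = 0 := by
      rw [smul_sub, sub_eq_zero]
      exact hxy
    rw [← algebraMap_smul O n, hs, mul_comm, mul_smul, h0, smul_zero]
  exact sub_eq_zero.1 ((smul_eq_zero.1 this).resolve_left hn)

theorem nonempty_linearEquiv_of_isPrincipalIdealRing {O M N : Type} [CommRing O] [IsDomain O]
    [IsPrincipalIdealRing O] [Module.Finite ℤ O] [Module.Free ℤ O]
    [AddCommGroup M] [Module.Finite ℤ M] [Module.IsTorsionFree ℤ M] [Module O M]
    [AddCommGroup N] [Module.Finite ℤ N] [Module.IsTorsionFree ℤ N] [Module O N]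
    (h : Module.finrank ℤ M = Module.finrank ℤ N) : Nonempty (M ≃ₗ[O] N) := by
  have := isTorsionFree_of_isIntegral (O := O) (M := M)
  have := isTorsionFree_of_isIntegral (O := O) (M := N)
  have := Module.Finite.of_restrictScalars_finite ℤ O M
  have := Module.Finite.of_restrictScalars_finite ℤ O N
  have : Module.Free O M := Module.free_of_finite_type_torsion_free'
  have : Module.Free O N := Module.free_of_finite_type_torsion_free'
  rw [← Module.finrank_mul_finrank ℤ O M, ← Module.finrank_mul_finrank ℤ O N] at h
  exact ⟨LinearEquiv.ofFinrankEq M N (Nat.eq_of_mul_eq_mul_left Module.finrank_pos h)⟩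

/-- The module obtained by letting a ring act through a ring homomorphism. -/
def ActionModule {O M : Type} [CommRing O] [AddCommGroup M] (_ : O →+* Module.End ℤ M) : Type := M

instance {O M : Type} [CommRing O] [AddCommGroup M] (φ : O →+* Module.End ℤ M) :
    AddCommGroup (ActionModule φ) := inferInstanceAs (AddCommGroup M)

instance {O M : Type} [CommRing O] [AddCommGroup M] (φ : O →+* Module.End ℤ M) :
    Module O (ActionModule φ) := Module.compHom M φ

theorem exists_linearEquiv_of_ringHom {O M : Type} [CommRing O] [IsDomain O]
    [IsPrincipalIdealRing O] [Module.Finite ℤ O] [Module.Free ℤ O]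
    [AddCommGroup M] [Module.Finite ℤ M] [Module.IsTorsionFree ℤ M]
    (φ ψ : O →+* Module.End ℤ M) : ∃ R : M ≃ₗ[ℤ] M, ∀ x v, R (φ x v) = ψ x (R v) := by
  have : Module.Finite ℤ (ActionModule φ) := inferInstanceAs (Module.Finite ℤ M)
  have : Module.Finite ℤ (ActionModule ψ) := inferInstanceAs (Module.Finite ℤ M)
  have : Module.IsTorsionFree ℤ (ActionModule φ) := inferInstanceAs (Module.IsTorsionFree ℤ M)
  have : Module.IsTorsionFree ℤ (ActionModule ψ) := inferInstanceAs (Module.IsTorsionFree ℤ M)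
  obtain ⟨e⟩ := nonempty_linearEquiv_of_isPrincipalIdealRing (O := O)
    (M := ActionModule φ) (N := ActionModule ψ) rfl
  exact ⟨AddEquiv.toIntLinearEquiv (show M ≃+ M from e.toAddEquiv), fun x v => e.map_smul x v⟩

theorem exists_linearEquiv_comm_of_isCyclotomicExtension (K : Type) [Field K] [NumberField K]
    [IsCyclotomicExtension {3} ℚ K] {M : Type} [AddCommGroup M] [Module.Finite ℤ M]
    [Module.IsTorsionFree ℤ M] {a b : Module.End ℤ M} (ha : a ^ 2 + a + 1 = 0)
    (hb : b ^ 2 + b + 1 = 0) : ∃ R : M ≃ₗ[ℤ] M, ∀ v, R (a v) = b (R v) := by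
  have : IsPrincipalIdealRing (𝓞 K) :=
    IsCyclotomicExtension.Rat.three_pid _
  have hζ := IsCyclotomicExtension.zeta_spec 3 ℚ K
  have hmin : minpoly ℤ hζ.integralPowerBasis.gen = X ^ 2 + X + 1 := by
    rw [hζ.integralPowerBasis_gen, ← cyclotomic_three ℤ,
      cyclotomic_eq_minpoly hζ (by norm_num)]
    exact (minpoly.algebraMap_eq RingOfIntegers.coe_injective hζ.toInteger).symm
  have lift : ∀ {c : Module.End ℤ M}, c ^ 2 + c + 1 = 0 →
      ∃ φ : 𝓞 K →ₐ[ℤ] Module.End ℤ M, φ hζ.integralPowerBasis.gen = c := by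
    intro c hc
    exact ⟨hζ.integralPowerBasis.lift c (by rw [hmin]; simpa using hc), PowerBasis.lift_gen _ _ _⟩
  obtain ⟨φ, hφ⟩ := lift ha
  obtain ⟨ψ, hψ⟩ := lift hb
  obtain ⟨R, hR⟩ := exists_linearEquiv_of_ringHom φ.toRingHom ψ.toRingHom
  refine ⟨R, fun v => ?_⟩
  rw [← hφ, ← hψ]
  exact hR _ v

theorem exists_linearEquiv_comm {M : Type} [AddCommGroup M] [Module.Finite ℤ M]
    [Module.IsTorsionFree ℤ M] {a b : Module.End ℤ M} (ha : a ^ 2 + a + 1 = 0)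
    (hb : b ^ 2 + b + 1 = 0) : ∃ R : M ≃ₗ[ℤ] M, ∀ v, R (a v) = b (R v) := by
  let K := CyclotomicField 3 ℚ
  have : IsCyclotomicExtension {3} ℚ K := CyclotomicField.isCyclotomicExtension 3 ℚ
  exact exists_linearEquiv_comm_of_isCyclotomicExtension K ha hb

/-- Integral matrices satisfying `A² - A + 1 = 0` are conjugate to their inverses. -/
theorem exists_conj_eq_inv {κ : Type} [Fintype κ] [DecidableEq κ] (A : (Matrix κ κ ℤ)ˣ)
    (hA : A.1 * A.1 - A.1 + 1 = 0) : ∃ R : (Matrix κ κ ℤ)ˣ, R * A * R⁻¹ = A⁻¹ := by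
  have hinv : A⁻¹.1 = 1 - A.1 := by
    have h : A.1 * (1 - A.1) = 1 := by
      rw [mul_sub, mul_one, ← sub_eq_zero, ← neg_eq_zero, ← hA]
      abel
    exact Units.inv_eq_of_mul_eq_one_right h
  have hA' : A⁻¹.1 * A⁻¹.1 - A⁻¹.1 + 1 = 0 := by
    rw [hinv, ← hA]
    noncomm_ring
  let Φ : Matrix κ κ ℤ ≃ₐ[ℤ] Module.End ℤ (κ → ℤ) := Matrix.toLinAlgEquiv'
  have key : ∀ B : Matrix κ κ ℤ, B * B - B + 1 = 0 → (-Φ B) ^ 2 + -Φ B + 1 = 0 := by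
    intro B hB
    rw [neg_sq, pow_two, ← map_mul, ← sub_eq_add_neg, ← map_sub, ← map_one Φ, ← map_add, hB,
      map_zero]
  obtain ⟨R, hR⟩ := exists_linearEquiv_comm (key _ hA) (key _ hA')
  let U : (Module.End ℤ (κ → ℤ))ˣ := LinearMap.GeneralLinearGroup.ofLinearEquiv R
  refine ⟨Units.map (Φ.symm : Module.End ℤ (κ → ℤ) →* Matrix κ κ ℤ) U, ?_⟩
  rw [mul_inv_eq_iff_eq_mul]
  apply Units.ext
  apply Φ.injective
  change Φ (Φ.symm U.1 * A.1) = Φ (A⁻¹.1 * Φ.symm U.1)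
  rw [map_mul, map_mul, AlgEquiv.apply_symm_apply]
  refine LinearMap.ext fun v => ?_
  have := hR v
  simp only [LinearMap.neg_apply, map_neg, neg_inj] at this
  exact this

end Eisenstein

section Values

open Polynomial

theorem exists_ringHom_matrix {f : ℤ[X]} (hf : IsUnit f.leadingCoeff) (hf' : 0 < f.degree) :
    ∃ (r : ℕ) (_ : 0 < r) (φ : ℤ[X] →+* Matrix (Fin r) (Fin r) ℤ), φ f = 1 := by
  obtain ⟨u, hu⟩ := hf
  have hlt : (1 : ℤ[X]).degree < f.degree := by simpa using hf'
  have hp : (C (u⁻¹.1 : ℤ) * (f - 1)).Monic := by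
    rw [Monic, leadingCoeff_mul, leadingCoeff_C, leadingCoeff_sub_of_degree_lt hlt, ← hu]
    simp
  have hdeg : 0 < (C (u⁻¹.1 : ℤ) * (f - 1)).natDegree := by
    rw [natDegree_C_mul (Units.ne_zero _), natDegree_pos_iff_degree_pos,
      degree_sub_eq_left_of_degree_lt hlt]
    exact hf'
  generalize hpdef : C (u⁻¹.1 : ℤ) * (f - 1) = p at *
  have hfp : f = 1 + C u.1 * p := by
    rw [← hpdef, ← mul_assoc, ← C_mul]
    simp
  refine ⟨p.natDegree, hdeg,
    (Algebra.leftMulMatrix (AdjoinRoot.powerBasis' hp).basis).toRingHom.comp (AdjoinRoot.mk p), ?_⟩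
  have : AdjoinRoot.mk p f = 1 := by
    rw [hfp]
    simp
  change Algebra.leftMulMatrix _ (AdjoinRoot.mk p f) = 1
  rw [this]
  exact map_one _

theorem sq_sub_self_add_one_of_ringHom {r : ℕ} {M : SL(2, ℤ[X])}
    {φ : ℤ[X] →+* Matrix (Fin r) (Fin r) ℤ} (hφ : φ M.1.trace = 1) :
    φ.mapMatrix M.1 * φ.mapMatrix M.1 - φ.mapMatrix M.1 + 1 = 0 := by
  have hCH : M.1 * M.1 - (M.1.trace • (1 : Matrix (Fin 2) (Fin 2) ℤ[X])) * M.1 + 1 = 0 := by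
    have hdet := M.2
    rw [Matrix.det_fin_two] at hdet
    ext i j : 1
    fin_cases i <;> fin_cases j <;>
      simp [Matrix.mul_apply, Fin.sum_univ_two, Matrix.trace_fin_two]
    · linear_combination -hdet
    · ring
    · ring
    · linear_combination -hdet
  have hone : φ.mapMatrix (M.1.trace • (1 : Matrix (Fin 2) (Fin 2) ℤ[X])) = 1 := by
    ext i j : 2
    by_cases h : i = j
    · subst h
      simp [hφ]
    · simp [h]
  have := congrArg φ.mapMatrix hCH
  rwa [map_add, map_sub, map_mul, map_mul, hone, one_mul, map_one, map_zero] at this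

/-- Block diagonal matrices with an even number of equal blocks. -/
def repeatBlock (κ : Type) [Fintype κ] [DecidableEq κ] (q : ℕ) :
    (Matrix κ κ ℤ)ˣ →* Matrix.SpecialLinearGroup (κ × Fin (2 * q)) ℤ where
  toFun A := ⟨Matrix.blockDiagonal fun _ => A.1, by
    rw [Matrix.det_blockDiagonal, Finset.prod_const, Finset.card_univ, Fintype.card_fin, pow_mul,
      Int.isUnit_sq ((Matrix.isUnit_iff_isUnit_det _).1 A.isUnit), one_pow]⟩
  map_one' := Subtype.ext Matrix.blockDiagonal_one
  map_mul' A B := Subtype.ext (Matrix.blockDiagonal_mul (fun _ => A.1) fun _ => B.1)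

theorem exists_hasOrderSixValues {t : ℕ} (w : FreeGroup (Fin t)) (hw : w ≠ 1) :
    ∃ k, 0 < k ∧ HasOrderSixValues w k := by
  obtain ⟨g, hg, hg'⟩ := exists_trace_lift w hw
  obtain ⟨r, hr, φ, hφ⟩ := exists_ringHom_matrix hg hg'
  let Ψ : Matrix (Fin 2) (Fin 2) ℤ[X] →+* Matrix (Fin 2 × Fin r) (Fin 2 × Fin r) ℤ :=
    (Matrix.compRingEquiv (Fin 2) (Fin r) ℤ).toRingHom.comp φ.mapMatrix
  let ρ : SL(2, ℤ[X]) →* (Matrix (Fin 2 × Fin r) (Fin 2 × Fin r) ℤ)ˣ :=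
    (Units.map (Ψ : _ →* _)).comp Matrix.SpecialLinearGroup.toGL
  have hA : (ρ (FreeGroup.lift g w)).1 * (ρ (FreeGroup.lift g w)).1 -
      (ρ (FreeGroup.lift g w)).1 + 1 = 0 := by
    have := congrArg (Matrix.compRingEquiv (Fin 2) (Fin r) ℤ) (sq_sub_self_add_one_of_ringHom hφ)
    rwa [map_add, map_sub, map_mul, map_one, map_zero] at this
  have hAw : ρ (FreeGroup.lift g w) ∈ wordImage w _ := map_mem_wordImage ρ ⟨g, rfl⟩
  generalize ρ (FreeGroup.lift g w) = A at hA hAw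
  obtain ⟨R, hR⟩ := exists_conj_eq_inv A hA
  refine ⟨2 * r * 2, by positivity, fun q => ⟨_, inferInstance, inferInstance,
    repeatBlock (Fin 2 × Fin r) q A, ?_, ?_, map_mem_wordImage _ hAw, ?_⟩⟩
  · simp
    ring
  · have := congrArg (Matrix.blockDiagonalRingHom (Fin 2 × Fin r) (Fin (2 * q)) ℤ)
      (show (fun _ => A.1 * A.1 - A.1 + 1) = (0 : Fin (2 * q) → _) from funext fun _ => hA)
    rw [map_zero] at this
    rw [← this]
    change _ = Matrix.blockDiagonalRingHom (Fin 2 × Fin r) (Fin (2 * q)) ℤ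
      ((fun _ => A.1) * (fun _ => A.1) - (fun _ => A.1) + 1)
    generalize hF : (fun _ : Fin (2 * q) => A.1) = F
    have hr : (repeatBlock (Fin 2 × Fin r) q A).1 =
        Matrix.blockDiagonalRingHom (Fin 2 × Fin r) (Fin (2 * q)) ℤ F := by
      rw [← hF]
      rfl
    rw [map_add, map_sub, map_mul, map_one, hr]
  · rw [← map_inv, ← hR]
    exact map_mem_wordImage _ (conj_mem_wordImage hAw R)

end Values

/-- Avni–Meiri. There is a constant `C` (which can be taken to be `87`)
such that for every nontrivial word `w` there is `d(w)` such that for all `d > d(w)`, every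
element of `SL_d(ℤ)` is a product of at most `C` elements of `w(SL_d(ℤ))`. -/
theorem SL_word_width_bounded :
    ∃ C : ℕ, C ≤ 87 ∧ ∀ (t : ℕ) (w : FreeGroup (Fin t)), w ≠ 1 →
      ∃ dw : ℕ, ∀ d : ℕ, dw < d →
        ∀ g : Matrix.SpecialLinearGroup (Fin d) ℤ,
          ∃ m : ℕ, m ≤ C ∧
            g ∈ wordImage w (Matrix.SpecialLinearGroup (Fin d) ℤ) ^ m := by
  refine ⟨86, by norm_num, fun t w hw => ?_⟩
  obtain ⟨k, hk, h⟩ := exists_hasOrderSixValues w hw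
  exact ⟨2 * k + 50, fun d hd g => ⟨86, le_rfl, h.mem_wordImage_pow hk hd g⟩⟩
end

section
/- Let w be an element of the free group F_2 on two generators with w ∉ [F_2, F_2] (w is not in the commutator subgroup). Then there exists a positive integer N such that for all n ≥ N, the word map w: SU(n) × SU(n) → SU(n) is surjective. -/
/-- The special unitary group `SU(n)`, as the kernel of the determinant on the unitary
group of `n × n` complex matrices. -/
noncomputable def SU (n : ℕ) : Subgroup (Matrix.unitaryGroup (Fin n) ℂ) :=
  MonoidHom.ker (Matrix.detMonoidHom.comp (unitary (Matrix (Fin n) (Fin n) ℂ)).subtype)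

open scoped Matrix.Norms.L2Operator in
/-- A unitary matrix is the exponential of `I • H` for some Hermitian matrix `H`. -/
theorem Matrix.unitaryGroup.exists_isHermitian_exp {ι : Type*} [Fintype ι] [DecidableEq ι]
    (A : Matrix.unitaryGroup ι ℂ) :
    ∃ H : Matrix ι ι ℂ, H.IsHermitian ∧ NormedSpace.exp (Complex.I • H) = (A : Matrix ι ι ℂ) := by
  have hcont (f : ℂ → ℂ) : ContinuousOn f (spectrum ℂ (A : Matrix ι ι ℂ)) :=
    (Matrix.finite_spectrum _).continuousOn f
  have hH : IsSelfAdjoint (cfc (Complex.ofReal ∘ Complex.arg) (A : Matrix ι ι ℂ)) :=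
    IsSelfAdjoint.cfc_arg _
  refine ⟨cfc (Complex.ofReal ∘ Complex.arg) (A : Matrix ι ι ℂ), hH, ?_⟩
  have hA : IsStarNormal (A : Matrix ι ι ℂ) := inferInstance
  rw [← CFC.exp_eq_normedSpace_exp (𝕜 := ℂ), ← cfc_comp_smul Complex.I _ _,
    ← cfc_comp _ _ _ hA (by rw [← Complex.exp_eq_exp_ℂ]; fun_prop) (hcont _)]
  conv_rhs => rw [← cfc_id ℂ (A : Matrix ι ι ℂ)]
  refine cfc_congr fun z hz ↦ ?_
  have hz1 : ‖z‖ = 1 := spectrum.norm_eq_one_of_unitary A.2 hz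
  have key := Complex.norm_mul_exp_arg_mul_I z
  rw [hz1, Complex.ofReal_one, one_mul, mul_comm] at key
  simpa [← Complex.exp_eq_exp_ℂ] using key

/-- Diagonal matrices with entries on the unit circle, as unitary matrices. -/
noncomputable def Matrix.unitaryGroup.diagonal (ι : Type*) [Fintype ι] [DecidableEq ι] :
    (ι → Circle) →* Matrix.unitaryGroup ι ℂ where
  toFun z := ⟨Matrix.diagonal fun i ↦ (z i : ℂ), by
    rw [Matrix.mem_unitaryGroup_iff, Matrix.star_eq_conjTranspose, Matrix.diagonal_conjTranspose,
      Matrix.diagonal_mul_diagonal, ← Matrix.diagonal_one]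
    congr 1
    ext i
    simp [Complex.mul_conj]⟩
  map_one' := Subtype.ext (by simp)
  map_mul' y z := Subtype.ext (by simp)

/-- Spectral theorem for unitary matrices. -/
theorem Matrix.unitaryGroup.exists_eq_conj_diagonal {ι : Type*} [Fintype ι] [DecidableEq ι]
    (A : Matrix.unitaryGroup ι ℂ) :
    ∃ (U : Matrix.unitaryGroup ι ℂ) (z : ι → Circle),
      A = U * Matrix.unitaryGroup.diagonal ι z * U⁻¹ := by
  obtain ⟨H, hH, hA⟩ := exists_isHermitian_exp A
  refine ⟨hH.eigenvectorUnitary, fun i ↦ Circle.exp (hH.eigenvalues i), Subtype.ext ?_⟩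
  rw [← hA]
  conv_lhs => rw [hH.spectral_theorem]
  rw [← map_smul, Unitary.conjStarAlgAut_apply]
  refine (Matrix.exp_units_conj (Unitary.toUnits hH.eigenvectorUnitary) _).trans ?_
  rw [← Matrix.diagonal_smul, Matrix.exp_diagonal]
  change _ * Matrix.diagonal _ * _ = _ * Matrix.diagonal _ * _
  congr 3
  ext i
  rw [Pi.coe_exp, ← Complex.exp_eq_exp_ℂ]
  simp [Circle.coe_exp, mul_comm]

theorem Matrix.unitaryGroup.det_diagonal {ι : Type*} [Fintype ι] [DecidableEq ι]
    (z : ι → Circle) :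
    (Matrix.unitaryGroup.diagonal ι z : Matrix ι ι ℂ).det = ((∏ i, z i : Circle) : ℂ) := by
  exact Matrix.det_diagonal.trans (map_prod Circle.coeHom z Finset.univ).symm

theorem Circle.exists_zpow_eq {d : ℤ} (hd : d ≠ 0) (z : Circle) : ∃ r : Circle, r ^ d = z := by
  refine ⟨Circle.exp (Complex.arg z / d), ?_⟩
  rw [← Circle.exp_zsmul, zsmul_eq_mul, mul_div_cancel₀ _ (by exact_mod_cast hd), Circle.exp_arg]

theorem Circle.exists_pi_zpow_eq_prod_eq_one {ι : Type*} [Fintype ι] [DecidableEq ι] [Nonempty ι]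
    {d : ℤ} (hd : d ≠ 0) (z : ι → Circle) (hz : ∏ i, z i = 1) :
    ∃ r : ι → Circle, r ^ d = z ∧ ∏ i, r i = 1 := by
  choose r hr using fun i ↦ Circle.exists_zpow_eq hd (z i)
  obtain ⟨j⟩ := ‹Nonempty ι›
  have hc : (∏ i, r i) ^ d = 1 := by simp_rw [← Finset.prod_zpow, hr, hz]
  refine ⟨r * Pi.mulSingle j (∏ i, r i)⁻¹, ?_, ?_⟩
  · rw [mul_zpow, ← Pi.mulSingle_zpow, inv_zpow, hc, inv_one, Pi.mulSingle_one, mul_one]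
    exact funext hr
  · simp [Finset.prod_mul_distrib]

theorem SU.exists_zpow_eq {n : ℕ} [NeZero n] {d : ℤ} (hd : d ≠ 0) (g : SU n) :
    ∃ h : SU n, h ^ d = g := by
  obtain ⟨U, z, hA⟩ := Matrix.unitaryGroup.exists_eq_conj_diagonal g.1
  have hconj (y : Fin n → Circle) :
      U * Matrix.unitaryGroup.diagonal _ y * U⁻¹ ∈ SU n ↔ ∏ i, y i = 1 := by
    simp only [SU]
    rw [MonoidHom.mem_ker, map_mul, map_mul, mul_right_comm, ← map_mul, mul_inv_cancel, map_one,
      one_mul, ← Circle.coe_eq_one, ← Matrix.unitaryGroup.det_diagonal]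
    rfl
  obtain ⟨r, hr, hr1⟩ := Circle.exists_pi_zpow_eq_prod_eq_one hd z ((hconj z).1 (hA ▸ g.2))
  refine ⟨⟨_, (hconj r).2 hr1⟩, Subtype.ext ?_⟩
  rw [Subgroup.coe_zpow, conj_zpow, ← map_zpow, hr, hA]

/-- The exponent sum of the generator `i`. -/
def FreeGroup.exponentSum {α : Type*} [DecidableEq α] (i : α) :
    FreeGroup α →* Multiplicative ℤ :=
  FreeGroup.lift (Pi.mulSingle i (Multiplicative.ofAdd 1))

theorem FreeGroup.lift_mulSingle {α G : Type*} [DecidableEq α] [Group G] (i : α) (g : G)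
    (w : FreeGroup α) :
    FreeGroup.lift (Pi.mulSingle i g) w = g ^ (FreeGroup.exponentSum i w).toAdd := by
  have h : FreeGroup.lift (Pi.mulSingle i g) =
      (zpowersHom G g).comp (FreeGroup.exponentSum i) := by
    ext j
    obtain rfl | hj := eq_or_ne j i
    · simp [FreeGroup.exponentSum]
    · simp [FreeGroup.exponentSum, hj]
  rw [h]
  rfl

theorem FreeGroup.mem_commutator_of_exponentSum_eq_one {α : Type*} [Fintype α] [DecidableEq α]
    {w : FreeGroup α} (hw : ∀ i, FreeGroup.exponentSum i w = 1) :
    w ∈ commutator (FreeGroup α) := by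
  have h : Abelianization.of = ∏ i, (zpowersHom (Abelianization (FreeGroup α))
      (Abelianization.of (FreeGroup.of i))).comp (FreeGroup.exponentSum i) := by
    ext j
    rw [MonoidHom.finsetProd_apply, Finset.prod_eq_single j]
    · simp [FreeGroup.exponentSum]
    · intro i _ hi
      simp [FreeGroup.exponentSum, hi.symm]
    · simp
  rw [← Abelianization.ker_of, MonoidHom.mem_ker, h, MonoidHom.finsetProd_apply]
  exact Finset.prod_eq_one fun i _ ↦ by simp [hw i]

/-- Elkasapy–Thom. If `w ∈ F₂` is not in the commutator subgroup
`[F₂, F₂]`, then the word map `w : SU(n) × SU(n) → SU(n)` is surjective for all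
sufficiently large `n`. -/
theorem word_map_surjective_on_SU (w : FreeGroup (Fin 2))
    (hw : w ∉ commutator (FreeGroup (Fin 2))) :
    ∃ N : ℕ, ∀ n : ℕ, N ≤ n →
      Function.Surjective (fun p : SU n × SU n => FreeGroup.lift ![p.1, p.2] w) := by
  obtain ⟨i, hi⟩ : ∃ i, FreeGroup.exponentSum i w ≠ 1 := by
    contrapose! hw
    exact FreeGroup.mem_commutator_of_exponentSum_eq_one hw
  refine ⟨1, fun n hn g ↦ ?_⟩
  have : NeZero n := ⟨by omega⟩
  obtain ⟨h, rfl⟩ := SU.exists_zpow_eq (d := (FreeGroup.exponentSum i w).toAdd) hi g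
  let v : Fin 2 → SU n := Pi.mulSingle i h
  refine ⟨(v 0, v 1), ?_⟩
  have hv : ![v 0, v 1] = v := by
    funext j
    fin_cases j <;> rfl
  change FreeGroup.lift ![v 0, v 1] w = _
  rw [hv, FreeGroup.lift_mulSingle]
end
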